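/- Let q be a prime power and n ≥ 3. Then (q,n) ∈ B(3,2), except possibly when: n = 3 and (q ≤ 37 with q ≠ 8, or q ∈ {43, 49, 61, 67, 71, 79, 81, 121, 151, 211, 331}); n = 4 and (q ≤ 37 or q ∈ {41, 43, 47, 83}); n = 5 and q ∈ {3, 4, 5, 7, 9, 11, 16}; n = 6 and q ∈ {2, 3, 4, 5, 7, 9, 11, 13, 19}; n = 7 and q ∈ {3, 4, 8}; n = 8 and q ∈ {2, 3, 4, 5, 7, 9}; q = 2 and n ∈ {9, 10, 12, 14, 15, 16, 18, 20, 24}; q = 3 and n ∈ {9, 10, 12, 16}; q = 4 and n ∈ {9, 10, 12}; or (q,n) ∈ {(5,12), (7,12)}. Moreover, (2,3), (2,4), (2,6), (3,3), (3,4) ∉ B(3,2). -/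

import Mathlib

open Polynomial

noncomputable section

/-- An element of a finite field is *primitive* if it generates the multiplicative group. -/
def IsPrimitiveElem {L : Type} [Field L] [Fintype L] (α : L) : Prop :=
  orderOf α = Fintype.card L - 1

/-- `β` is a *normal element* of `L` over `K`, where `n = [L : K]`:
the conjugates `β, β^q, …, β^(q^(n-1))` form a `K`-basis of `L`. -/
def IsNormalElem (K : Type) {L : Type} [Field K] [Fintype K] [Field L] [Algebra K L]
    (n : ℕ) (β : L) : Prop :=
  LinearIndependent K (fun i : Fin n => β ^ Fintype.card K ^ (i : ℕ)) ∧
    Submodule.span K (Set.range fun i : Fin n => β ^ Fintype.card K ^ (i : ℕ)) = ⊤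

/-- The set `Υ_Q(m₁, m₂)` of rational functions over the field `F` with `Q` elements. -/
def Upsilon (F : Type) [Field F] [Fintype F] (m₁ m₂ : ℕ) : Set (RatFunc F) :=
  {f | ∃ f₁ f₂ : F[X], f₂ ≠ 0 ∧
      f = algebraMap F[X] (RatFunc F) f₁ / algebraMap F[X] (RatFunc F) f₂ ∧
      f₁.natDegree ≤ m₁ ∧ f₂.natDegree ≤ m₂ ∧ IsCoprime f₁ f₂ ∧
      ∃ (k : ℕ) (g : F[X]), 0 < k ∧ g.Monic ∧ Irreducible g ∧ g ≠ X ∧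
        Nat.gcd k (Fintype.card F - 1) = 1 ∧
        g ^ k ∣ f₁ * f₂ ∧ ¬ g ^ (k + 1) ∣ f₁ * f₂}

/-- Evaluation of a rational function at a point of the same field (`0` if undefined). -/
def ratEval {F : Type} [Field F] (f : RatFunc F) (α : F) : F :=
  f.eval (RingHom.id F) α

/-- `α` is `s`-free. -/
def IsFree {F : Type} [Field F] (s : ℕ) (α : F) : Prop :=
  α ≠ 0 ∧ ∀ d : ℕ, d ∣ s → d ≠ 1 → ¬ ∃ β : F, β ^ d = α

/-- The `F_q[x]`-module action `h ∘ β = ∑ hᵢ β^(qⁱ)` on `L`. -/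
def polyAct {K L : Type} [Field K] [Fintype K] [Field L] [Algebra K L]
    (h : K[X]) (β : L) : L :=
  h.sum fun i a => algebraMap K L a * β ^ Fintype.card K ^ i

/-- `α` is `g`-free with respect to the `F_q[x]`-module structure of `L`. -/
def IsPolyFree (K : Type) {L : Type} [Field K] [Fintype K] [Field L] [Algebra K L]
    (g : K[X]) (α : L) : Prop :=
  ∀ h : K[X], h.Monic → h ∣ g → (∃ lam : L, α = polyAct h lam) → h = 1

/-- `N_f(e₁, e₂, g)`: the number of `α ∈ L` such that `α` is `e₁`-free,
`f(α)` is `e₂`-free and `α` is `g`-free. -/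
def NElems (K : Type) {L : Type} [Field K] [Fintype K] [Field L] [Fintype L] [Algebra K L]
    (f : RatFunc L) (e₁ e₂ : ℕ) (g : K[X]) : ℕ :=
  Nat.card {α : L | IsFree e₁ α ∧ IsFree e₂ (ratEval f α) ∧ IsPolyFree K g α}

/-- `W(ℓ)`: the number of squarefree divisors of `ℓ`. -/
def Wnat (ℓ : ℕ) : ℕ := (ℓ.divisors.filter Squarefree).card

/-- `W_q(g)`: the number of monic squarefree divisors of `g` in `F_q[x]`. -/
def Wpoly {K : Type} [Field K] (g : K[X]) : ℕ :=
  Nat.card {h : K[X] // h.Monic ∧ Squarefree h ∧ h ∣ g}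

/-- `Φ(g) = |(F_q[x]/(g))ˣ|`. -/
def PhiPoly {K : Type} [Field K] (g : K[X]) : ℕ :=
  Nat.card ((K[X] ⧸ Ideal.span ({g} : Set K[X]))ˣ)

/-- `(q, n) ∈ B(m₁, m₂)`: for every `f ∈ Υ_{qⁿ}(m₁, m₂)` there is a primitive element
`α` of `F_{qⁿ}`, normal over `F_q`, with `f(α)` also primitive. -/
def memB (m₁ m₂ q n : ℕ) : Prop :=
  ∀ (K L : Type) [Field K] [Field L] [Fintype K] [Fintype L] [Algebra K L],
    Fintype.card K = q → Fintype.card L = q ^ n →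
    ∀ f ∈ Upsilon L m₁ m₂,
      ∃ α : L, IsPrimitiveElem α ∧ IsNormalElem K n α ∧ IsPrimitiveElem (ratEval f α)

/-- `𝔑(q, n)`: the number of primitive elements of `F_{qⁿ}` that are normal over `F_q`. -/
def NNum (K L : Type) [Field K] [Fintype K] [Field L] [Fintype L] [Algebra K L] (n : ℕ) : ℕ :=
  Nat.card {α : L | IsPrimitiveElem α ∧ IsNormalElem K n α}

end

/-- degree bound for a determinant by columns -/
lemma natDegree_det_le_cols {R : Type*} [CommRing R] {ι : Type*} [Fintype ι] [DecidableEq ι]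
    (M : Matrix ι ι R[X]) (d : ι → ℕ) (h : ∀ i j, (M i j).natDegree ≤ d j) :
    M.det.natDegree ≤ ∑ j, d j := by
  rw [Matrix.det_apply]
  refine natDegree_sum_le_of_forall_le _ _ (fun σ _ => ?_)
  have h1 : (∏ i, M (σ i) i).natDegree ≤ ∑ j, d j :=
    (natDegree_prod_le _ _).trans (Finset.sum_le_sum fun i _ => h _ _)
  have h2 : (Equiv.Perm.sign σ • ∏ i, M (σ i) i).natDegree = (∏ i, M (σ i) i).natDegree := by
    rcases Int.units_eq_one_or (Equiv.Perm.sign σ) with h | h <;> simp [h]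
  rw [h2]; exact h1

lemma natDegree_resultant_le {R : Type*} [CommRing R] (f g : R[X][X]) (m n a b : ℕ)
    (hf : ∀ i, (f.coeff i).natDegree ≤ a) (hg : ∀ i, (g.coeff i).natDegree ≤ b) :
    (resultant f g m n).natDegree ≤ m * b + n * a := by
  refine (natDegree_det_le_cols _ (fun j => Fin.addCases (fun _ => b) (fun _ => a) j) ?_).trans ?_
  · intro i j
    refine Fin.addCases (fun j => ?_) (fun j => ?_) j
    · simp only [sylvester, Matrix.of_apply, Fin.addCases_left]
      split_ifs
      · exact hg _
      · simp
    · simp only [sylvester, Matrix.of_apply, Fin.addCases_right]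
      split_ifs
      · exact hf _
      · simp
  · rw [Fin.sum_univ_add]; simp

/-- The key local argument -/
lemma stepanov_local {E : Type*} [Field E] (p s r D h A : ℕ) [Fact p.Prime] [CharP E p]
    (hs : s = p ^ r) (hD : 0 < D) (hDs : D ∣ s - 1) (H : E[X]) (hH : H.natDegree ≤ h)
    (τ : E) (hτ : H.eval τ ≠ 0)
    (hirr : ∀ κ : E, κ ≠ 0 → ∀ P : E[X][X], P ≠ 0 → P.natDegree < D →
      resultant P (C H * X ^ D - C (C κ)) (D - 1) D ≠ 0)
    (B : Fin D → E[X]) (hB : ∀ i, (B i).natDegree ≤ A) (hbd : (D - 1) * h + D * A < s)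
    (hdiv : (X - C τ) ^ s ∣ ∑ i, B i * (H ^ ((s - 1) / D)) ^ (i : ℕ)) : ∀ i, B i = 0 := by
  by_contra hne
  push Not at hne
  obtain ⟨i0, hi0⟩ := hne
  have hs1 : 1 ≤ s := by rw [hs]; exact Nat.one_le_pow _ _ (Fact.out : p.Prime).pos
  set V := H ^ ((s - 1) / D) with hV
  let P : E[X][X] := ∑ i : Fin D, C (B i) * X ^ (i : ℕ)
  have hPc : ∀ k, P.coeff k = if hk : k < D then B ⟨k, hk⟩ else 0 := by
    intro k
    simp only [P, finset_sum_coeff, coeff_C_mul, coeff_X_pow, mul_ite, mul_one, mul_zero]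
    split_ifs with hk
    · rw [Finset.sum_eq_single ⟨k, hk⟩] <;> simp
      intro b hb hh
      exfalso; apply hb; ext; simp [hh]
    · apply Finset.sum_eq_zero
      intro i _
      rw [if_neg]; intro h; exact hk (h ▸ i.2)
  have hP0 : P ≠ 0 := by
    intro h0
    have := hPc i0
    rw [h0] at this
    simp at this
    exact hi0 this.symm
  have hPd : P.natDegree < D := by
    rw [natDegree_lt_iff_degree_lt hP0, degree_lt_iff_coeff_zero]
    intro m hm
    rw [hPc, dif_neg (by simpa using hm)]
  set κ := (H.eval τ) ^ s with hκ
  have hκ0 : κ ≠ 0 := pow_ne_zero _ hτ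
  have hres := hirr κ hκ0 P hP0 hPd
  set G : E[X][X] := C H * X ^ D - C (C κ) with hG
  have hGd : G.natDegree ≤ D := by
    rw [hG]
    refine (natDegree_sub_le _ _).trans (max_le ?_ ?_)
    · exact natDegree_C_mul_X_pow_le _ _
    · simp
  obtain ⟨u, v, -, -, huv⟩ := exists_mul_add_mul_eq_C_resultant (m := D - 1) (n := D) P G
    (by omega) hGd (by omega)
  have hdeg : (resultant P G (D-1) D).natDegree ≤ (D-1) * h + D * A := by
    apply natDegree_resultant_le
    · intro k; rw [hPc]; split_ifs
      · exact hB _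
      · simp
    · intro k
      rw [hG]
      simp only [coeff_sub, coeff_C_mul, coeff_X_pow, coeff_C]
      refine (natDegree_sub_le _ _).trans (max_le ?_ ?_)
      · split_ifs <;> simp [hH]
      · split_ifs <;> simp
  have hd1 : (X - C τ) ^ s ∣ P.eval V := by
    have : P.eval V = ∑ i, B i * V ^ (i : ℕ) := by
      simp [P, eval_finset_sum]
    rw [this]; exact hdiv
  have hd2 : (X - C τ) ^ s ∣ G.eval V := by
    have : G.eval V = (H - C (H.eval τ)) ^ s := by
      have hch : CharP E[X] p := inferInstance
      rw [hG]
      simp only [eval_sub, eval_mul, eval_C, eval_pow, eval_X]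
      rw [hs, sub_pow_char_pow, ← hs, hV, ← pow_mul, Nat.div_mul_cancel hDs, ← pow_succ',
        Nat.sub_add_cancel hs1, ← C_pow]
    rw [this]
    apply pow_dvd_pow_of_dvd
    rw [dvd_iff_isRoot]; simp
  have hd3 : (X - C τ) ^ s ∣ resultant P G (D-1) D := by
    have := congrArg (eval V) huv
    rw [eval_add, eval_mul, eval_mul, eval_C] at this
    rw [← this]
    exact dvd_add (hd1.mul_right _) (hd2.mul_right _)
  have := natDegree_le_of_dvd hd3 hres
  rw [natDegree_pow, natDegree_X_sub_C] at this
  omega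

theorem stepanov_count {E : Type*} [Field E] [Fintype E] [DecidableEq E] (p s r D h A J : ℕ)
    [Fact p.Prime] [CharP E p] (hs : s = p ^ r) (hcard : Fintype.card E = s ^ 2)
    (hD : 0 < D) (hDs : D ∣ s - 1) (H : E[X]) (hH : H.natDegree ≤ h) (hH0 : H ≠ 0)
    (hirr : ∀ κ : E, κ ≠ 0 → ∀ P : E[X][X], P ≠ 0 → P.natDegree < D →
      resultant P (C H * X ^ D - C (C κ)) (D - 1) D ≠ 0)
    (hA : 0 < A) (hJ : 0 < J)
    (hbd : (D - 1) * h + D * A < s) (hJs : J + h ≤ s ^ 2)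
    (hdim : (A - 1) * s + (D - 1) * (h * ((s - 1) / D)) + J < D * J * A) (ζ : E) :
    (Finset.univ.filter fun z : E => H.eval z ≠ 0 ∧ (H.eval z) ^ ((s ^ 2 - 1) / D) = ζ).card
      ≤ A + (D - 1) * (h * ((s - 1) / D)) + (J - 1) * s := by
  have hs1 : 1 ≤ s := by rw [hs]; exact Nat.one_le_pow _ _ (Fact.out : p.Prime).pos
  set e := (s - 1) / D with he
  have heD : e * D = s - 1 := Nat.div_mul_cancel hDs
  have hee : (s ^ 2 - 1) / D = e * (s + 1) := by
    have : s ^ 2 - 1 = D * (e * (s + 1)) := by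
      obtain ⟨t, rfl⟩ : ∃ t, s = t + 1 := ⟨s - 1, by omega⟩
      have : e * D = t := by simpa using heD
      rw [← mul_assoc, mul_comm D e, this]
      have : (t+1)^2 = t * (t + 1 + 1) + 1 := by ring
      omega
    rw [this, Nat.mul_div_cancel_left _ hD]
  set V := H ^ e with hV
  have hVd : V.natDegree ≤ h * e := by
    rw [hV, natDegree_pow, mul_comm]; exact Nat.mul_le_mul_right _ hH
  set M := (A - 1) * s + (D - 1) * (h * e) + J with hM
  let Φ : (Fin D × Fin J × Fin A → E) → E[X] := fun b =>
    ∑ x : Fin D × Fin J × Fin A,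
      C (b x) * (C (ζ ^ (x.1 : ℕ)) * X ^ ((x.2.2 : ℕ) * s + x.2.1) * V ^ (D - 1 - x.1))
  have hΦd : ∀ b, (Φ b).degree < M := by
    intro b
    refine lt_of_le_of_lt (degree_sum_le _ _) ?_
    rw [Finset.sup_lt_iff (by rw [bot_lt_iff_ne_bot]; exact WithBot.coe_ne_bot)]
    intro x _
    refine lt_of_le_of_lt degree_le_natDegree ?_
    norm_cast
    have h1 : (V ^ (D - 1 - (x.1 : ℕ))).natDegree ≤ (D - 1) * (h * e) := by
      refine natDegree_pow_le.trans ?_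
      exact Nat.mul_le_mul (by omega) hVd
    have h2 : ((x.2.2 : ℕ) * s + x.2.1) < (A - 1) * s + J := by
      have := x.2.2.2
      have := x.2.1.2
      have : (x.2.2 : ℕ) * s ≤ (A - 1) * s := Nat.mul_le_mul_right _ (by omega)
      omega
    have h3 := natDegree_C_mul_le (b x)
      (C (ζ ^ (x.1 : ℕ)) * X ^ ((x.2.2 : ℕ) * s + x.2.1) * V ^ (D - 1 - x.1))
    have h4 := natDegree_mul_le (p := C (ζ ^ (x.1 : ℕ)) * X ^ ((x.2.2 : ℕ) * s + x.2.1))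
      (q := V ^ (D - 1 - (x.1 : ℕ)))
    have h5 := natDegree_C_mul_X_pow_le (ζ ^ (x.1 : ℕ)) ((x.2.2 : ℕ) * s + x.2.1)
    omega
  let Λ : (Fin D × Fin J × Fin A → E) →ₗ[E] (Fin M → E) :=
    { toFun := fun b k => (Φ b).coeff k
      map_add' := by
        intro b c; ext k
        simp only [Φ, Pi.add_apply, map_add, add_mul, Finset.sum_add_distrib, coeff_add]
      map_smul' := by
        intro t b; ext k
        simp only [Φ, Pi.smul_apply, smul_eq_mul, map_mul, mul_assoc, ← Finset.mul_sum,
          coeff_C_mul, RingHom.id_apply] }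
  have hker : LinearMap.ker Λ ≠ ⊥ := by
    apply LinearMap.ker_ne_bot_of_finrank_lt
    simp only [Module.finrank_fintype_fun_eq_card, Fintype.card_prod, Fintype.card_fin]
    rw [← mul_assoc]; exact hdim
  obtain ⟨b, hbk, hb0⟩ := Submodule.exists_mem_ne_zero_of_ne_bot hker
  have hΦb : Φ b = 0 := by
    ext k
    by_cases hk : k < M
    · have := congrFun (LinearMap.mem_ker.mp hbk) ⟨k, hk⟩
      simpa [Λ] using this
    · rw [coeff_zero]
      exact coeff_eq_zero_of_degree_lt ((hΦd b).trans_le (by exact_mod_cast not_lt.mp hk))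
  -- s-th roots
  have hinj : Function.Injective (fun x : E => x ^ s) := by
    rw [hs]; exact (iterateFrobenius E p r).injective
  have hsurj : Function.Surjective (fun x : E => x ^ s) := Finite.surjective_of_injective hinj
  choose rt hrt using hsurj
  simp only at hrt
  let a : Fin D × Fin J × Fin A → E := fun x => rt (b x)
  have hab : ∀ x, a x ^ s = b x := fun x => hrt _
  let U : E[X] := ∑ i : Fin D, (∑ j : Fin J, ∑ l : Fin A,
     C (a (i, j, l)) * X ^ (l : ℕ) * (X ^ s) ^ (j : ℕ)) * V ^ (i : ℕ)
  have hXs : ∀ τ : E, (X - C τ : E[X]) ^ s = X ^ s - C (τ ^ s) := by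
    intro τ; rw [hs, sub_pow_char_pow, C_pow]
  have hU0 : U ≠ 0 := by
    intro hU
    apply hb0
    have key : ∀ τ : E, H.eval τ ≠ 0 → ∀ i, ∑ j : Fin J, ∑ l : Fin A,
        C (a (i, j, l)) * X ^ (l : ℕ) * C (τ ^ s) ^ (j : ℕ) = 0 := by
      intro τ hτ
      refine stepanov_local p s r D h A hs hD hDs H hH τ hτ hirr _ ?_ hbd ?_
      · intro i
        refine natDegree_sum_le_of_forall_le _ _ fun j _ =>
          natDegree_sum_le_of_forall_le _ _ fun l _ => ?_
        rw [← C_pow]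
        refine (natDegree_mul_C_le _ _).trans ?_
        refine (natDegree_C_mul_X_pow_le _ _).trans l.2.le
      · rw [← he, ← hV]
        have h1 : (X - C τ) ^ s ∣ ∑ i : Fin D, (∑ j : Fin J, ∑ l : Fin A,
            (C (a (i, j, l)) * X ^ (l : ℕ) * C (τ ^ s) ^ (j : ℕ) -
              C (a (i, j, l)) * X ^ (l : ℕ) * (X ^ s) ^ (j : ℕ))) * V ^ (i : ℕ) := by
          refine Finset.dvd_sum fun i _ => Dvd.dvd.mul_right (Finset.dvd_sum fun j _ =>
            Finset.dvd_sum fun l _ => ?_) _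
          rw [← mul_sub]
          refine Dvd.dvd.mul_left ?_ _
          rw [hXs]
          have := sub_dvd_pow_sub_pow (X ^ s) (C (τ ^ s)) (j : ℕ)
          exact (dvd_sub_comm).mp this
        have h2 : ∑ i : Fin D, (∑ j : Fin J, ∑ l : Fin A,
            (C (a (i, j, l)) * X ^ (l : ℕ) * C (τ ^ s) ^ (j : ℕ) -
              C (a (i, j, l)) * X ^ (l : ℕ) * (X ^ s) ^ (j : ℕ))) * V ^ (i : ℕ)
            = ∑ i : Fin D, (∑ j : Fin J, ∑ l : Fin A,
            (C (a (i, j, l)) * X ^ (l : ℕ) * C (τ ^ s) ^ (j : ℕ))) * V ^ (i : ℕ) - U := by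
          simp only [U, Finset.sum_sub_distrib, sub_mul]
        rw [h2, hU, sub_zero] at h1
        exact h1
    funext x
    obtain ⟨i, j, l⟩ := x
    rw [← hab, Pi.zero_apply]
    rw [pow_eq_zero_iff (by omega)]
    -- polynomial in τ^s
    let P : E[X] := ∑ j : Fin J, C (a (i, j, l)) * X ^ (j : ℕ)
    have hPd : P.degree < J := by
      refine lt_of_le_of_lt (degree_sum_le _ _) ?_
      rw [Finset.sup_lt_iff (by rw [bot_lt_iff_ne_bot]; exact WithBot.coe_ne_bot)]
      intro j _
      exact (degree_C_mul_X_pow_le _ _).trans_lt (by exact_mod_cast j.2)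
    have hPz : P = 0 := by
      let S := (Finset.univ.filter fun z : E => H.eval z ≠ 0).image (fun x => x ^ s)
      have hSc : J ≤ S.card := by
        rw [Finset.card_image_of_injective _ hinj]
        have h1 : (Finset.univ.filter fun z : E => ¬ (H.eval z ≠ 0)).card ≤ h := by
          have : (Finset.univ.filter fun z : E => ¬ (H.eval z ≠ 0)) ⊆ H.roots.toFinset := by
            intro z hz
            simp at hz
            simp [hH0, hz]
          exact (Finset.card_le_card this).trans
            ((Multiset.toFinset_card_le _).trans ((card_roots' _).trans hH))
        have h2 := Finset.card_filter_add_card_filter_not (s := (Finset.univ : Finset E))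
          (fun z => H.eval z ≠ 0)
        rw [Finset.card_univ, hcard] at h2
        omega
      apply eq_zero_of_degree_lt_of_eval_finset_eq_zero S
        (hPd.trans_le (by exact_mod_cast hSc))
      intro y hy
      simp only [S, Finset.mem_image, Finset.mem_filter, Finset.mem_univ, true_and] at hy
      obtain ⟨τ, hτ, rfl⟩ := hy
      have := congrArg (fun q => coeff q (l : ℕ)) (key τ hτ i)
      simp only [finsetSum_coeff, ← C_pow, coeff_mul_C, coeff_C_mul, coeff_X_pow, coeff_zero] at this
      rw [← this]
      simp only [P, eval_finsetSum, eval_mul, eval_C, eval_pow, eval_X]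
      refine Finset.sum_congr rfl fun j _ => ?_
      rw [Finset.sum_eq_single l]
      · simp
      · intro l' _ hl'
        rw [if_neg, mul_zero, zero_mul]
        intro hh; exact hl' (Fin.ext hh.symm)
      · simp
    have := congrArg (fun q => coeff q (j : ℕ)) hPz
    simp only [P, finsetSum_coeff, coeff_C_mul, coeff_X_pow, coeff_zero] at this
    rw [Finset.sum_eq_single j] at this
    · simpa using this
    · intro l' _ hl'
      rw [if_neg, mul_zero]
      intro hh; exact hl' (Fin.ext hh.symm)
    · simp
  have hUd : U.natDegree ≤ A + (D - 1) * (h * e) + (J - 1) * s := by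
    refine natDegree_sum_le_of_forall_le _ _ fun i _ => ?_
    have h1 : (V ^ (i : ℕ)).natDegree ≤ (D - 1) * (h * e) := by
      refine natDegree_pow_le.trans ?_
      exact Nat.mul_le_mul (by omega) hVd
    refine natDegree_mul_le.trans ?_
    have h2 : (∑ j : Fin J, ∑ l : Fin A,
     C (a (i, j, l)) * X ^ (l : ℕ) * (X ^ s) ^ (j : ℕ)).natDegree ≤ A + (J - 1) * s := by
      refine natDegree_sum_le_of_forall_le _ _ fun j _ =>
          natDegree_sum_le_of_forall_le _ _ fun l _ => ?_
      refine natDegree_mul_le.trans ?_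
      have h3 := natDegree_C_mul_X_pow_le (a (i, j, l)) (l : ℕ)
      have h4 : ((X ^ s : E[X]) ^ (j : ℕ)).natDegree ≤ (J - 1) * s := by
        rw [← pow_mul, natDegree_X_pow, mul_comm]
        exact Nat.mul_le_mul_right _ (by omega)
      have := l.2
      omega
    omega
  have hsub : (Finset.univ.filter fun z : E => H.eval z ≠ 0 ∧
      (H.eval z) ^ ((s ^ 2 - 1) / D) = ζ) ⊆ U.roots.toFinset := by
    intro z hz
    simp only [Finset.mem_filter, Finset.mem_univ, true_and] at hz
    obtain ⟨hz0, hz1⟩ := hz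
    simp only [Multiset.mem_toFinset, mem_roots hU0, IsRoot.def]
    set v := V.eval z with hv
    have hv0 : v ≠ 0 := by
      rw [hv, hV, eval_pow]; exact pow_ne_zero _ hz0
    have hvs : v ^ (s + 1) = ζ := by
      rw [hv, hV, eval_pow, ← pow_mul, ← hee, hz1]
    have hzz : (z ^ s) ^ s = z := by
      rw [← pow_mul, ← sq, ← hcard, FiniteField.pow_card]
    have h1 : (U.eval z) ^ s * v ^ (D - 1) = (Φ b).eval z := by
      have hch : ExpChar E p := ExpChar.prime Fact.out
      simp only [U, Φ, eval_finsetSum, eval_mul, eval_C, eval_pow, eval_X]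
      rw [Fintype.sum_prod_type, hs, sum_pow_char_pow, ← hs, Finset.sum_mul]
      refine Finset.sum_congr rfl fun i _ => ?_
      rw [Fintype.sum_prod_type, mul_pow, hs, sum_pow_char_pow, ← hs, Finset.sum_mul,
        Finset.sum_mul]
      refine Finset.sum_congr rfl fun j _ => ?_
      rw [hs, sum_pow_char_pow, ← hs, Finset.sum_mul, Finset.sum_mul]
      refine Finset.sum_congr rfl fun l _ => ?_
      rw [← hab, ← hv, ← hvs]
      have hi : v ^ (D - 1) = v ^ (D - 1 - (i:ℕ)) * v ^ (i : ℕ) := by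
        rw [← pow_add]; congr 1; omega
      have hz3 : ((z ^ s) ^ (j : ℕ)) ^ s = z ^ (j : ℕ) := by
        rw [← pow_mul, mul_comm, pow_mul, hzz]
      rw [mul_pow, mul_pow, hz3, hi]
      ring
    rw [hΦb, eval_zero] at h1
    rcases mul_eq_zero.mp h1 with h | h
    · exact pow_eq_zero_iff (by omega) |>.mp h
    · exact absurd h (pow_ne_zero _ hv0)
  exact (Finset.card_le_card hsub).trans
    ((Multiset.toFinset_card_le _).trans ((card_roots' _).trans hUd))

lemma kummer_irr_aux {K Ω : Type*} [Field K] [Field Ω] [Algebra K Ω] [IsAlgClosed Ω] (D : ℕ) (hD : 0 < D) (ζ : K) (hζ : IsPrimitiveRoot ζ D)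
    (a : K) (ha : a ≠ 0) (hno : ∀ ℓ : ℕ, ℓ.Prime → ℓ ∣ D → ∀ b : K, b ^ ℓ ≠ a) :
    Irreducible (X ^ D - C a : K[X]) := by
  have hmon : (X ^ D - C a : K[X]).Monic := monic_X_pow_sub_C a hD.ne'
  obtain ⟨θ, hθ⟩ : ∃ θ : Ω, θ ^ D = algebraMap K Ω a :=
    IsAlgClosed.exists_pow_nat_eq _ hD
  have hθ0 : θ ≠ 0 := by
    rintro rfl
    rw [zero_pow hD.ne'] at hθ
    exact ha (by simpa using hθ.symm)
  have hInt : IsIntegral K θ := ⟨_, hmon, by simp [hθ]⟩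
  set m := minpoly K θ with hm
  have hdvd : m ∣ X ^ D - C a := minpoly.dvd _ _ (by simp [hθ])
  set e := m.natDegree with he
  have he0 : 0 < e := minpoly.natDegree_pos hInt
  have heD : e ≤ D := by
    have := natDegree_le_of_dvd hdvd hmon.ne_zero
    rwa [natDegree_X_pow_sub_C] at this
  rcases heD.lt_or_eq with hlt | heq
  · exfalso
    have hroots : ∀ S : Multiset Ω, (∀ r ∈ S, r ^ D = algebraMap K Ω a) →
        ∃ c : K, c ≠ 0 ∧ S.prod = algebraMap K Ω c * θ ^ (Multiset.card S) := by
      intro S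
      induction S using Multiset.induction with
      | empty => intro _; exact ⟨1, one_ne_zero, by simp⟩
      | cons r S ih =>
        intro hS
        obtain ⟨c, hc, hc'⟩ := ih (fun r hr => hS r (Multiset.mem_cons_of_mem hr))
        have hr := hS r (Multiset.mem_cons_self _ _)
        have h1 : (r / θ) ^ D = 1 := by
          rw [div_pow, hr, hθ, div_self]; simpa using ha
        have hζ' : IsPrimitiveRoot (algebraMap K Ω ζ) D := hζ.map_of_injective
          (algebraMap K Ω).injective
        have : NeZero D := ⟨hD.ne'⟩
        obtain ⟨i, -, hi⟩ := hζ'.eq_pow_of_pow_eq_one h1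
        refine ⟨ζ ^ i * c, mul_ne_zero (pow_ne_zero _ (hζ.ne_zero hD.ne')) hc, ?_⟩
        rw [Multiset.prod_cons, hc', Multiset.card_cons, map_mul, map_pow, hi]
        field_simp
        ring
    have hsp : (m.map (algebraMap K Ω)).Splits := IsAlgClosed.splits _
    have hmm : (m.map (algebraMap K Ω)).Monic := (minpoly.monic hInt).map _
    obtain ⟨c, hc, hc'⟩ := hroots (m.map (algebraMap K Ω)).roots (by
      intro r hr
      have h1 : (m.map (algebraMap K Ω)).IsRoot r := (mem_roots'.mp hr).2
      have h2 : (algebraMap K Ω a) = r ^ D := by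
        have : ((X ^ D - C a : K[X]).map (algebraMap K Ω)).IsRoot r :=
          h1.dvd (Polynomial.map_dvd (algebraMap K Ω) hdvd)
        simp [IsRoot.def, sub_eq_zero] at this
        exact this.symm
      exact h2.symm)
    have hcard : Multiset.card (m.map (algebraMap K Ω)).roots = e := by
      rw [← hsp.natDegree_eq_card_roots, natDegree_map]
    have hθe : θ ^ e ∈ (algebraMap K Ω).fieldRange := by
      have h1 := hsp.coeff_zero_eq_prod_roots_of_monic hmm
      rw [hc', hcard, coeff_map] at h1
      refine ⟨(-1) ^ (m.map (algebraMap K Ω)).natDegree * m.coeff 0 / c, ?_⟩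
      rw [map_div₀, map_mul, h1]
      simp only [map_pow, map_neg, map_one]
      have : algebraMap K Ω c ≠ 0 := by simpa using hc
      field_simp
      rw [← pow_mul, mul_comm, pow_mul]; simp
    have hθD : θ ^ D ∈ (algebraMap K Ω).fieldRange := ⟨a, hθ.symm⟩
    have hθg : θ ^ (Nat.gcd e D) ∈ (algebraMap K Ω).fieldRange := by
      have h1 : θ ^ (Nat.gcd e D) = (θ ^ e) ^ (Nat.gcdA e D) * (θ ^ D) ^ (Nat.gcdB e D) := by
        rw [← zpow_natCast, ← zpow_natCast, ← zpow_natCast, ← zpow_mul, ← zpow_mul, ← zpow_add₀ hθ0,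
          Nat.gcd_eq_gcd_ab]
      rw [h1]
      exact mul_mem (zpow_mem hθe _) (zpow_mem hθD _)
    set g := Nat.gcd e D with hg
    obtain ⟨t, ht⟩ : g ∣ D := Nat.gcd_dvd_right _ _
    have hge : g ≤ e := Nat.gcd_le_left _ he0
    have ht1 : t ≠ 1 := by rintro rfl; omega
    obtain ⟨ℓ, hℓ, u, hu⟩ := Nat.exists_prime_and_dvd ht1
    obtain ⟨b, hb⟩ := pow_mem hθg u
    apply hno ℓ hℓ ⟨g * u, by rw [ht, hu]; ring⟩ b
    apply (algebraMap K Ω).injective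
    rw [map_pow, ← hθ, ht, hu]
    have hb' : algebraMap K Ω b = (θ ^ g) ^ u := hb
    rw [hb', ← pow_mul, ← pow_mul]; congr 1; ring
  · have : m = X ^ D - C a := by
      symm
      apply eq_of_monic_of_dvd_of_natDegree_le (minpoly.monic hInt) hmon hdvd
      rw [natDegree_X_pow_sub_C]; exact heq.ge
    rw [← this]
    exact minpoly.irreducible hInt

lemma kummer_irr {K : Type*} [Field K] (D : ℕ) (hD : 0 < D) (ζ : K) (hζ : IsPrimitiveRoot ζ D)
    (a : K) (ha : a ≠ 0) (hno : ∀ ℓ : ℕ, ℓ.Prime → ℓ ∣ D → ∀ b : K, b ^ ℓ ≠ a) :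
    Irreducible (X ^ D - C a : K[X]) :=
  kummer_irr_aux (Ω := AlgebraicClosure K) D hD ζ hζ a ha hno

lemma resultant_ne_zero_of_mult_aux {E K : Type*} [Field E] [Field K] [Algebra E[X] K]
    [IsFractionRing E[X] K] (D : ℕ) (hD : 0 < D) (ζ : E)
    (hζ : IsPrimitiveRoot ζ D) (H : E[X]) (hH0 : H ≠ 0)
    (hmult : ∀ ℓ : ℕ, ℓ.Prime → ℓ ∣ D → ∃ π : E[X], Irreducible π ∧ ¬ ℓ ∣ multiplicity π H) :
    ∀ κ : E, κ ≠ 0 → ∀ P : E[X][X], P ≠ 0 → P.natDegree < D →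
      resultant P (C H * X ^ D - C (C κ)) (D - 1) D ≠ 0 := by
  intro κ hκ P hP hPd
  let φ := algebraMap E[X] K
  have hφ : Function.Injective φ := IsFractionRing.injective _ _
  have hφH : φ H ≠ 0 := by simpa [φ] using hH0
  have hirr : Irreducible (X ^ D - C (φ (C κ) / φ H) : K[X]) := by
    apply kummer_irr D hD (φ (C ζ)) (hζ.map_of_injective (f := φ.comp C) (hφ.comp C_injective))
    · refine div_ne_zero ?_ hφH
      simpa [φ] using hκ
    · intro ℓ hℓ hℓD b hb
      obtain ⟨π, hπ, hπℓ⟩ := hmult ℓ hℓ hℓD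
      obtain ⟨u, w, hw, rfl⟩ := IsFractionRing.div_surjective (A := E[X]) b
      have hw0 : w ≠ 0 := nonZeroDivisors.ne_zero hw
      have hφw : φ w ≠ 0 := by simpa [φ] using hw0
      have h1 : u ^ ℓ * H = C κ * w ^ ℓ := by
        apply hφ
        change (φ u / φ w) ^ ℓ = _ at hb
        simp only [map_mul, map_pow]
        rw [div_pow] at hb
        field_simp at hb
        rw [hb]; ring
      have hu0 : u ≠ 0 := by
        rintro rfl
        rw [zero_pow hℓ.ne_zero, zero_mul] at h1
        have := mul_ne_zero (C_ne_zero.mpr hκ) (pow_ne_zero ℓ hw0)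
        exact this h1.symm
      apply hπℓ
      have hfin : ∀ q : E[X], q ≠ 0 → FiniteMultiplicity π q := fun q hq =>
        FiniteMultiplicity.of_prime_left hπ.prime hq
      have h2 := congrArg (multiplicity π) h1
      rw [multiplicity_mul hπ.prime (hfin _ (mul_ne_zero (pow_ne_zero _ hu0) hH0)),
        multiplicity_mul hπ.prime (hfin _ (mul_ne_zero (C_ne_zero.mpr hκ) (pow_ne_zero _ hw0))),
        FiniteMultiplicity.multiplicity_pow hπ.prime (hfin _ hu0),
        FiniteMultiplicity.multiplicity_pow hπ.prime (hfin _ hw0)] at h2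
      have h3 : multiplicity π (C κ) = 0 := by
        apply multiplicity_eq_zero.mpr
        intro hd
        exact hπ.not_isUnit (isUnit_of_dvd_unit hd (isUnit_C.mpr (IsUnit.mk0 _ hκ)))
      rw [h3, zero_add] at h2
      have h4 : ℓ ∣ ℓ * multiplicity π u + multiplicity π H := by rw [h2]; exact dvd_mul_right _ _
      exact (Nat.dvd_add_right (dvd_mul_right _ _)).mp h4
  set G : E[X][X] := C H * X ^ D - C (C κ) with hG
  have hGm : G.map φ = C (φ H) * (X ^ D - C (φ (C κ) / φ H)) := by
    rw [hG, mul_sub, ← C_mul, mul_div_cancel₀ _ hφH]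
    simp
  have hGd : (G.map φ).natDegree = D := by
    rw [hGm, natDegree_C_mul hφH, natDegree_X_pow_sub_C]
  have hPm : P.map φ ≠ 0 := (Polynomial.map_ne_zero_iff hφ).mpr hP
  have hPmd : (P.map φ).natDegree = P.natDegree := natDegree_map_eq_of_injective hφ _
  have hcop : IsCoprime (P.map φ) (G.map φ) := by
    have hu : IsUnit (C (φ H) : K[X]) := isUnit_C.mpr (IsUnit.mk0 _ hφH)
    rw [hGm, isCoprime_mul_unit_left_right hu]
    rw [isCoprime_comm, hirr.coprime_iff_not_dvd]
    intro hd
    have := natDegree_le_of_dvd hd hPm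
    rw [natDegree_X_pow_sub_C] at this
    omega
  have h1 := resultant_ne_zero _ _ hcop
  intro h0
  have h2 : resultant (P.map φ) (G.map φ) (D - 1) D = 0 := by
    rw [resultant_map_map, h0, map_zero]
  obtain ⟨k, hk⟩ : ∃ k, D - 1 = (P.map φ).natDegree + k := ⟨D - 1 - P.natDegree, by omega⟩
  rw [hk, resultant_add_left_deg _ _ _ _ _ le_rfl] at h2
  rw [hGd] at h1
  have h3 : (G.map φ).coeff D ≠ 0 := by
    have : (G.map φ) ≠ 0 := by intro h; rw [h] at hGd; simp at hGd; omega
    have := leadingCoeff_ne_zero.mpr this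
    rwa [leadingCoeff, hGd] at this
  exact (mul_ne_zero (mul_ne_zero (pow_ne_zero _ (by simp)) (pow_ne_zero _ h3)) h1) h2

lemma resultant_ne_zero_of_mult {E : Type*} [Field E] (D : ℕ) (hD : 0 < D) (ζ : E)
    (hζ : IsPrimitiveRoot ζ D) (H : E[X]) (hH0 : H ≠ 0)
    (hmult : ∀ ℓ : ℕ, ℓ.Prime → ℓ ∣ D → ∃ π : E[X], Irreducible π ∧ ¬ ℓ ∣ multiplicity π H) :
    ∀ κ : E, κ ≠ 0 → ∀ P : E[X][X], P ≠ 0 → P.natDegree < D →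
      resultant P (C H * X ^ D - C (C κ)) (D - 1) D ≠ 0 :=
  resultant_ne_zero_of_mult_aux (K := RatFunc E) D hD ζ hζ H hH0 hmult

theorem stepanov_D {E : Type*} [Field E] [Fintype E] [DecidableEq E] (p s r D h : ℕ)
    [Fact p.Prime] [CharP E p] (hs : s = p ^ r) (hcard : Fintype.card E = s ^ 2)
    (hD : 0 < D) (hDs : D ∣ s - 1) (H : E[X]) (hH : H.natDegree ≤ h) (hH0 : H ≠ 0)
    (hirr : ∀ κ : E, κ ≠ 0 → ∀ P : E[X][X], P ≠ 0 → P.natDegree < D →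
      resultant P (C H * X ^ D - C (C κ)) (D - 1) D ≠ 0)
    (hbig : 100 * ((D + 1) * (h + 1)) ≤ s) (ζ : E) :
    D * (Finset.univ.filter fun z : E => H.eval z ≠ 0 ∧ (H.eval z) ^ ((s ^ 2 - 1) / D) = ζ).card
      ≤ s ^ 2 + (1 + D * h + D * (4 * h + 10)) * s := by
  set c := 4 * h + 10 with hc
  have hc0 : 0 < c := by omega
  set e := (s - 1) / D with he
  have heD : D * e = s - 1 := Nat.mul_div_cancel' hDs
  set A := s / (2 * D) with hA
  have hA1 : 2 * D * A ≤ s := Nat.mul_div_le _ _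
  have hA2 : s < 2 * D * A + 2 * D := by
    have := Nat.lt_mul_div_succ s (show 0 < 2 * D by omega)
    rw [← hA] at this; linarith
  have hbig' : 100 * (D * h) + 100 * D + 100 * h + 100 ≤ s := by linarith
  have hDA : D ≤ D * A := by
    have : 0 < A := Nat.div_pos (by omega) (by omega)
    exact Nat.le_mul_of_pos_right _ this
  have hA0 : 0 < A := Nat.div_pos (by omega) (by omega)
  have heds : e ≤ D * e := Nat.le_mul_of_pos_left _ hD
  have hAle : A ≤ D * A := Nat.le_mul_of_pos_left _ hD
  have hA3 : 2 * (D * A) ≤ s := by linarith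
  have hA4 : s < 2 * (D * A) + 2 * D := by linarith
  have hbd : (D - 1) * h + D * A < s := by
    have : (D - 1) * h ≤ D * h := Nat.mul_le_mul_right _ (by omega)
    omega
  have hhe : (D - 1) * (h * e) ≤ h * s := by
    calc (D - 1) * (h * e) ≤ D * (h * e) := Nat.mul_le_mul_right _ (by omega)
      _ = h * (D * e) := by ring
      _ ≤ h * s := Nat.mul_le_mul_left _ (by omega)
  have hes : e ≤ s := heds.trans (by rw [heD]; exact Nat.sub_le _ _)
  have hJs : e + c + h ≤ s ^ 2 := by
    have : s * 2 ≤ s * s := Nat.mul_le_mul_left _ (by omega)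
    have : c + h ≤ s := by omega
    rw [sq]; linarith
  have key := stepanov_count p s r D h A (e + c) hs hcard hD hDs H hH hH0 hirr hA0 (Nat.add_pos_right _ hc0) hbd
    hJs (by
      rw [← he]
      obtain ⟨A', hA'⟩ : ∃ A', A = A' + 1 := ⟨A - 1, by omega⟩
      have e1 : A - 1 = A' := by omega
      rw [e1]
      have e2 : D * (e + c) * A = (D * e) * A + c * (D * A) := by ring
      have e3 : D * e + 1 = s := by omega
      have e4 : (D * e) * A + A = s * A := by rw [← e3]; ring
      have e5 : s * A = A' * s + s := by rw [hA']; ring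
      rw [e2]
      have e6 : (4 * h + 10) * s ≤ (4 * h + 10) * (2 * (D * A) + 2 * D) :=
        Nat.mul_le_mul_left _ hA4.le
      have e7 : h * 100 ≤ h * s := Nat.mul_le_mul_left _ (by omega)
      have e8 : (4 * h + 10) * (2 * (D * A) + 2 * D) = 2 * (c * (D * A)) + 8 * (D * h) + 20 * D := by
        rw [hc]; ring
      have e9 : (4 * h + 10) * s = 4 * (h * s) + 10 * s := by ring
      omega) ζ
  refine (Nat.mul_le_mul_left D key).trans ?_
  rw [← he]
  have f1 : D * (A + (D - 1) * (h * e) + (e + c - 1) * s) =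
     D * A + D * ((D - 1) * (h * e)) + (D * e + D * (c - 1)) * s := by
    rw [Nat.add_sub_assoc hc0]; ring
  rw [f1, heD]
  have f2 : D * ((D - 1) * (h * e)) ≤ D * (h * s) := Nat.mul_le_mul_left _ hhe
  have f3 : (s - 1) * s ≤ s ^ 2 := by rw [sq]; exact Nat.mul_le_mul_right _ (by omega)
  have f4 : D * (c - 1) * s ≤ D * c * s :=
    Nat.mul_le_mul_right _ (Nat.mul_le_mul_left _ (by omega))
  have f5 : D * A ≤ s := by omega
  nlinarith

theorem stepanov_charsum {E : Type*} [Field E] [Fintype E] [DecidableEq E] (p s r D h : ℕ)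
    [Fact p.Prime] [CharP E p] (hs : s = p ^ r) (hcard : Fintype.card E = s ^ 2)
    (hD : 0 < D) (hDs : D ∣ s - 1) (H : E[X]) (hH : H.natDegree ≤ h) (hH0 : H ≠ 0)
    (hmult : ∀ ℓ : ℕ, ℓ.Prime → ℓ ∣ D → ∃ π : E[X], Irreducible π ∧ ¬ ℓ ∣ multiplicity π H)
    (hbig : 100 * ((D + 1) * (h + 1)) ≤ s) (χ : MulChar E ℂ) (hχD : χ ^ D = 1) (hχ : χ ≠ 1) :
    ‖∑ z : E, χ (H.eval z)‖ ≤ (1 + D * h + D * (4 * h + 10) : ℕ) * (s : ℝ) + h := by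
  obtain ⟨g, hg⟩ := IsCyclic.exists_generator (α := Eˣ)
  have hgord : orderOf (g : E) = s ^ 2 - 1 := by
    rw [orderOf_units, orderOf_eq_card_of_forall_mem_zpowers hg, Nat.card_eq_fintype_card,
      Fintype.card_units, hcard]
  have hs1 : 1 < s := by nlinarith
  have hDs2 : D ∣ s ^ 2 - 1 := by
    have : s ^ 2 - 1 = (s + 1) * (s - 1) := by
      have := Nat.sq_sub_sq s 1; simpa using this
    rw [this]; exact hDs.mul_left _
  obtain ⟨e, he⟩ := hDs2
  have hs2 : 0 < s ^ 2 - 1 := by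
    have : 1 < s ^ 2 := Nat.one_lt_pow (by norm_num) hs1
    omega
  have he0 : 0 < e := by
    rcases Nat.eq_zero_or_pos e with h | h
    · rw [h] at he; omega
    · exact h
  have hediv : (s ^ 2 - 1) / D = e := by rw [he, Nat.mul_div_cancel_left _ hD]
  set ζ : E := (g : E) ^ e with hζ
  have hgprim : IsPrimitiveRoot (g : E) (D * e) := by
    rw [← he, ← hgord]; exact IsPrimitiveRoot.orderOf _
  have hζprim : IsPrimitiveRoot ζ D := hgprim.pow (by rw [← he]; omega) (by ring)
  set ω : ℂ := χ g with hω
  have hωD : ω ^ D = 1 := by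
    have := congrArg (fun ψ : MulChar E ℂ => ψ (g : E)) hχD
    simp only [MulChar.pow_apply_coe, MulChar.one_apply_coe] at this
    exact this
  have hω1 : ω ≠ 1 := by
    intro h1
    apply hχ
    ext u
    obtain ⟨k, hk⟩ := (mem_powers_iff_mem_zpowers (x := g) (y := u)).mpr (hg u)
    rw [← hk]
    simp only [Units.val_pow_eq_pow_val, map_pow, ← hω, h1]
    simp
  have hωn : ‖ω‖ = 1 := by
    have := congrArg norm hωD
    rw [norm_pow, norm_one] at this
    exact (pow_eq_one_iff_of_nonneg (norm_nonneg _) hD.ne').mp this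
  have hgeom : ∑ i ∈ Finset.range D, ω ^ i = 0 := by
    have := mul_geom_sum ω D
    rw [hωD, sub_self] at this
    exact (mul_eq_zero.mp this).resolve_left (sub_ne_zero.mpr hω1)
  set Z : ℕ → Finset E := fun i => Finset.univ.filter fun z : E =>
    H.eval z ≠ 0 ∧ (H.eval z) ^ ((s ^ 2 - 1) / D) = ζ ^ i with hZ
  have hZmem : ∀ z i, z ∈ Z i ↔ H.eval z ≠ 0 ∧ (H.eval z) ^ e = ζ ^ i := by
    intro z i; simp [hZ, hediv]
  have hpart : ∀ z, H.eval z ≠ 0 → ∃ i0 ∈ Finset.range D, χ (H.eval z) = ω ^ i0 ∧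
      ∀ i ∈ Finset.range D, z ∈ Z i ↔ i = i0 := by
    intro z hz
    obtain ⟨k, hk⟩ := (mem_powers_iff_mem_zpowers (x := g) (y := Units.mk0 _ hz)).mpr (hg _)
    have hk' : H.eval z = (g : E) ^ k := by
      have := congrArg Units.val hk
      simpa using this.symm
    refine ⟨k % D, Finset.mem_range.mpr (Nat.mod_lt _ hD), ?_, ?_⟩
    · rw [hk', map_pow, ← hω, ← pow_eq_pow_mod _ hωD]
    · intro i hi
      rw [hZmem]
      have h1 : (H.eval z) ^ e = ζ ^ (k % D) := by
        rw [← pow_eq_pow_mod _ hζprim.pow_eq_one, hk', hζ, ← pow_mul, ← pow_mul, mul_comm]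
      rw [h1]
      constructor
      · rintro ⟨-, h2⟩
        exact (hζprim.pow_inj (Nat.mod_lt _ hD) (Finset.mem_range.mp hi) h2).symm
      · rintro rfl; exact ⟨hz, rfl⟩
  have hsum : ∑ z : E, χ (H.eval z) = ∑ i ∈ Finset.range D, ω ^ i * ((Z i).card : ℂ) := by
    have h1 : ∀ z, χ (H.eval z) = ∑ i ∈ Finset.range D, if z ∈ Z i then ω ^ i else 0 := by
      intro z
      by_cases hz : H.eval z = 0
      · rw [hz, χ.map_zero, Finset.sum_eq_zero]
        intro i _
        rw [if_neg]; rw [hZmem]; simp [hz]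
      · obtain ⟨i0, hi0, h2, h3⟩ := hpart z hz
        rw [h2, Finset.sum_eq_single_of_mem i0 hi0]
        · rw [if_pos ((h3 i0 hi0).mpr rfl)]
        · intro i hi hne
          rw [if_neg]; rw [h3 i hi]; exact hne
    simp_rw [h1]
    rw [Finset.sum_comm]
    refine Finset.sum_congr rfl fun i _ => ?_
    rw [Finset.sum_ite_mem, Finset.univ_inter, Finset.sum_const, nsmul_eq_mul, mul_comm]
  have hcnt : s ^ 2 ≤ h + ∑ i ∈ Finset.range D, (Z i).card := by
    rw [← hcard, ← Finset.card_univ]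
    have h1 : (Finset.univ : Finset E) ⊆ H.roots.toFinset ∪ (Finset.range D).biUnion Z := by
      intro z _
      by_cases hz : H.eval z = 0
      · apply Finset.mem_union_left; simp [hH0, hz]
      · obtain ⟨i0, hi0, h2, h3⟩ := hpart z hz
        apply Finset.mem_union_right
        rw [Finset.mem_biUnion]; exact ⟨i0, hi0, (h3 i0 hi0).mpr rfl⟩
    refine (Finset.card_le_card h1).trans ((Finset.card_union_le _ _).trans ?_)
    refine Nat.add_le_add ?_ Finset.card_biUnion_le
    exact (Multiset.toFinset_card_le _).trans ((card_roots' _).trans hH)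
  set Bd : ℕ := s ^ 2 + (1 + D * h + D * (4 * h + 10)) * s with hBd
  have hN : ∀ i, D * (Z i).card ≤ Bd := by
    intro i
    exact stepanov_D p s r D h hs hcard hD hDs H hH hH0
      (resultant_ne_zero_of_mult D hD ζ hζprim H hH0 hmult) hbig _
  have hDR : (0 : ℝ) < D := by exact_mod_cast hD
  have hN' : ∀ i, ((Z i).card : ℝ) ≤ Bd / D := by
    intro i
    rw [le_div_iff₀ hDR, mul_comm]; exact_mod_cast hN i
  have hsum2 : ∑ z : E, χ (H.eval z) =
      ∑ i ∈ Finset.range D, ω ^ i * (((Z i).card : ℂ) - ((Bd / D : ℝ) : ℂ)) := by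
    rw [hsum]
    simp only [mul_sub, Finset.sum_sub_distrib, ← Finset.sum_mul, hgeom, zero_mul, sub_zero]
  rw [hsum2]
  refine (norm_sum_le _ _).trans ?_
  have h1 : ∀ i ∈ Finset.range D, ‖ω ^ i * (((Z i).card : ℂ) - ((Bd / D : ℝ) : ℂ))‖ =
      (Bd / D - (Z i).card : ℝ) := by
    intro i _
    rw [norm_mul, norm_pow, hωn, one_pow, one_mul, norm_sub_rev]
    have : (((Bd / D : ℝ) : ℂ) - ((Z i).card : ℂ)) = ((Bd / D - (Z i).card : ℝ) : ℂ) := by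
      push_cast; rfl
    rw [this, Complex.norm_real, Real.norm_of_nonneg (sub_nonneg.mpr (hN' i))]
  rw [Finset.sum_congr rfl h1, Finset.sum_sub_distrib, Finset.sum_const, Finset.card_range,
    nsmul_eq_mul, mul_div_cancel₀ _ hDR.ne']
  have h2 : ((s ^ 2 : ℕ) : ℝ) ≤ h + ∑ i ∈ Finset.range D, ((Z i).card : ℝ) := by
    exact_mod_cast hcnt
  rw [hBd]
  push_cast at h2 ⊢
  linarith

noncomputable section LfunDefs
open Classical in
/-- all polynomials of degree at most `n` over a finite field -/
def polysLE (F : Type*) [Field F] [Fintype F] (n : ℕ) : Finset F[X] :=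
  Finset.univ.image (fun c : Fin (n + 1) → F => ∑ i, C (c i) * X ^ (i : ℕ))

lemma mem_polysLE {F : Type*} [Field F] [Fintype F] {n : ℕ} {f : F[X]} :
    f ∈ polysLE F n ↔ f.natDegree ≤ n := by
  simp only [polysLE, Finset.mem_image, Finset.mem_univ, true_and]
  constructor
  · rintro ⟨c, rfl⟩
    refine natDegree_sum_le_of_forall_le _ _ fun i _ => ?_
    exact (natDegree_C_mul_X_pow_le _ _).trans (by omega)
  · intro h
    refine ⟨fun i => f.coeff i, ?_⟩
    conv_rhs => rw [f.as_sum_range_C_mul_X_pow' (Nat.lt_succ_of_le h)]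
    rw [Finset.sum_range]

open Classical in
/-- monic polynomials of degree `n` -/
def monF (F : Type*) [Field F] [Fintype F] (n : ℕ) : Finset F[X] :=
  (polysLE F n).filter fun f => f.Monic ∧ f.natDegree = n

open Classical in
/-- monic irreducible polynomials of degree at most `n` -/
def irrF (F : Type*) [Field F] [Fintype F] (n : ℕ) : Finset F[X] :=
  (polysLE F n).filter fun f => f.Monic ∧ Irreducible f

lemma mem_monF {F : Type*} [Field F] [Fintype F] {n : ℕ} {f : F[X]} :
    f ∈ monF F n ↔ f.Monic ∧ f.natDegree = n := by
  simp only [monF, Finset.mem_filter, mem_polysLE]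
  constructor
  · rintro ⟨-, h⟩; exact h
  · rintro ⟨h1, h2⟩; exact ⟨h2.le, h1, h2⟩

lemma mem_irrF {F : Type*} [Field F] [Fintype F] {n : ℕ} {f : F[X]} :
    f ∈ irrF F n ↔ f.natDegree ≤ n ∧ f.Monic ∧ Irreducible f := by
  simp [irrF, mem_polysLE]

/-- coefficient of the L-function -/
def Lcoef {F : Type*} [Field F] [Fintype F] (lam : F[X] → ℂ) (n : ℕ) : ℂ :=
  ∑ h ∈ monF F n, lam h

/-- prime power sums -/
def Lpow {F : Type*} [Field F] [Fintype F] (lam : F[X] → ℂ) (j : ℕ) : ℂ :=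
  ∑ π ∈ (irrF F j).filter (fun π => π.natDegree ∣ j),
    (π.natDegree : ℂ) * lam π ^ (j / π.natDegree)

end LfunDefs

lemma natDegree_eq_sum_mult {F : Type*} [Field F] [Fintype F] {n : ℕ} {h : F[X]}
    (hm : h.Monic) (hn : h.natDegree = n) :
    n = ∑ π ∈ irrF F n, π.natDegree * multiplicity π h := by
  classical
  have h0 : h ≠ 0 := hm.ne_zero
  let S := UniqueFactorizationMonoid.normalizedFactors h
  have hS : S.prod = h := by
    rw [UniqueFactorizationMonoid.prod_normalizedFactors_eq h0, hm.normalize_eq_self]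
  have hSm : ∀ π ∈ S, π.Monic := by
    intro π hπ
    have := UniqueFactorizationMonoid.normalize_normalized_factor π hπ
    have hne := (UniqueFactorizationMonoid.irreducible_of_normalized_factor π hπ).ne_zero
    rw [← this]; exact monic_normalize hne
  have h1 : n = (S.map natDegree).sum := by
    rw [← hn, ← hS]
    exact natDegree_multiset_prod_of_monic _ hSm
  refine h1.trans ?_
  rw [Finset.sum_multiset_map_count]
  have hsub : S.toFinset ⊆ irrF F n := by
    intro π hπ
    rw [Multiset.mem_toFinset] at hπ
    have hirr := UniqueFactorizationMonoid.irreducible_of_normalized_factor π hπ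
    refine mem_irrF.mpr ⟨?_, hSm π hπ, hirr⟩
    rw [← hn]
    exact natDegree_le_of_dvd (UniqueFactorizationMonoid.dvd_of_mem_normalizedFactors hπ) h0
  have hcm : ∀ π ∈ irrF F n, multiplicity π h = S.count π := by
    intro π hπ
    obtain ⟨-, h2, h3⟩ := mem_irrF.mp hπ
    have := UniqueFactorizationMonoid.emultiplicity_eq_count_normalizedFactors h3 h0
    rw [h2.normalize_eq_self] at this
    exact multiplicity_eq_of_emultiplicity_eq_some this
  rw [Finset.sum_subset hsub]
  · refine Finset.sum_congr rfl fun π hπ => ?_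
    rw [hcm π hπ, smul_eq_mul, mul_comm]
  · intro π _ hπ
    rw [Multiset.mem_toFinset] at hπ
    rw [Multiset.count_eq_zero_of_notMem hπ, zero_smul]

lemma mult_eq_card {F : Type*} [Field F] {n : ℕ} {h π : F[X]} [DecidablePred fun e => π ^ e ∣ h]
    (hm : h.Monic) (hn : h.natDegree = n) (hπ : Irreducible π) :
    multiplicity π h = ((Finset.Icc 1 n).filter fun e => π ^ e ∣ h).card := by
  have hfin : FiniteMultiplicity π h := FiniteMultiplicity.of_prime_left hπ.prime hm.ne_zero
  have hle : multiplicity π h ≤ n := by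
    have h1 := natDegree_le_of_dvd (pow_multiplicity_dvd π h) hm.ne_zero
    rw [natDegree_pow, hn] at h1
    have h2 := hπ.natDegree_pos
    nlinarith
  have : ((Finset.Icc 1 n).filter fun e => π ^ e ∣ h) = Finset.Icc 1 (multiplicity π h) := by
    ext e
    simp only [Finset.mem_filter, Finset.mem_Icc]
    rw [hfin.pow_dvd_iff_le_multiplicity]
    omega
  rw [this]; simp

theorem Lnewton {F : Type*} [Field F] [Fintype F] (lam : F[X] → ℂ) (h1 : lam 1 = 1)
    (hmul : ∀ f g : F[X], f.Monic → g.Monic → lam (f * g) = lam f * lam g) (n : ℕ) :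
    (n : ℂ) * Lcoef lam n = ∑ j ∈ Finset.Icc 1 n, Lpow lam j * Lcoef lam (n - j) := by
  classical
  have hpow : ∀ (f : F[X]) (e : ℕ), f.Monic → lam (f ^ e) = lam f ^ e := by
    intro f e hf
    induction e with
    | zero => simp [h1]
    | succ e ih => rw [pow_succ, pow_succ, hmul _ _ (hf.pow e) hf, ih]
  -- sum over multiples
  have hA : ∀ π ∈ irrF F n, ∀ e ∈ Finset.Icc 1 n,
      ∑ h ∈ (monF F n).filter (fun h => π ^ e ∣ h), lam h =
        if e * π.natDegree ≤ n then lam π ^ e * Lcoef lam (n - e * π.natDegree) else 0 := by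
    intro π hπ e _
    obtain ⟨-, hπm, hπi⟩ := mem_irrF.mp hπ
    split_ifs with hle
    · rw [Lcoef, Finset.mul_sum]
      symm
      refine Finset.sum_bij (fun g _ => π ^ e * g) ?_ ?_ ?_ ?_
      · intro g hg
        obtain ⟨hg1, hg2⟩ := mem_monF.mp hg
        refine Finset.mem_filter.mpr ⟨mem_monF.mpr ⟨(hπm.pow e).mul hg1, ?_⟩, dvd_mul_right _ _⟩
        rw [(hπm.pow e).natDegree_mul hg1, hπm.natDegree_pow, hg2]; omega
      · intro g _ g' _ hgg
        exact mul_left_cancel₀ (hπm.pow e).ne_zero hgg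
      · intro h hh
        obtain ⟨hh1, g, rfl⟩ := Finset.mem_filter.mp hh
        obtain ⟨hh2, hh3⟩ := mem_monF.mp hh1
        have hgm : g.Monic := (hπm.pow e).of_mul_monic_left hh2
        refine ⟨g, mem_monF.mpr ⟨hgm, ?_⟩, rfl⟩
        rw [(hπm.pow e).natDegree_mul hgm, hπm.natDegree_pow] at hh3
        omega
      · intro g hg
        obtain ⟨hg1, hg2⟩ := mem_monF.mp hg
        rw [hmul _ _ (hπm.pow e) hg1, hpow _ _ hπm]
    · rw [Finset.filter_eq_empty_iff.mpr, Finset.sum_empty]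
      intro h hh hd
      obtain ⟨hh2, hh3⟩ := mem_monF.mp hh
      have := natDegree_le_of_dvd hd hh2.ne_zero
      rw [hπm.natDegree_pow] at this
      omega
  have hL : (n : ℂ) * Lcoef lam n = ∑ π ∈ irrF F n, ∑ e ∈ Finset.Icc 1 n,
      (π.natDegree : ℂ) * (if e * π.natDegree ≤ n then
        lam π ^ e * Lcoef lam (n - e * π.natDegree) else 0) := by
    have e1 : ∀ h ∈ monF F n, (n : ℂ) * lam h = ∑ π ∈ irrF F n, ∑ e ∈ Finset.Icc 1 n,
        (π.natDegree : ℂ) * (if π ^ e ∣ h then lam h else 0) := by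
      intro h hh
      obtain ⟨hh2, hh3⟩ := mem_monF.mp hh
      conv_lhs => rw [natDegree_eq_sum_mult hh2 hh3]
      push_cast
      rw [Finset.sum_mul]
      refine Finset.sum_congr rfl fun π hπ => ?_
      obtain ⟨-, hπm, hπi⟩ := mem_irrF.mp hπ
      rw [mult_eq_card hh2 hh3 hπi, ← Finset.mul_sum, mul_assoc]
      congr 1
      rw [← Finset.sum_filter, Finset.sum_const, nsmul_eq_mul]
    rw [Lcoef, Finset.mul_sum, Finset.sum_congr rfl e1, Finset.sum_comm]
    refine Finset.sum_congr rfl fun π hπ => ?_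
    rw [Finset.sum_comm]
    refine Finset.sum_congr rfl fun e he => ?_
    rw [← Finset.mul_sum, ← Finset.sum_filter, hA π hπ e he]
  rw [hL]
  have hR : ∀ j ∈ Finset.Icc 1 n, Lpow lam j * Lcoef lam (n - j) =
      ∑ π ∈ irrF F n, if π.natDegree ∣ j then
        (π.natDegree : ℂ) * lam π ^ (j / π.natDegree) * Lcoef lam (n - j) else 0 := by
    intro j hj
    rw [Finset.mem_Icc] at hj
    rw [← Finset.sum_filter, Lpow, Finset.sum_mul]
    refine Finset.sum_congr ?_ fun _ _ => rfl
    ext π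
    simp only [Finset.mem_filter, mem_irrF]
    constructor
    · rintro ⟨⟨a, b⟩, c⟩; exact ⟨⟨by omega, b⟩, c⟩
    · rintro ⟨⟨a, b⟩, c⟩; exact ⟨⟨Nat.le_of_dvd (by omega) c, b⟩, c⟩
  rw [Finset.sum_congr rfl hR]
  conv_rhs => rw [Finset.sum_comm]
  refine Finset.sum_congr rfl fun π hπ => ?_
  obtain ⟨-, hπm, hπi⟩ := mem_irrF.mp hπ
  have hd := hπi.natDegree_pos
  have e2 : ∀ e, (π.natDegree : ℂ) * (if e * π.natDegree ≤ n then
        lam π ^ e * Lcoef lam (n - e * π.natDegree) else 0) = if e * π.natDegree ≤ n then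
        (π.natDegree : ℂ) * (lam π ^ e * Lcoef lam (n - e * π.natDegree)) else 0 := by
    intro e; split_ifs <;> simp
  simp_rw [e2]
  rw [← Finset.sum_filter, ← Finset.sum_filter]
  refine Finset.sum_bij (fun e _ => e * π.natDegree) ?_ ?_ ?_ ?_
  · intro e he
    simp only [Finset.mem_filter, Finset.mem_Icc] at he ⊢
    refine ⟨⟨?_, he.2⟩, dvd_mul_left _ _⟩
    exact Nat.mul_pos (by omega) hd
  · intro a _ b _ hab
    exact Nat.eq_of_mul_eq_mul_right hd hab
  · intro j hj
    simp only [Finset.mem_filter, Finset.mem_Icc] at hj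
    obtain ⟨⟨hj1, hj2⟩, e, rfl⟩ := hj
    refine ⟨e, ?_, mul_comm _ _⟩
    simp only [Finset.mem_filter, Finset.mem_Icc]
    have : 0 < e := Nat.pos_of_ne_zero (by rintro rfl; simp at hj1)
    refine ⟨⟨this, ?_⟩, by rw [mul_comm]; exact hj2⟩
    nlinarith
  · intro e _
    rw [Nat.mul_div_cancel _ hd, mul_assoc]

lemma newton_roots (m : ℕ) (c S : ℕ → ℂ) (hc0 : c 0 = 1) (hc : ∀ n, m < n → c n = 0)
    (hN : ∀ n : ℕ, (n : ℂ) * c n = ∑ j ∈ Finset.Icc 1 n, S j * c (n - j)) :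
    ∃ ω : Fin m → ℂ, ∀ k, 1 ≤ k → S k = - ∑ i, ω i ^ k := by
  let P : ℂ[X] := ∑ n ∈ Finset.range (m + 1), C (c n) * X ^ (m - n)
  have hcoef : ∀ n, n ≤ m → P.coeff (m - n) = c n := by
    intro n hn
    simp only [P, finsetSum_coeff, coeff_C_mul, coeff_X_pow]
    rw [Finset.sum_eq_single n]
    · simp
    · intro b hb hbn
      rw [Finset.mem_range] at hb
      rw [if_neg (by omega), mul_zero]
    · intro h; simp at h; omega
  have hdeg : P.natDegree ≤ m := by
    refine natDegree_sum_le_of_forall_le _ _ fun i _ => ?_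
    exact (natDegree_C_mul_X_pow_le _ _).trans (by omega)
  have hlead : P.coeff m = 1 := by simpa [hc0] using hcoef 0 (Nat.zero_le _)
  have hdeg' : P.natDegree = m := natDegree_eq_of_le_of_coeff_ne_zero hdeg (by rw [hlead]; simp)
  have hmon : P.Monic := by rw [Monic, leadingCoeff, hdeg', hlead]
  have hcard : P.roots.card = P.natDegree := (IsAlgClosed.splits P).natDegree_eq_card_roots.symm
  have hlen : P.roots.toList.length = m := by rw [Multiset.length_toList, hcard, hdeg']
  let ω : Fin m → ℂ := fun i => P.roots.toList.get (i.cast hlen.symm)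
  have hω : (Finset.univ.val.map ω) = P.roots := by
    have h1 : List.ofFn ω = P.roots.toList := by
      refine List.ext_get (by simp [hlen]) ?_
      intro n h1 h2
      simp [ω]
    have h2 : (Finset.univ.val.map ω) = ((List.ofFn ω : List ℂ) : Multiset ℂ) := by
      rw [List.ofFn_eq_map]; rfl
    rw [h2, h1, Multiset.coe_toList]
  have hes : ∀ n, MvPolynomial.aeval ω (MvPolynomial.esymm (Fin m) ℂ n) = (-1) ^ n * c n := by
    intro n
    rw [MvPolynomial.aeval_esymm_eq_multiset_esymm, hω]
    by_cases hn : n ≤ m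
    · have := Polynomial.coeff_eq_esymm_roots_of_card hcard (k := m - n) (by omega)
      rw [hcoef n hn, hmon.leadingCoeff, one_mul, hdeg', Nat.sub_sub_self hn] at this
      rw [this, ← mul_assoc, ← mul_pow]; simp
    · rw [hc n (by omega), mul_zero, Multiset.esymm, Multiset.powersetCard_eq_empty]
      · simp
      · rw [hcard, hdeg']; omega
  have hps : ∀ n, MvPolynomial.aeval ω (MvPolynomial.psum (Fin m) ℂ n) = ∑ i, ω i ^ n := by
    intro n; simp [MvPolynomial.psum]
  have hnew : ∀ k : ℕ, (k : ℂ) * c k = ∑ j ∈ Finset.Icc 1 k, (-∑ i, ω i ^ j) * c (k - j) := by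
    intro k
    have h := congrArg (MvPolynomial.aeval ω) (MvPolynomial.mul_esymm_eq_sum (Fin m) ℂ k)
    simp only [map_mul, map_natCast, map_pow, map_neg, map_one, map_sum, hes, hps] at h
    have h2 : ∑ x ∈ Finset.HasAntidiagonal.antidiagonal k with x.1 < k, (-1 : ℂ) ^ x.1 * ((-1) ^ x.1 * c x.1) *
        ∑ i, ω i ^ x.2 = ∑ j ∈ Finset.Icc 1 k, (∑ i, ω i ^ j) * c (k - j) := by
      refine Finset.sum_bij' (fun x _ => x.2) (fun j _ => (k - j, j)) ?_ ?_ ?_ ?_ ?_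
      · intro a ha; simp only [Finset.mem_filter, Finset.HasAntidiagonal.mem_antidiagonal, Finset.mem_Icc] at ha ⊢; omega
      · intro a ha; simp only [Finset.mem_filter, Finset.HasAntidiagonal.mem_antidiagonal, Finset.mem_Icc] at ha ⊢; omega
      · intro a ha
        simp only [Finset.mem_filter, Finset.HasAntidiagonal.mem_antidiagonal] at ha
        ext <;> simp; omega
      · intro a ha; rfl
      · intro a ha
        simp only [Finset.mem_filter, Finset.HasAntidiagonal.mem_antidiagonal] at ha
        rw [← mul_assoc, ← mul_pow]
        have : k - a.2 = a.1 := by omega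
        rw [this]; simp; ring
    rw [h2] at h
    have h3 : ((-1 : ℂ) ^ k) * ((-1) ^ k) = 1 := by rw [← mul_pow]; simp
    calc (k : ℂ) * c k = (-1) ^ k * (k * ((-1) ^ k * c k)) := by linear_combination (-(k:ℂ) * c k) * h3
      _ = ((-1) ^ k * (-1) ^ k) * - ∑ j ∈ Finset.Icc 1 k, (∑ i, ω i ^ j) * c (k - j) := by
        rw [h]; ring
      _ = _ := by
        rw [h3, one_mul, ← Finset.sum_neg_distrib]
        exact Finset.sum_congr rfl fun j _ => by ring
  refine ⟨ω, fun k => ?_⟩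
  induction k using Nat.strong_induction_on with
  | _ k ih =>
    intro hk
    have h1 := (hN k).symm.trans (hnew k)
    rw [← Finset.sum_erase_add _ _ (Finset.mem_Icc.mpr ⟨hk, le_refl k⟩),
      ← Finset.sum_erase_add (Finset.Icc 1 k) (fun j => (-∑ i, ω i ^ j) * c (k - j))
        (Finset.mem_Icc.mpr ⟨hk, le_refl k⟩)] at h1
    rw [Finset.sum_congr rfl (g := fun j => (-∑ i, ω i ^ j) * c (k - j))] at h1
    · simpa [hc0] using h1
    · intro j hj
      rw [Finset.mem_erase, Finset.mem_Icc] at hj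
      rw [ih j (by omega) hj.2.1]

lemma phases_recur {ι : Type*} [Fintype ι] (v : ι → ℂ) (hv : ∀ i, ‖v i‖ ≤ 1) (N : ℕ) :
    ∃ k, N ≤ k ∧ Even k ∧ ∀ i, ‖v i‖ = 1 → ‖v i ^ k - 1‖ ≤ 1 / 2 := by
  let u : ℕ → ι → ℂ := fun j i => v i ^ (2 * j)
  have hu : ∀ j, u j ∈ Metric.closedBall (0 : ι → ℂ) 1 := by
    intro j
    rw [mem_closedBall_zero_iff, pi_norm_le_iff_of_nonneg zero_le_one]
    intro i
    simp only [u, norm_pow]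
    exact pow_le_one₀ (norm_nonneg _) (hv i)
  obtain ⟨a, -, φ, hφ, hlim⟩ := (isCompact_closedBall (0 : ι → ℂ) 1).tendsto_subseq hu
  obtain ⟨M, hM⟩ := (Metric.cauchySeq_iff.mp hlim.cauchySeq) (1 / 2) (by norm_num)
  have hsm : φ M + N ≤ φ (M + N) := by
    induction N with
    | zero => simp
    | succ n ih =>
      have := hφ (show M + n < M + (n + 1) by omega)
      omega
  refine ⟨2 * (φ (M + N) - φ M), by omega, even_two_mul _, fun i hi => ?_⟩
  have h1 := (hM M le_rfl (M + N) (by omega)).le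
  rw [dist_eq_norm, pi_norm_le_iff_of_nonneg (by norm_num)] at h1
  have h2 := h1 i
  simp only [u, Function.comp, Pi.sub_apply] at h2
  have h3 : v i ^ (2 * φ M) - v i ^ (2 * φ (M + N)) =
      - (v i ^ (2 * φ M) * (v i ^ (2 * (φ (M + N) - φ M)) - 1)) := by
    have : 2 * φ (M + N) = 2 * φ M + 2 * (φ (M + N) - φ M) := by omega
    rw [mul_sub, ← pow_add, ← this]; ring
  rw [h3, norm_neg, norm_mul, norm_pow, hi, one_pow, one_mul] at h2
  exact h2

theorem power_sum_bound {ι : Type*} [Fintype ι] (ω : ι → ℂ) (R A : ℝ) (hR : 0 < R) (k0 : ℕ)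
    (h : ∀ k, k0 ≤ k → Even k → ‖∑ i, ω i ^ k‖ ≤ A * R ^ k) (i : ι) : ‖ω i‖ ≤ R := by
  by_contra hlt
  push Not at hlt
  set ρ := ‖ω i‖ with hρ
  have hρ0 : 0 < ρ := hR.trans hlt
  obtain ⟨N, hN⟩ := pow_unbounded_of_one_lt (2 * A) (show 1 < ρ / R by rwa [one_lt_div hR])
  let v : ι → ℂ := fun i => ω i / (‖ω i‖ : ℂ)
  have hv : ∀ i, ‖v i‖ ≤ 1 := by
    intro i
    simp only [v, norm_div, Complex.norm_real, norm_norm]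
    exact div_self_le_one _
  have hv1 : ∀ i, ω i ≠ 0 → ‖v i‖ = 1 := by
    intro i hi
    simp only [v, norm_div, Complex.norm_real, norm_norm]
    exact div_self (norm_ne_zero_iff.mpr hi)
  obtain ⟨k, hk, hke, hkv⟩ := phases_recur v hv (N + k0 + 1)
  have hre : ∀ j, ‖ω j‖ ^ k / 2 ≤ (ω j ^ k).re := by
    intro j
    by_cases hj : ω j = 0
    · simp [hj, show k ≠ 0 by omega]
    · have h1 := hkv j (hv1 j hj)
      have h2 : ω j ^ k = ((‖ω j‖ ^ k : ℝ) : ℂ) * v j ^ k := by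
        simp only [v]
        rw [div_pow]
        have : (‖ω j‖ : ℂ) ^ k ≠ 0 := pow_ne_zero _ (by simpa using hj)
        push_cast
        field_simp
      rw [h2, Complex.re_ofReal_mul]
      have h3 : 1 / 2 ≤ (v j ^ k).re := by
        have := (abs_le.mp (Complex.abs_re_le_norm (v j ^ k - 1))).1
        simp only [Complex.sub_re, Complex.one_re] at this
        linarith
      have : 0 ≤ ‖ω j‖ ^ k := by positivity
      nlinarith
  have hs : ρ ^ k / 2 ≤ A * R ^ k := by
    calc ρ ^ k / 2 ≤ ∑ j, ‖ω j‖ ^ k / 2 :=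
          Finset.single_le_sum (f := fun j => ‖ω j‖ ^ k / 2) (fun j _ => by positivity)
            (Finset.mem_univ i)
      _ ≤ ∑ j, (ω j ^ k).re := Finset.sum_le_sum fun j _ => hre j
      _ = (∑ j, ω j ^ k).re := by simp
      _ ≤ ‖∑ j, ω j ^ k‖ := Complex.re_le_norm _
      _ ≤ _ := h k (by omega) hke
  have h4 : (ρ / R) ^ N ≤ (ρ / R) ^ k :=
    pow_le_pow_right₀ (by rw [one_le_div hR]; exact hlt.le) (by omega)
  have h5 : (ρ / R) ^ k ≤ 2 * A := by
    rw [div_pow, div_le_iff₀ (by positivity)]; linarith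
  linarith

noncomputable section LfunLam
/-- the multiplicative function attached to `χ`, `ψ`, `G` -/
def lamF {F : Type*} [Field F] (χ : MulChar F ℂ) (ψ : AddChar F ℂ) (G h : F[X]) : ℂ :=
  χ (resultant h G) * ψ (- h.nextCoeff)
end LfunLam

lemma lamF_one {F : Type*} [Field F] (χ : MulChar F ℂ) (ψ : AddChar F ℂ) (G : F[X]) :
    lamF χ ψ G 1 = 1 := by
  simp [lamF, nextCoeff]

lemma lamF_mul {F : Type*} [Field F] (χ : MulChar F ℂ) (ψ : AddChar F ℂ) (G f g : F[X])
    (hf : f.Monic) (hg : g.Monic) : lamF χ ψ G (f * g) = lamF χ ψ G f * lamF χ ψ G g := by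
  unfold lamF
  rw [hf.natDegree_mul hg, resultant_mul_left _ _ _ _ le_rfl, map_mul, hf.nextCoeff_mul hg,
    neg_add, AddChar.map_add_eq_mul]
  ring

lemma norm_aeval_eq {F E : Type*} [Field F] [Fintype F] [Field E] [Fintype E] [Algebra F E]
    (G : F[X]) (x : E) : Algebra.norm F (aeval x G) =
      (resultant (minpoly F x) G) ^ (Module.finrank (IntermediateField.adjoin F {x}) E) := by
  classical
  have hx : IsIntegral F x := Algebra.IsIntegral.isIntegral x
  let K := IntermediateField.adjoin F {x}
  let pb := IntermediateField.adjoin.powerBasis hx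
  have hgen : algebraMap K E pb.gen = x := by
    rw [IntermediateField.adjoin.powerBasis_gen]; rfl
  have hmp : minpoly F pb.gen = minpoly F x := by
    rw [IntermediateField.adjoin.powerBasis_gen]; exact IntermediateField.minpoly_gen F x
  have h1 : aeval x G = algebraMap K E (aeval pb.gen G) := by
    rw [← aeval_algebraMap_apply, hgen]
  rw [h1, ← Algebra.norm_norm (S := K), Algebra.norm_algebraMap, map_pow]
  congr 1
  let A := AlgebraicClosure F
  apply (algebraMap F A).injective
  rw [Algebra.norm_eq_prod_embeddings F A]
  have hmon : (minpoly F x).Monic := minpoly.monic hx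
  rw [← resultant_map_map, ← natDegree_map (f := algebraMap F A) (p := minpoly F x),
    resultant_eq_prod_eval _ _ _ (natDegree_map_le) (IsAlgClosed.splits _),
    (hmon.map _).leadingCoeff, one_pow, one_mul]
  have hsep : (minpoly F pb.gen).Separable := Algebra.IsSeparable.isSeparable F pb.gen
  rw [@Fintype.prod_equiv (K →ₐ[F] A) _ _ _ _ _ pb.liftEquiv'
    (fun σ => σ (aeval pb.gen G)) (fun y => (G.map (algebraMap F A)).eval (y : A)) ?_]
  · rw [Finset.prod_mem_multiset _ _ (fun y => (G.map (algebraMap F A)).eval y),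
      Finset.prod_eq_multiset_prod, Multiset.toFinset_val,
      Multiset.dedup_eq_self.mpr]
    · rw [hmp]
    · exact nodup_roots (hsep.map)
    · intro y; rfl
  · intro σ
    rw [PowerBasis.liftEquiv'_apply_coe, eval_map_algebraMap, aeval_algHom_apply]

lemma lamF_minpoly {F E : Type*} [Field F] [Fintype F] [Field E] [Fintype E] [Algebra F E]
    (χ : MulChar F ℂ) (ψ : AddChar F ℂ) (G : F[X]) (x : E) :
    χ (Algebra.norm F (aeval x G)) * ψ (Algebra.trace F E x) =
      lamF χ ψ G (minpoly F x) ^ (Module.finrank F E / (minpoly F x).natDegree) := by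
  have hx : IsIntegral F x := Algebra.IsIntegral.isIntegral x
  have hk : Module.finrank F E / (minpoly F x).natDegree =
      Module.finrank (IntermediateField.adjoin F {x}) E := by
    rw [← IntermediateField.adjoin.finrank hx,
      ← Module.finrank_mul_finrank F (IntermediateField.adjoin F {x}) E]
    exact Nat.mul_div_cancel_left _ Module.finrank_pos
  rw [hk, norm_aeval_eq, trace_eq_finrank_mul_minpoly_nextCoeff, map_pow, lamF, mul_pow,
    ← nsmul_eq_mul, AddChar.map_nsmul_eq_pow]

theorem Lpow_eq {F E : Type*} [Field F] [Fintype F] [Field E] [Fintype E] [Algebra F E]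
    (χ : MulChar F ℂ) (ψ : AddChar F ℂ) (G : F[X]) (k : ℕ) (hk : Module.finrank F E = k) :
    ∑ x : E, χ (Algebra.norm F (aeval x G)) * ψ (Algebra.trace F E x) =
      Lpow (lamF χ ψ G) k := by
  classical
  have hk0 : 0 < k := hk ▸ Module.finrank_pos
  unfold Lpow
  have hmaps : ∀ x ∈ (Finset.univ : Finset E), minpoly F x ∈
      (irrF F k).filter (fun π => π.natDegree ∣ k) := by
    intro x _
    have hx : IsIntegral F x := Algebra.IsIntegral.isIntegral x
    have hd : (minpoly F x).natDegree ∣ k := hk ▸ minpoly.degree_dvd hx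
    exact Finset.mem_filter.mpr ⟨mem_irrF.mpr ⟨Nat.le_of_dvd hk0 hd, minpoly.monic hx,
      minpoly.irreducible hx⟩, hd⟩
  rw [← Finset.sum_fiberwise_of_maps_to hmaps]
  refine Finset.sum_congr rfl fun π hπ => ?_
  obtain ⟨hπ1, hd⟩ := Finset.mem_filter.mp hπ
  obtain ⟨-, hπm, hπi⟩ := mem_irrF.mp hπ1
  have hfib : (Finset.univ.filter fun x : E => minpoly F x = π) = (π.rootSet E).toFinset := by
    ext x
    simp only [Finset.mem_filter, Finset.mem_univ, true_and, Set.mem_toFinset, mem_rootSet]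
    constructor
    · rintro rfl; exact ⟨hπi.ne_zero, minpoly.aeval F x⟩
    · rintro ⟨-, h⟩; exact (minpoly.eq_of_irreducible_of_monic hπi h hπm).symm
  have hcard : (Finset.univ.filter fun x : E => minpoly F x = π).card = π.natDegree := by
    rw [hfib, Set.toFinset_card]
    apply card_rootSet_eq_natDegree
    · exact PerfectField.separable_of_irreducible hπi
    · have hdv := hπi.natDegree_dvd_iff_dvd_X_pow_card_pow_sub_X.mp hd
      have hcE : Nat.card F ^ k = Fintype.card E := by
        rw [← hk, ← Module.natCard_eq_pow_finrank (K := F) (V := E), Nat.card_eq_fintype_card]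
      rw [hcE] at hdv
      have h1 := Polynomial.map_dvd (algebraMap F E) hdv
      have h2 : ((X ^ Fintype.card E - X : F[X]).map (algebraMap F E)) =
          X ^ Fintype.card E - X := by simp
      rw [h2] at h1
      refine Splits.of_dvd ?_ ?_ h1
      · have := FiniteField.isSplittingField_sub E F
        have h3 := this.splits'
        rwa [h2] at h3
      · exact FiniteField.X_pow_card_sub_X_ne_zero _ Fintype.one_lt_card
  rw [Finset.sum_congr rfl (g := fun _ => lamF χ ψ G π ^ (k / π.natDegree)), Finset.sum_const,
    hcard, nsmul_eq_mul]
  intro x hx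
  rw [Finset.mem_filter] at hx
  rw [lamF_minpoly, hk, hx.2]

lemma algMap_resultant {F : Type*} [Field F] (G h : F[X]) (hG : G.Monic) :
    algebraMap F (AlgebraicClosure F) (resultant G h) =
      ((G.map (algebraMap F (AlgebraicClosure F))).roots.map
        (fun ρ => aeval ρ h)).prod := by
  rw [← resultant_map_map, ← natDegree_map (f := algebraMap F (AlgebraicClosure F)) (p := G),
    resultant_eq_prod_eval _ _ _ (natDegree_map_le) (IsAlgClosed.splits _),
    (hG.map _).leadingCoeff, one_pow, one_mul]
  simp only [eval_map_algebraMap]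

lemma resultant_congr {F : Type*} [Field F] {G M h h' : F[X]} {e : ℕ} (hG : G.Monic)
    (hGM : G ∣ M ^ e) (hd : M ∣ h - h') : resultant G h = resultant G h' := by
  apply (algebraMap F (AlgebraicClosure F)).injective
  rw [algMap_resultant _ _ hG, algMap_resultant _ _ hG]
  congr 1
  refine Multiset.map_congr rfl fun ρ hρ => ?_
  have h1 : aeval ρ G = 0 := (mem_aroots'.mp hρ).2
  have h2 : aeval ρ M = 0 := by
    obtain ⟨c, hc⟩ := hGM
    have : aeval ρ (M ^ e) = 0 := by rw [hc, map_mul, h1, zero_mul]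
    rw [map_pow] at this
    exact eq_zero_of_pow_eq_zero this
  obtain ⟨c, hc⟩ := hd
  have : aeval ρ (h - h') = 0 := by rw [hc, map_mul, h2, zero_mul]
  rw [map_sub] at this
  exact sub_eq_zero.mp this

lemma resultant_mul_monic {F : Type*} [Field F] {G : F[X]} (h h' : F[X]) (hG : G.Monic) :
    resultant G (h * h') = resultant G h * resultant G h' := by
  apply (algebraMap F (AlgebraicClosure F)).injective
  rw [map_mul, algMap_resultant _ _ hG, algMap_resultant _ _ hG, algMap_resultant _ _ hG,
    ← Multiset.prod_map_mul]
  simp only [map_mul]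

theorem Lcoef_zero {F : Type*} [Field F] [Fintype F] (χ : MulChar F ℂ) (ψ : AddChar F ℂ)
    (G M : F[X]) (m e n : ℕ) (hG : G.Monic) (hM : M.Monic) (hm : M.natDegree = m)
    (hMG : M ∣ G) (hGM : G ∣ M ^ e) (hn : m < n)
    (hcase : ψ ≠ 1 ∨ ∃ h1, χ (resultant G h1) ≠ 0 ∧ χ (resultant G h1) ≠ 1) :
    Lcoef (lamF χ ψ G) n = 0 := by
  classical
  have hlam : ∀ h ∈ monF F n, lamF χ ψ G h =
      χ ((-1) ^ (n * G.natDegree)) * χ (resultant G h) * ψ (- h.coeff (n - 1)) := by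
    intro h hh
    obtain ⟨h1, h2⟩ := mem_monF.mp hh
    rw [lamF, resultant_comm, map_mul, nextCoeff_of_natDegree_pos (by omega), h2]
  -- it suffices to produce an injective self map multiplying `lamF`
  suffices H : ∃ (T : F[X] → F[X]) (u : ℂ), u ≠ 1 ∧ (∀ h ∈ monF F n, T h ∈ monF F n) ∧
      Set.InjOn T (monF F n) ∧ ∀ h ∈ monF F n, lamF χ ψ G (T h) = u * lamF χ ψ G h by
    obtain ⟨T, u, hu, hT1, hT2, hT3⟩ := H
    have him : (monF F n).image T = monF F n := by
      refine Finset.eq_of_subset_of_card_le ?_ ?_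
      · intro x hx
        obtain ⟨y, hy, rfl⟩ := Finset.mem_image.mp hx
        exact hT1 y hy
      · rw [Finset.card_image_of_injOn hT2]
    have h1 : Lcoef (lamF χ ψ G) n = u * Lcoef (lamF χ ψ G) n := by
      unfold Lcoef
      conv_lhs => rw [← him, Finset.sum_image hT2]
      rw [Finset.mul_sum]
      exact Finset.sum_congr rfl hT3
    have h2 : (1 - u) * Lcoef (lamF χ ψ G) n = 0 := by linear_combination h1
    rcases mul_eq_zero.mp h2 with h | h
    · exact absurd (sub_eq_zero.mp h).symm hu
    · exact h
  by_cases hψ : ψ = 1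
  swap
  · obtain ⟨a, ha⟩ := (AddChar.ne_one_iff).mp hψ
    let δ : F[X] := C (-a) * X ^ (n - 1 - m) * M
    have hδd : δ.natDegree < n := by
      refine lt_of_le_of_lt (natDegree_mul_le) ?_
      have := natDegree_C_mul_X_pow_le (-a) (n - 1 - m)
      omega
    have hδc : δ.coeff (n - 1) = -a := by
      have e1 : n - 1 = m + (n - 1 - m) := by omega
      simp only [δ]
      rw [mul_assoc, coeff_C_mul, mul_comm (X ^ _) M, e1, show m + (n - 1 - m) - m = n - 1 - m by omega,
        coeff_mul_X_pow, ← hm, hM.coeff_natDegree, mul_one]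
    have hT1 : ∀ h ∈ monF F n, h + δ ∈ monF F n := by
      intro h hh
      obtain ⟨h1, h2⟩ := mem_monF.mp hh
      have hlt : δ.degree < h.degree := by
        rw [degree_eq_natDegree h1.ne_zero, h2]
        exact (degree_le_natDegree).trans_lt (by exact_mod_cast hδd)
      refine mem_monF.mpr ⟨h1.add_of_left hlt, ?_⟩
      rw [natDegree_add_eq_left_of_degree_lt hlt, h2]
    refine ⟨fun h => h + δ, ψ a, ha, hT1, fun x _ y _ hxy => add_right_cancel hxy, ?_⟩
    intro h hh
    rw [hlam h hh, hlam _ (hT1 h hh), resultant_congr (h' := h) hG hGM, coeff_add, hδc, neg_add,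
      neg_neg, AddChar.map_add_eq_mul]
    · ring
    · simp only [δ, add_sub_cancel_left]; exact dvd_mul_left _ _
  · obtain ⟨h1, h10, h11⟩ := hcase.resolve_left (not_not.mpr hψ)
    have hcop : IsCoprime G h1 := by
      by_contra hc
      have : resultant G h1 = 0 := resultant_eq_zero_iff.mpr ⟨Or.inl hG.ne_zero, hc⟩
      rw [this] at h10
      exact h10 (MulChar.map_zero χ)
    have hcopM : IsCoprime M h1 := hcop.of_isCoprime_of_dvd_left hMG
    let T : F[X] → F[X] := fun h => M * (h /ₘ M) + (h1 * h) %ₘ M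
    have hTd : ∀ h, M ∣ T h - h1 * h := by
      intro h
      have := modByMonic_add_div (h1 * h) M
      refine ⟨h /ₘ M - (h1 * h) /ₘ M, ?_⟩
      simp only [T]
      linear_combination this
    have hT1 : ∀ h ∈ monF F n, T h ∈ monF F n := by
      intro h hh
      obtain ⟨hh1, hh2⟩ := mem_monF.mp hh
      have e1 : T h = h + ((h1 * h) %ₘ M - h %ₘ M) := by
        have := modByMonic_add_div h M
        simp only [T]
        linear_combination this
      have hlt : ((h1 * h) %ₘ M - h %ₘ M).degree < h.degree := by
        refine (degree_sub_le _ _).trans_lt ?_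
        have hMh : M.degree < h.degree := by
          rw [degree_eq_natDegree hh1.ne_zero, degree_eq_natDegree hM.ne_zero, hm, hh2]
          exact_mod_cast hn
        exact max_lt ((degree_modByMonic_lt _ hM).trans hMh) ((degree_modByMonic_lt _ hM).trans hMh)
      rw [e1]
      refine mem_monF.mpr ⟨hh1.add_of_left hlt, ?_⟩
      rw [natDegree_add_eq_left_of_degree_lt hlt, hh2]
    refine ⟨T, χ (resultant G h1), h11, hT1, ?_, ?_⟩
    · intro x _ y _ hxy
      have d1 : x /ₘ M = y /ₘ M := by
        have a1 := (div_modByMonic_unique (f := T x) (x /ₘ M) ((h1 * x) %ₘ M) hM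
          ⟨by simp only [T]; ring, degree_modByMonic_lt _ hM⟩).1
        have a2 := (div_modByMonic_unique (f := T y) (y /ₘ M) ((h1 * y) %ₘ M) hM
          ⟨by simp only [T]; ring, degree_modByMonic_lt _ hM⟩).1
        rw [← a1, ← a2]; exact congrArg (· /ₘ M) hxy
      have d2 : M ∣ h1 * (x - y) := by
        have := dvd_sub (hTd y) (hTd x)
        rw [show T x = T y from hxy] at this
        have e : T y - h1 * y - (T y - h1 * x) = h1 * (x - y) := by ring
        rwa [e] at this
      have d3 := hcopM.dvd_of_dvd_mul_left d2
      have d4 : x %ₘ M = y %ₘ M := by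
        have := (modByMonic_eq_zero_iff_dvd hM).mpr d3
        rw [sub_modByMonic] at this
        exact sub_eq_zero.mp this
      rw [← modByMonic_add_div x M, ← modByMonic_add_div y M, d1, d4]
    · intro h hh
      rw [hlam h hh, hlam _ (hT1 h hh), resultant_congr hG hGM (hTd h), resultant_mul_monic _ _ hG,
        map_mul, hψ]
      simp only [AddChar.one_apply]
      ring

lemma mult_transfer {F E : Type*} [Field F] [Fintype F] [Field E] [Algebra F E]
    (Q : ℕ) (hQ : Fintype.card F = Q) (G π : F[X]) (hG : G ≠ 0) (hπ : Irreducible π) :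
    ∃ ϖ : E[X], Irreducible ϖ ∧
      multiplicity ϖ ((G.comp (X ^ Q - X)).map (algebraMap F E)) = multiplicity π G := by
  have hQ1 : 1 < Q := hQ ▸ Fintype.one_lt_card
  let φ : F[X] →+* E[X] := (mapRingHom (algebraMap F E)).comp (compRingHom (X ^ Q - X))
  have hφ : ∀ f, φ f = (f.comp (X ^ Q - X)).map (algebraMap F E) := fun f => rfl
  have hu : (X ^ Q - X : F[X]).natDegree = Q := FiniteField.X_pow_card_sub_X_natDegree_eq _ hQ1
  have hdeg : (φ π).natDegree = π.natDegree * Q := by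
    rw [hφ, natDegree_map, natDegree_comp, hu]
  have hnu : ¬ IsUnit (φ π) := by
    intro h
    have := natDegree_eq_zero_of_isUnit h
    rw [hdeg] at this
    have := hπ.natDegree_pos
    rcases Nat.mul_eq_zero.mp ‹π.natDegree * Q = 0› with h | h <;> omega
  have hne : φ π ≠ 0 := by
    intro h
    rw [h, natDegree_zero] at hdeg
    have := hπ.natDegree_pos
    rcases Nat.mul_eq_zero.mp hdeg.symm with h | h <;> omega
  obtain ⟨ϖ, hϖ, hϖd⟩ := WfDvdMonoid.exists_irreducible_factor hnu hne
  have hQ0 : (Q : F) = 0 := by rw [← hQ]; exact Nat.cast_card_eq_zero F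
  -- squarefree
  have hsep : (φ π).Separable := by
    have hs : π.Separable := PerfectField.separable_of_irreducible hπ
    rw [hφ]
    apply Separable.map
    rw [Polynomial.separable_def] at hs ⊢
    obtain ⟨a, b, hab⟩ := hs
    refine ⟨a.comp (X ^ Q - X), - b.comp (X ^ Q - X), ?_⟩
    have h1 : derivative (X ^ Q - X : F[X]) = -1 := by
      rw [derivative_sub, derivative_X_pow, derivative_X, hQ0]; simp
    rw [derivative_comp, h1]
    have := congrArg (fun f => f.comp (X ^ Q - X)) hab
    simp only [add_comp, mul_comp, one_comp] at this
    linear_combination this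
  have hsq : ¬ ϖ ^ 2 ∣ φ π := by
    intro h
    rw [sq] at h
    exact hϖ.not_isUnit (hsep.squarefree _ h)
  refine ⟨ϖ, hϖ, ?_⟩
  have hfin : FiniteMultiplicity π G := FiniteMultiplicity.of_prime_left hπ.prime hG
  obtain ⟨B, hB, hπB⟩ := hfin.exists_eq_pow_mul_and_not_dvd
  set v := multiplicity π G
  obtain ⟨A', hA'⟩ := hϖd
  have hA'n : ¬ ϖ ∣ A' := by
    intro h
    exact hsq (by rw [hA', sq]; exact mul_dvd_mul_left _ h)
  have hBn : ¬ ϖ ∣ φ B := by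
    intro h
    have hc : IsCoprime π B := (hπ.coprime_iff_not_dvd).mpr hπB
    have hc2 : IsCoprime (φ π) (φ B) := hc.map φ
    exact hϖ.not_isUnit (hc2.isUnit_of_dvd' ⟨A', hA'⟩ h)
  rw [← hφ, hB, map_mul, map_pow, hA', mul_pow, mul_assoc]
  apply multiplicity_eq_of_dvd_of_not_dvd (dvd_mul_right _ _)
  intro h
  rw [pow_succ] at h
  have h2 := (mul_dvd_mul_iff_left (pow_ne_zero v hϖ.ne_zero)).mp h
  rcases hϖ.prime.dvd_or_dvd h2 with h3 | h3
  · exact hA'n (hϖ.prime.dvd_of_dvd_pow h3)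
  · exact hBn h3

noncomputable section NormChar
/-- the character `χ ∘ N` -/
def normChar {F : Type*} (E : Type*) [Field F] [Field E] [Algebra F E] [FiniteDimensional F E]
    (χ : MulChar F ℂ) : MulChar E ℂ where
  toFun x := χ (Algebra.norm F x)
  map_one' := by simp
  map_mul' x y := by simp
  map_nonunit' a ha := by
    have : a = 0 := by simpa [isUnit_iff_ne_zero] using ha
    subst this
    have : Algebra.norm F (0 : E) = 0 := Algebra.norm_zero
    rw [this]; exact MulChar.map_zero χ
end NormChar

lemma normChar_apply {F E : Type*} [Field F] [Field E] [Algebra F E] [FiniteDimensional F E]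
    (χ : MulChar F ℂ) (x : E) : normChar E χ x = χ (Algebra.norm F x) := rfl

theorem T_bound {F E : Type*} [Field F] [Fintype F] [Field E] [Fintype E] [Algebra F E]
    (Q D k : ℕ) (hQ : Fintype.card F = Q) (G : F[X]) (hG : G ≠ 0) (χ : MulChar F ℂ) (hχ : χ ≠ 1)
    (hD : D ∣ Q - 1) (hD0 : 0 < D) (hχD : χ ^ D = 1)
    (hmult : ∀ ℓ : ℕ, ℓ.Prime → ℓ ∣ D → ∃ π : F[X], Irreducible π ∧ ¬ ℓ ∣ multiplicity π G)
    (hk : Module.finrank F E = 2 * k)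
    (hbig : 100 * ((D + 1) * (G.natDegree * Q + 1)) ≤ Q ^ k) :
    ‖∑ z : E, χ (Algebra.norm F (aeval (z ^ Q - z) G))‖ ≤
      (1 + D * (G.natDegree * Q) + D * (4 * (G.natDegree * Q) + 10) : ℕ) * ((Q ^ k : ℕ) : ℝ) +
        (G.natDegree * Q : ℕ) := by
  classical
  have hQ1 : 1 < Q := hQ ▸ Fintype.one_lt_card
  obtain ⟨p, hp⟩ := CharP.exists F
  obtain ⟨a, hpp, ha⟩ := FiniteField.card F p
  have : Fact p.Prime := ⟨hpp⟩
  have : CharP E p := charP_of_injective_algebraMap (algebraMap F E).injective p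
  have hu : (X ^ Q - X : F[X]).natDegree = Q := FiniteField.X_pow_card_sub_X_natDegree_eq _ hQ1
  let H : E[X] := (G.comp (X ^ Q - X)).map (algebraMap F E)
  have hHd : H.natDegree = G.natDegree * Q := by
    simp only [H]; rw [natDegree_map, natDegree_comp, hu]
  have hH0 : H ≠ 0 := by
    simp only [H]
    rw [Polynomial.map_ne_zero_iff (algebraMap F E).injective, Ne, comp_eq_zero_iff]
    rintro (h | ⟨-, h⟩)
    · exact hG h
    · rw [h, natDegree_C] at hu; omega
  have hsur := FiniteField.norm_surjective F E
  have hcard : Fintype.card E = (Q ^ k) ^ 2 := by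
    rw [Module.card_eq_pow_finrank (K := F) (V := E), hQ, hk, ← pow_mul, mul_comm]
  have key := stepanov_charsum (E := E) p (Q ^ k) (a * k) D (G.natDegree * Q)
    (by rw [← hQ, ha, pow_mul]) hcard hD0 (hD.trans (by simpa using Nat.sub_dvd_pow_sub_pow Q 1 k)) H hHd.le hH0
    (by
      intro ℓ h1 h2
      obtain ⟨π, hπ, hn⟩ := hmult ℓ h1 h2
      obtain ⟨ϖ, hϖ, he⟩ := mult_transfer (E := E) Q hQ G π hG hπ
      exact ⟨ϖ, hϖ, by rwa [he]⟩)
    hbig (normChar E χ)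
    (by
      ext x
      have := congrArg (fun c : MulChar F ℂ => c (Algebra.norm F (x : E))) hχD
      rw [MulChar.pow_apply_coe, normChar_apply, MulChar.one_apply_coe]
      have hx : IsUnit (Algebra.norm F (x : E)) := (x.isUnit).map (Algebra.norm F)
      rw [← MulChar.pow_apply' _ hD0.ne', hχD, MulChar.one_apply hx])
    (by
      intro h
      apply hχ
      ext y
      obtain ⟨x, hx⟩ := hsur (y : F)
      have h1 : normChar E χ x = (1 : MulChar E ℂ) x := by rw [h]
      rw [normChar_apply, hx] at h1
      rw [h1, MulChar.one_apply_coe, MulChar.one_apply]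
      rw [isUnit_iff_ne_zero]
      rintro rfl
      rw [Algebra.norm_zero] at hx
      exact y.ne_zero hx.symm)
  have e : ∀ z : E, normChar E χ (H.eval z) = χ (Algebra.norm F (aeval (z ^ Q - z) G)) := by
    intro z
    rw [normChar_apply]
    simp only [H]
    rw [eval_map_algebraMap, aeval_comp]
    simp
  rw [Finset.sum_congr rfl (fun z _ => e z)] at key
  exact_mod_cast key

lemma sum_artin_schreier {F E : Type*} [Field F] [Fintype F] [Field E] [Fintype E] [Algebra F E]
    (Q : ℕ) (hQ : Fintype.card F = Q) (g : E → ℂ) :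
    ∑ ψ : AddChar F ℂ, ∑ x : E, g x * ψ (Algebra.trace F E x) = ∑ z : E, g (z ^ Q - z) := by
  classical
  have hQ1 : 1 < Q := hQ ▸ Fintype.one_lt_card
  let L : E →ₗ[F] E := (FiniteField.frobeniusAlgHom F E).toLinearMap - LinearMap.id
  have hL : ∀ z, L z = z ^ Q - z := by
    intro z; simp [L, hQ]
  -- kernel has Q elements
  have hker : (Finset.univ.filter fun z : E => L z = 0).card = Q := by
    have : (Finset.univ.filter fun z : E => L z = 0) = Finset.univ.image (algebraMap F E) := by
      symm
      refine Finset.eq_of_subset_of_card_le ?_ ?_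
      · intro x hx
        obtain ⟨y, -, rfl⟩ := Finset.mem_image.mp hx
        rw [Finset.mem_filter, hL, ← map_pow, ← hQ, FiniteField.pow_card, sub_self]
        exact ⟨Finset.mem_univ _, rfl⟩
      · rw [Finset.card_image_of_injective _ (algebraMap F E).injective, Finset.card_univ, hQ]
        have hne : (X ^ Q - X : E[X]) ≠ 0 := FiniteField.X_pow_card_sub_X_ne_zero _ hQ1
        have hd : (X ^ Q - X : E[X]).natDegree = Q :=
          FiniteField.X_pow_card_sub_X_natDegree_eq _ hQ1
        calc _ ≤ (X ^ Q - X : E[X]).roots.toFinset.card := by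
              refine Finset.card_le_card fun z hz => ?_
              rw [Finset.mem_filter, hL] at hz
              rw [Multiset.mem_toFinset, mem_roots hne]
              simp [hz.2]
          _ ≤ (X ^ Q - X : E[X]).roots.card := Multiset.toFinset_card_le _
          _ ≤ Q := (card_roots' _).trans hd.le
    rw [this, Finset.card_image_of_injective _ (algebraMap F E).injective, Finset.card_univ, hQ]
  have hkerK : Nat.card (LinearMap.ker L) = Q := by
    rw [← hker, Nat.card_eq_fintype_card, Fintype.card_subtype]; rfl
  have hkr : Module.finrank F (LinearMap.ker L) = 1 := by
    have := Module.natCard_eq_pow_finrank (K := F) (V := LinearMap.ker L)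
    rw [hkerK, Nat.card_eq_fintype_card, hQ] at this
    have h2 : Q ^ 1 = Q ^ Module.finrank F (LinearMap.ker L) := by simpa using this
    exact (Nat.pow_right_injective hQ1 h2).symm
  have hsur : Function.Surjective (Algebra.trace F E) := Algebra.trace_surjective F E
  have hrange : LinearMap.range L = LinearMap.ker (Algebra.trace F E) := by
    apply Submodule.eq_of_le_of_finrank_eq
    · rintro _ ⟨z, rfl⟩
      rw [LinearMap.mem_ker]
      have : Algebra.trace F E (FiniteField.frobeniusAlgEquivOfAlgebraic F E z) = Algebra.trace F E z :=
        Algebra.trace_eq_of_algEquiv _ _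
      rw [hL, map_sub, sub_eq_zero, ← this]
      simp [hQ]
    · have h1 := LinearMap.finrank_range_add_finrank_ker L
      have h2 := LinearMap.finrank_range_add_finrank_ker (Algebra.trace F E)
      rw [LinearMap.range_eq_top.mpr hsur, finrank_top, Module.finrank_self] at h2
      omega
  -- left side
  have hleft : ∑ ψ : AddChar F ℂ, ∑ x : E, g x * ψ (Algebra.trace F E x) =
      ∑ x : E, if Algebra.trace F E x = 0 then (Q : ℂ) * g x else 0 := by
    rw [Finset.sum_comm]
    refine Finset.sum_congr rfl fun x _ => ?_
    rw [← Finset.mul_sum, AddChar.sum_apply_eq_ite]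
    split_ifs
    · rw [hQ]; ring
    · simp
  have hfib : ∀ x : E, ((Finset.univ.filter fun z : E => L z = x).card : ℂ) =
      if Algebra.trace F E x = 0 then (Q : ℂ) else 0 := by
    intro x
    split_ifs with h
    · have hx : x ∈ LinearMap.range L := by rw [hrange]; exact h
      obtain ⟨z0, hz0⟩ := hx
      rw [← hker]
      norm_cast
      refine Finset.card_bij (fun z _ => z - z0) ?_ ?_ ?_
      · intro z hz
        rw [Finset.mem_filter] at hz ⊢
        refine ⟨Finset.mem_univ _, ?_⟩
        rw [map_sub, hz.2, hz0, sub_self]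
      · intro a _ b _ hab; exact sub_left_injective hab
      · intro b hb
        rw [Finset.mem_filter] at hb
        refine ⟨b + z0, ?_, by simp⟩
        rw [Finset.mem_filter, map_add, hb.2, hz0, zero_add]
        exact ⟨Finset.mem_univ _, rfl⟩
    · rw [Finset.filter_eq_empty_iff.mpr, Finset.card_empty, Nat.cast_zero]
      intro z _ hz
      apply h
      have : x ∈ LinearMap.ker (Algebra.trace F E) := by rw [← hrange]; exact ⟨z, hz⟩
      exact this
  rw [hleft]
  simp only [← hL]
  symm
  rw [← Finset.sum_fiberwise_of_maps_to (g := fun z => L z) (t := Finset.univ)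
    (fun z _ => Finset.mem_univ _)]
  refine Finset.sum_congr rfl fun x _ => ?_
  rw [Finset.sum_congr rfl (g := fun _ => g x), Finset.sum_const, nsmul_eq_mul, hfib]
  · split_ifs <;> simp
  · intro z hz
    rw [Finset.mem_filter] at hz
    rw [hz.2]

lemma exists_h1 {F : Type*} [Field F] [Fintype F]
    (Q D : ℕ) (hQ : Fintype.card F = Q) (G : F[X]) (hG : G.Monic) (χ : MulChar F ℂ) (hχ : χ ≠ 1)
    (hD : D ∣ Q - 1) (hD0 : 0 < D) (hχD : χ ^ D = 1)
    (hmult : ∀ ℓ : ℕ, ℓ.Prime → ℓ ∣ D → ∃ π : F[X], Irreducible π ∧ ¬ ℓ ∣ multiplicity π G) :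
    ∃ h1, χ (resultant G h1) ≠ 0 ∧ χ (resultant G h1) ≠ 1 := by
  classical
  have hQ1 : 1 < Q := hQ ▸ Fintype.one_lt_card
  obtain ⟨p, hp⟩ := CharP.exists F
  obtain ⟨a, hpp, ha⟩ := FiniteField.card F p
  have : Fact p.Prime := ⟨hpp⟩
  set d := G.natDegree with hd
  set A := 1 + D * (d * Q) + D * (4 * (d * Q) + 10) with hA
  let k := 100 * ((D + 1) * (d * Q + 1)) + A + 2 * (d * Q) + 1
  have hk : k < Q ^ k := Nat.lt_pow_self hQ1
  have : NeZero (2 * k) := ⟨by simp only [k]; omega⟩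
  let E := FiniteField.Extension F p (2 * k)
  have : Fintype E := Fintype.ofFinite E
  have hfr : Module.finrank F E = 2 * k := FiniteField.finrank_extension F p (2 * k)
  have hcard : Fintype.card E = Q ^ k * Q ^ k := by
    rw [Module.card_eq_pow_finrank (K := F) (V := E), hQ, hfr, two_mul, pow_add]
  have hT := T_bound (E := E) Q D k hQ G hG.ne_zero χ hχ hD hD0 hχD hmult hfr
    (by rw [← hd]; simp only [k] at hk ⊢; omega)
  -- find z
  have hz : ∃ z : E, χ (Algebra.norm F (aeval (z ^ Q - z) G)) ≠ 0 ∧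
      χ (Algebra.norm F (aeval (z ^ Q - z) G)) ≠ 1 := by
    by_contra hcon
    push Not at hcon
    have hu : (X ^ Q - X : F[X]).natDegree = Q := FiniteField.X_pow_card_sub_X_natDegree_eq _ hQ1
    let H : E[X] := (G.comp (X ^ Q - X)).map (algebraMap F E)
    have hHd : H.natDegree = d * Q := by
      simp only [H]; rw [natDegree_map, natDegree_comp, hu]
    have hH0 : H ≠ 0 := by
      simp only [H]
      rw [Polynomial.map_ne_zero_iff (algebraMap F E).injective, Ne, comp_eq_zero_iff]
      rintro (h | ⟨-, h⟩)
      · exact hG.ne_zero h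
      · rw [h, natDegree_C] at hu; omega
    let Z := Finset.univ.filter fun z : E => χ (Algebra.norm F (aeval (z ^ Q - z) G)) = 0
    have hZ : Z.card ≤ d * Q := by
      calc Z.card ≤ H.roots.toFinset.card := by
            refine Finset.card_le_card fun z hz => ?_
            rw [Finset.mem_filter] at hz
            rw [Multiset.mem_toFinset, mem_roots hH0, IsRoot.def]
            simp only [H]
            rw [eval_map_algebraMap, aeval_comp]
            have h1 : Algebra.norm F (aeval (z ^ Q - z) G) = 0 := by
              by_contra hne
              exact (IsUnit.map χ (isUnit_iff_ne_zero.mpr hne)).ne_zero hz.2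
            have h2 := Algebra.norm_eq_zero_iff.mp h1
            simpa using h2
        _ ≤ H.roots.card := Multiset.toFinset_card_le _
        _ ≤ d * Q := (card_roots' _).trans hHd.le
    have hsum : ∑ z : E, χ (Algebra.norm F (aeval (z ^ Q - z) G)) =
        ((Finset.univ.filter fun z : E => ¬ χ (Algebra.norm F (aeval (z ^ Q - z) G)) = 0).card : ℂ) := by
      rw [Finset.card_filter]
      push_cast
      refine Finset.sum_congr rfl fun z _ => ?_
      by_cases h : χ (Algebra.norm F (aeval (z ^ Q - z) G)) = 0
      · simp [h]
      · rw [if_pos h]; exact hcon z h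
    have hcc := Finset.card_filter_add_card_filter_not (s := (Finset.univ : Finset E))
      (fun z : E => χ (Algebra.norm F (aeval (z ^ Q - z) G)) = 0)
    rw [Finset.card_univ, hcard] at hcc
    rw [hsum, Complex.norm_natCast] at hT
    have hT' : (Finset.univ.filter fun z : E => ¬ χ (Algebra.norm F (aeval (z ^ Q - z) G)) = 0).card
        ≤ A * Q ^ k + d * Q := by exact_mod_cast hT
    have h3 : Q ^ k * Q ^ k ≤ A * Q ^ k + 2 * (d * Q) := by
      have : Z.card + _ = _ := hcc
      omega
    have h4 : A + 2 * (d * Q) + 1 ≤ Q ^ k := by simp only [k] at hk ⊢; omega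
    nlinarith [Nat.mul_le_mul_right (Q ^ k) h4, Nat.zero_le (d * Q)]
  obtain ⟨z, hz0, hz1⟩ := hz
  set x := z ^ Q - z
  have hInt : IsIntegral F x := Algebra.IsIntegral.isIntegral x
  set t := Module.finrank (IntermediateField.adjoin F {x}) E with ht
  have hdt : (minpoly F x).natDegree * t = 2 * k := by
    rw [← IntermediateField.adjoin.finrank hInt, ht, Module.finrank_mul_finrank, hfr]
  have hpow : ∀ (f : F[X]) (j : ℕ), resultant G (f ^ j) = resultant G f ^ j := by
    intro f j
    induction j with
    | zero =>
      simp
    | succ j ih => rw [pow_succ, pow_succ, resultant_mul_monic _ _ hG, ih]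
  have hkey : resultant G ((minpoly F x) ^ t) = Algebra.norm F (aeval x G) := by
    rw [norm_aeval_eq, hpow, resultant_comm (minpoly F x) G, mul_pow, ← pow_mul,
      show (minpoly F x).natDegree * G.natDegree * t = 2 * (k * G.natDegree) by
        rw [mul_right_comm, hdt]; ring]
    simp [ht]
  exact ⟨(minpoly F x) ^ t, by rwa [hkey], by rwa [hkey]⟩

theorem weil_bound {F : Type*} [Field F] [Fintype F]
    (Q D m e : ℕ) (hQ : Fintype.card F = Q) (G M : F[X]) (hG : G.Monic) (hM : M.Monic)
    (hm : M.natDegree = m) (hMG : M ∣ G) (hGM : G ∣ M ^ e)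
    (χ : MulChar F ℂ) (hχ : χ ≠ 1)
    (hD : D ∣ Q - 1) (hD0 : 0 < D) (hχD : χ ^ D = 1)
    (hmult : ∀ ℓ : ℕ, ℓ.Prime → ℓ ∣ D → ∃ π : F[X], Irreducible π ∧ ¬ ℓ ∣ multiplicity π G)
    (ψ : AddChar F ℂ) : ‖∑ x : F, χ (G.eval x) * ψ x‖ ≤ m * √Q := by
  classical
  have hQ1 : 1 < Q := hQ ▸ Fintype.one_lt_card
  obtain ⟨p, hp⟩ := CharP.exists F
  obtain ⟨a, hpp, ha⟩ := FiniteField.card F p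
  have : Fact p.Prime := ⟨hpp⟩
  have hh1 := exists_h1 Q D hQ G hG χ hχ hD hD0 hχD hmult
  have hroots : ∀ ψ : AddChar F ℂ, ∃ ω : Fin m → ℂ, ∀ k, 1 ≤ k →
      Lpow (lamF χ ψ G) k = - ∑ i, ω i ^ k := by
    intro ψ
    apply newton_roots m (Lcoef (lamF χ ψ G))
    · have : monF F 0 = {1} := by
        ext f
        rw [mem_monF, Finset.mem_singleton]
        constructor
        · rintro ⟨h1, h2⟩; exact h1.natDegree_eq_zero.mp h2
        · rintro rfl; exact ⟨monic_one, natDegree_one⟩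
      rw [Lcoef, this, Finset.sum_singleton, lamF_one]
    · intro n hn
      exact Lcoef_zero χ ψ G M m e n hG hM hm hMG hGM hn (Or.inr hh1)
    · exact Lnewton _ (lamF_one _ _ _) (lamF_mul _ _ _)
  choose ω hω using hroots
  set d := G.natDegree with hd
  set A := 1 + D * (d * Q) + D * (4 * (d * Q) + 10) with hA
  let K := 100 * ((D + 1) * (d * Q + 1)) + 1
  have hb : ∀ i : AddChar F ℂ × Fin m, ‖ω i.1 i.2‖ ≤ √Q := by
    refine power_sum_bound (fun i : AddChar F ℂ × Fin m => ω i.1 i.2) (√Q) (A + d * Q : ℕ)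
      (Real.sqrt_pos.mpr (by exact_mod_cast (by omega : 0 < Q))) (2 * K) ?_
    intro k' hk' hke
    obtain ⟨k, hk2⟩ := hke
    have hk : k' = 2 * k := by omega
    subst hk
    have hkK : K ≤ k := by omega
    have : NeZero (2 * k) := ⟨by simp only [K] at hkK; omega⟩
    let E := FiniteField.Extension F p (2 * k)
    have : Fintype E := Fintype.ofFinite E
    have hfr : Module.finrank F E = 2 * k := FiniteField.finrank_extension F p (2 * k)
    have hkQ : k < Q ^ k := Nat.lt_pow_self hQ1
    have hT := T_bound (E := E) Q D k hQ G hG.ne_zero χ hχ hD hD0 hχD hmult hfr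
      (by rw [← hd]; simp only [K] at hkK; omega)
    have hsum : ∑ z : E, χ (Algebra.norm F (aeval (z ^ Q - z) G)) =
        - ∑ i : AddChar F ℂ × Fin m, ω i.1 i.2 ^ (2 * k) := by
      rw [← sum_artin_schreier Q hQ (fun x : E => χ (Algebra.norm F (aeval x G))),
        Fintype.sum_prod_type, ← Finset.sum_neg_distrib]
      refine Finset.sum_congr rfl fun ψ _ => ?_
      rw [Lpow_eq χ ψ G (2 * k) hfr, hω ψ (2 * k) (by simp only [K] at hkK; omega)]
    rw [hsum, norm_neg] at hT
    refine hT.trans ?_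
    have hsq : (√(Q : ℝ)) ^ (2 * k) = ((Q ^ k : ℕ) : ℝ) := by
      rw [pow_mul, Real.sq_sqrt (by positivity)]; push_cast; rfl
    rw [hsq]
    have h1 : A * Q ^ k + d * Q ≤ (A + d * Q) * Q ^ k := by
      have : 1 ≤ Q ^ k := Nat.one_le_pow _ _ (by omega)
      nlinarith [Nat.zero_le (d * Q)]
    exact_mod_cast h1
  have h1 := Lpow_eq (E := F) χ ψ G 1 (Module.finrank_self F)
  rw [hω ψ 1 le_rfl] at h1
  have h2 : ∑ x : F, χ (G.eval x) * ψ x = - ∑ i, ω ψ i ^ 1 := by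
    rw [← h1]
    refine Finset.sum_congr rfl fun x _ => ?_
    rw [Algebra.norm_self, Algebra.trace_self]
    simp
  rw [h2, norm_neg]
  calc _ ≤ ∑ i : Fin m, ‖ω ψ i ^ 1‖ := norm_sum_le _ _
    _ ≤ ∑ i : Fin m, √Q := Finset.sum_le_sum fun i _ => by rw [pow_one]; exact hb (ψ, i)
    _ = m * √Q := by simp

lemma mulChar_pair {F : Type*} [Field F] [Fintype F] (χ1 χ2 : MulChar F ℂ)
    (h : ¬ (χ1 = 1 ∧ χ2 = 1)) :
    ∃ (χ : MulChar F ℂ) (a b : ℕ), χ ≠ 1 ∧ 0 < a ∧ 0 < b ∧ χ1 = χ ^ a ∧ χ2 = χ ^ b ∧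
      ∀ ℓ : ℕ, ℓ.Prime → ℓ ∣ orderOf χ → ℓ ∣ b → ¬ ℓ ∣ a := by
  classical
  have hcyc : IsCyclic (MulChar F ℂ) := by
    obtain ⟨e⟩ := MulChar.mulEquiv_units F ℂ
    exact isCyclic_of_surjective e.symm e.symm.surjective
  have : Finite (MulChar F ℂ) := inferInstance
  obtain ⟨⟨χ, hχH⟩, hgen⟩ := IsCyclic.exists_monoid_generator (α := Subgroup.closure {χ1, χ2})
  have hp : 0 < orderOf χ := orderOf_pos χ
  have key : ∀ c ∈ Subgroup.closure {χ1, χ2}, ∃ a : ℕ, 0 < a ∧ c = χ ^ a := by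
    intro c hc
    obtain ⟨a, ha⟩ := Submonoid.mem_powers_iff _ _ |>.1 (hgen ⟨c, hc⟩)
    refine ⟨a + orderOf χ, by omega, ?_⟩
    rw [pow_add, pow_orderOf_eq_one, mul_one]
    simpa using (congrArg Subtype.val ha).symm
  obtain ⟨a, ha0, ha⟩ := key χ1 (Subgroup.subset_closure (by simp))
  obtain ⟨b, hb0, hb⟩ := key χ2 (Subgroup.subset_closure (by simp))
  refine ⟨χ, a, b, ?_, ha0, hb0, ha, hb, ?_⟩
  · rintro rfl
    simp at ha hb
    exact h ⟨ha, hb⟩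
  · intro ℓ hℓ hD hlb hla
    obtain ⟨s, t, hst⟩ := Subgroup.mem_closure_pair.1 hχH
    rw [ha, hb, ← zpow_natCast, ← zpow_natCast, ← zpow_mul, ← zpow_mul, ← zpow_add] at hst
    have h1 : χ ^ ((a * s + b * t : ℤ) - 1) = 1 := by
      rw [zpow_sub, hst]; simp
    rw [← orderOf_dvd_iff_zpow_eq_one] at h1
    have h2 : (ℓ : ℤ) ∣ a * s + b * t - 1 := (Int.natCast_dvd_natCast.2 hD).trans h1
    have h3 : (ℓ : ℤ) ∣ a * s + b * t :=
      dvd_add (Dvd.dvd.mul_right (Int.natCast_dvd_natCast.2 hla) _)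
        (Dvd.dvd.mul_right (Int.natCast_dvd_natCast.2 hlb) _)
    have h4 : (ℓ : ℤ) ∣ 1 := by simpa using dvd_sub h3 h2
    have := Int.natCast_dvd_natCast.1 (by simpa using h4 : (ℓ : ℤ) ∣ ((1 : ℕ) : ℤ))
    exact hℓ.one_lt.ne' (Nat.dvd_one.1 this)

lemma emult_coprime {F : Type*} [Field F] (g : F[X]) (hg : Irreducible g) (k : ℕ)
    (f1 f2 : F[X]) (hc : IsCoprime f1 f2) (h1 : g ^ k ∣ f1 * f2) (h2 : ¬ g ^ (k + 1) ∣ f1 * f2) :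
    (emultiplicity g f1 = k ∧ emultiplicity g f2 = 0) ∨
      (emultiplicity g f1 = 0 ∧ emultiplicity g f2 = k) := by
  have hm : emultiplicity g (f1 * f2) = k := emultiplicity_eq_coe.2 ⟨h1, h2⟩
  rw [emultiplicity_mul hg.prime] at hm
  by_cases h : g ∣ f1
  · left
    have : ¬ g ∣ f2 := fun h' => hg.not_isUnit (hc.isUnit_of_dvd' h h')
    have h0 := emultiplicity_eq_zero.2 this
    rw [h0, add_zero] at hm
    exact ⟨hm, h0⟩
  · right
    have h0 := emultiplicity_eq_zero.2 h
    rw [h0, zero_add] at hm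
    exact ⟨h0, hm⟩

set_option maxHeartbeats 400000 in
theorem charsum6 {F : Type*} [Field F] [Fintype F] (f1 f2 : F[X]) (hd1 : f1.natDegree ≤ 3)
    (hd2 : f2.natDegree ≤ 2) (hc : IsCoprime f1 f2) (k : ℕ) (g : F[X]) (hk : 0 < k)
    (hgm : g.Monic) (hg : Irreducible g) (hgX : g ≠ X)
    (hkq : Nat.gcd k (Fintype.card F - 1) = 1) (h1 : g ^ k ∣ f1 * f2)
    (h2 : ¬ g ^ (k + 1) ∣ f1 * f2) (χ1 χ2 : MulChar F ℂ) (ψ : AddChar F ℂ)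
    (hnt : ¬ (χ1 = 1 ∧ χ2 = 1 ∧ ψ = 1)) :
    ‖∑ x : F, χ1 x * χ2 (f1.eval x / f2.eval x) * ψ x‖ ≤ 6 * √(Fintype.card F) := by
  classical
  have hf0 : f1 * f2 ≠ 0 := by
    intro h; rw [h] at h2; exact h2 (dvd_zero _)
  have hf1 : f1 ≠ 0 := left_ne_zero_of_mul hf0
  have hf2 : f2 ≠ 0 := right_ne_zero_of_mul hf0
  have hQ1 : (1 : ℝ) ≤ √(Fintype.card F) := by
    rw [Real.one_le_sqrt]; exact_mod_cast Fintype.card_pos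
  by_cases htriv : χ1 = 1 ∧ χ2 = 1
  · obtain ⟨rfl, rfl⟩ := htriv
    have hψ : ψ ≠ 1 := fun h => hnt ⟨rfl, rfl, h⟩
    set Z : Finset F := (X * f1 * f2).roots.toFinset with hZ
    have hX0 : X * f1 * f2 ≠ 0 := by
      rw [mul_assoc]; exact mul_ne_zero X_ne_zero hf0
    have hZmem : ∀ x, x ∈ Z ↔ (x = 0 ∨ f1.eval x = 0 ∨ f2.eval x = 0) := by
      intro x
      simp [hZ, Polynomial.mem_roots hX0, or_assoc]
    have hZc : (Z.card : ℝ) ≤ 6 := by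
      have : Z.card ≤ 6 := by
        calc Z.card ≤ _ := Multiset.toFinset_card_le _
          _ ≤ _ := Polynomial.card_roots' _
          _ ≤ 6 := by
            rw [natDegree_mul (mul_ne_zero X_ne_zero hf1) hf2, natDegree_mul X_ne_zero hf1,
              natDegree_X]; omega
      exact_mod_cast this
    have hs : ∑ x : F, (1 : MulChar F ℂ) x * (1 : MulChar F ℂ) (f1.eval x / f2.eval x) * ψ x
        = - ∑ x ∈ Z, ψ x := by
      have hall : ∑ x : F, ψ x = 0 := AddChar.sum_eq_zero_iff_ne_zero.2 hψ
      rw [eq_neg_iff_add_eq_zero, ← hall, ← Finset.sum_filter_add_sum_filter_not Finset.univ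
        (fun x => x ∈ Z) (fun x => ψ x), add_comm]
      congr 1
      · rw [Finset.filter_mem_eq_inter, Finset.univ_inter]
      · rw [Finset.sum_filter]
        refine Finset.sum_congr rfl fun x _ => ?_
        by_cases hx : x ∈ Z
        · rw [if_neg (not_not.2 hx)]
          rcases (hZmem x).1 hx with h | h | h <;> simp only [h, div_zero, zero_div, MulChar.map_zero, zero_mul, mul_zero]
        · rw [if_pos hx]
          rw [hZmem] at hx
          push Not at hx
          rw [MulChar.one_apply (isUnit_iff_ne_zero.2 hx.1),
            MulChar.one_apply (isUnit_iff_ne_zero.2 (div_ne_zero hx.2.1 hx.2.2)), one_mul, one_mul]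
    rw [hs, norm_neg]
    calc ‖∑ x ∈ Z, ψ x‖ ≤ ∑ x ∈ Z, ‖ψ x‖ := norm_sum_le _ _
      _ = Z.card := by simp
      _ ≤ 6 := hZc
      _ ≤ _ := by linarith
  · obtain ⟨χ, a, b, hχ, ha, hb, rfl, rfl, hab⟩ := mulChar_pair χ1 χ2 htriv
    set D := orderOf χ with hD
    have hD0 : 0 < D := orderOf_pos χ
    have hD2 : 2 ≤ D := by
      by_contra hlt
      have : D = 1 := by omega
      exact hχ (orderOf_eq_one_iff.1 this)
    have hDQ : D ∣ Fintype.card F - 1 := χ.orderOf_dvd_card_sub_one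
    set c1 := f1.leadingCoeff
    set c2 := f2.leadingCoeff
    have hc1 : c1 ≠ 0 := leadingCoeff_ne_zero.2 hf1
    have hc2 : c2 ≠ 0 := leadingCoeff_ne_zero.2 hf2
    set F1 := C c1⁻¹ * f1 with hF1
    set F2 := C c2⁻¹ * f2 with hF2
    have hF1m : F1.Monic := by
      rw [hF1, mul_comm]; exact monic_mul_leadingCoeff_inv hf1
    have hF2m : F2.Monic := by
      rw [hF2, mul_comm]; exact monic_mul_leadingCoeff_inv hf2
    have hinv : ∀ y : F, χ y⁻¹ = χ y ^ (D - 1) := by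
      intro y
      by_cases hy : y = 0
      · subst hy
        rw [inv_zero, MulChar.map_zero, zero_pow (by omega)]
      · have e1 : χ y * χ y⁻¹ = 1 := by
          rw [← map_mul, mul_inv_cancel₀ hy, map_one]
        have e2 : χ y ^ D = 1 := by
          rw [← MulChar.pow_apply' χ hD0.ne', pow_orderOf_eq_one]
          exact MulChar.one_apply (isUnit_iff_ne_zero.2 hy)
        have e3 : χ y ≠ 0 := left_ne_zero_of_mul (e1 ▸ one_ne_zero)
        apply mul_left_cancel₀ e3
        rw [e1, ← pow_succ', Nat.sub_add_cancel (by omega), e2]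
    set B := b * (D - 1) with hB
    have hB0 : 0 < B := Nat.mul_pos hb (by omega)
    set G := X ^ a * F1 ^ b * F2 ^ B with hGdef
    set M := X * F1 * F2 with hMdef
    have hGm : G.Monic := ((monic_X_pow a).mul (hF1m.pow b)).mul (hF2m.pow B)
    have hMm : M.Monic := (monic_X.mul hF1m).mul hF2m
    have hMd : (M.natDegree : ℝ) ≤ 6 := by
      have : M.natDegree ≤ 6 := by
        rw [hMdef, Monic.natDegree_mul (monic_X.mul hF1m) hF2m, Monic.natDegree_mul monic_X hF1m,
          natDegree_X, hF1, hF2]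
        have := natDegree_C_mul_le c1⁻¹ f1
        have := natDegree_C_mul_le c2⁻¹ f2
        omega
      exact_mod_cast this
    have hsum : ∀ x : F, (χ ^ a) x * (χ ^ b) (f1.eval x / f2.eval x) * ψ x =
        (χ c1 ^ b * χ c2 ^ B) * (χ (G.eval x) * ψ x) := by
      intro x
      have e1 : f1.eval x = c1 * F1.eval x := by
        rw [hF1, eval_mul, eval_C, mul_inv_cancel_left₀ hc1]
      have e2 : f2.eval x = c2 * F2.eval x := by
        rw [hF2, eval_mul, eval_C, mul_inv_cancel_left₀ hc2]
      rw [MulChar.pow_apply' χ ha.ne', MulChar.pow_apply' χ hb.ne', e1, e2, div_eq_mul_inv,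
        map_mul, hinv, hGdef]
      simp only [eval_mul, eval_pow, eval_X, map_mul, map_pow, mul_pow, hB, ← pow_mul,
        mul_comm b (D - 1)]
      ring
    simp_rw [hsum]
    rw [← Finset.mul_sum, norm_mul]
    have hn1 : ∀ y : F, ‖χ y‖ ≤ 1 := fun y => by
      by_cases hy : y = 0
      · rw [hy, MulChar.map_zero]; simp
      · obtain ⟨u, rfl⟩ := isUnit_iff_ne_zero.2 hy
        have : ‖χ u‖ = 1 := by
          apply Complex.norm_eq_one_of_pow_eq_one (n := D) _ hD0.ne'
          rw [← MulChar.pow_apply' χ hD0.ne', pow_orderOf_eq_one]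
          exact MulChar.one_apply u.isUnit
        exact this.le
    have hn2 : ‖χ c1 ^ b * χ c2 ^ B‖ ≤ 1 := by
      rw [norm_mul, norm_pow, norm_pow]
      exact mul_le_one₀ (pow_le_one₀ (norm_nonneg _) (hn1 _)) (by positivity)
        (pow_le_one₀ (norm_nonneg _) (hn1 _))
    have hF1ass : ∀ π : F[X], emultiplicity π F1 = emultiplicity π f1 := fun π =>
      emultiplicity_eq_of_associated_right
        (associated_unit_mul_left f1 _ (isUnit_C.2 (isUnit_iff_ne_zero.2 (inv_ne_zero hc1))))
    have hF2ass : ∀ π : F[X], emultiplicity π F2 = emultiplicity π f2 := fun π =>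
      emultiplicity_eq_of_associated_right
        (associated_unit_mul_left f2 _ (isUnit_C.2 (isUnit_iff_ne_zero.2 (inv_ne_zero hc2))))
    have hmulG : ∀ π : F[X], Irreducible π → emultiplicity π G =
        a * emultiplicity π X + b * emultiplicity π f1 + B * emultiplicity π f2 := by
      intro π hπ
      rw [hGdef, emultiplicity_mul hπ.prime, emultiplicity_mul hπ.prime, emultiplicity_pow hπ.prime,
        emultiplicity_pow hπ.prime, emultiplicity_pow hπ.prime, hF1ass, hF2ass]
    have hmult : ∀ ℓ : ℕ, ℓ.Prime → ℓ ∣ D → ∃ π : F[X], Irreducible π ∧ ¬ ℓ ∣ multiplicity π G := by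
      intro ℓ hℓ hℓD
      by_cases hℓb : ℓ ∣ b
      · refine ⟨X, irreducible_X, ?_⟩
        have hfin : ∀ f : F[X], f ≠ 0 → ∃ v : ℕ, emultiplicity X f = v := fun f hf =>
          ⟨_, (FiniteMultiplicity.of_not_isUnit not_isUnit_X hf).emultiplicity_eq_multiplicity⟩
        obtain ⟨v1, hv1⟩ := hfin f1 hf1
        obtain ⟨v2, hv2⟩ := hfin f2 hf2
        have hXX : emultiplicity (X : F[X]) X = (1 : ℕ) := by
          simpa using emultiplicity_pow_self (X_ne_zero (R := F)) not_isUnit_X 1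
        have := hmulG X irreducible_X
        rw [hv1, hv2, hXX] at this
        have hm : multiplicity X G = a * 1 + b * v1 + B * v2 :=
          multiplicity_eq_of_emultiplicity_eq_some (by rw [this]; push_cast; rfl)
        rw [hm, mul_one, add_assoc]
        intro hdiv
        exact hab ℓ hℓ hℓD hℓb ((Nat.dvd_add_left (dvd_add (hℓb.mul_right _)
          ((hℓb.mul_right _).mul_right _))).1 hdiv)
      · refine ⟨g, hg, ?_⟩
        have hgX0 : emultiplicity g X = 0 := by
          rw [emultiplicity_eq_zero]
          intro hd
          exact hgX (eq_of_monic_of_associated hgm monic_X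
            ((hg.dvd_irreducible_iff_associated irreducible_X).1 hd))
        have hℓk : ¬ ℓ ∣ k := by
          intro hd
          have := Nat.dvd_gcd hd (hℓD.trans hDQ)
          rw [hkq] at this
          exact hℓ.one_lt.ne' (Nat.dvd_one.1 this)
        have hℓD1 : ¬ ℓ ∣ (D - 1) := by
          intro hd
          have : ℓ ∣ 1 := by
            have := Nat.dvd_sub hℓD hd
            rwa [show D - (D - 1) = 1 by omega] at this
          exact hℓ.one_lt.ne' (Nat.dvd_one.1 this)
        have := hmulG g hg
        rcases emult_coprime g hg k f1 f2 hc h1 h2 with ⟨e1, e2⟩ | ⟨e1, e2⟩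
        · rw [hgX0, e1, e2] at this
          have hm : multiplicity g G = b * k :=
            multiplicity_eq_of_emultiplicity_eq_some (by rw [this]; push_cast; simp)
          rw [hm, hℓ.dvd_mul]; tauto
        · rw [hgX0, e1, e2] at this
          have hm : multiplicity g G = B * k :=
            multiplicity_eq_of_emultiplicity_eq_some (by rw [this]; push_cast; simp)
          rw [hm, hℓ.dvd_mul, hB, hℓ.dvd_mul]; tauto
    clear_value D B F1 F2 c1 c2
    have hMG : M ∣ G := by
      rw [hGdef, hMdef]
      exact mul_dvd_mul (mul_dvd_mul (dvd_pow_self _ ha.ne') (dvd_pow_self _ hb.ne'))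
        (dvd_pow_self _ hB0.ne')
    have hGM : G ∣ M ^ (a + b + B) := by
      rw [hGdef, hMdef, mul_pow, mul_pow]
      have i1 : a ≤ a + b + B := by omega
      have i2 : b ≤ a + b + B := by omega
      have i3 : B ≤ a + b + B := by omega
      exact mul_dvd_mul (mul_dvd_mul (pow_dvd_pow X i1) (pow_dvd_pow F1 i2)) (pow_dvd_pow F2 i3)
    clear_value G M
    have hw := weil_bound (F := F) (Fintype.card F) D M.natDegree (a + b + B) rfl G M hGm hMm rfl
      hMG hGM
      χ hχ hDQ hD0 (hD ▸ pow_orderOf_eq_one χ) hmult ψ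
    calc _ ≤ 1 * (M.natDegree * √(Fintype.card F)) :=
          mul_le_mul hn2 hw (norm_nonneg _) zero_le_one
      _ ≤ _ := by
        rw [one_mul]
        exact mul_le_mul_of_nonneg_right hMd (by positivity)

/-- Twisted count of the points avoiding all the events in `J`. -/
noncomputable def sieveN {F T ι : Type*} [Fintype F] (ev : T → F → ℂ) (E : ι → F → Prop)
    (J : Finset ι) (d : T) : ℂ :=
  open Classical in ∑ x, ev d x * ∏ i ∈ J, (if E i x then 0 else 1)

lemma sieveN_insert {F T ι : Type*} [Fintype F] [CommGroup T] [DecidableEq T] [DecidableEq ι]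
    (ev : T → F → ℂ)
    (hmul : ∀ c d x, ev (c * d) x = ev c x * ev d x) (H : ι → Finset T) (E : ι → F → Prop)
    (J : Finset ι) (i : ι) (hi : i ∉ J) (h1 : 1 ∈ H i)
    (hE : ∀ x, (E i x → ∑ c ∈ H i, ev c x = (H i).card * ev 1 x) ∧
      (¬ E i x → ∑ c ∈ H i, ev c x = 0)) (d : T) :
    sieveN ev E (insert i J) d = (1 - 1 / ((H i).card : ℂ)) * sieveN ev E J d
      - 1 / ((H i).card : ℂ) * ∑ c ∈ (H i).erase 1, sieveN ev E J (d * c) := by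
  classical
  have hm : ((H i).card : ℂ) ≠ 0 := by
    exact_mod_cast (Finset.card_pos.2 ⟨1, h1⟩).ne'
  unfold sieveN
  rw [Finset.sum_comm, Finset.mul_sum, Finset.mul_sum, ← Finset.sum_sub_distrib]
  refine Finset.sum_congr rfl fun x _ => ?_
  rw [Finset.prod_insert hi, ← Finset.sum_mul]
  set P := ∏ j ∈ J, (if E j x then (0 : ℂ) else 1)
  simp_rw [hmul]
  rw [← Finset.mul_sum]
  have h2 : ∑ c ∈ (H i).erase 1, ev c x = ∑ c ∈ H i, ev c x - ev 1 x := by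
    rw [← Finset.add_sum_erase _ _ h1]; ring
  have h3 : ev d x * ev 1 x = ev d x := by rw [← hmul, mul_one]
  rw [h2, mul_sub, h3]
  by_cases h : E i x
  · rw [(hE x).1 h, if_pos h]
    have : ev d x * ((H i).card * ev 1 x) = (H i).card * ev d x := by
      rw [mul_left_comm, h3]
    rw [this]
    field_simp
    ring
  · rw [(hE x).2 h, if_neg h]
    field_simp
    ring

lemma sieveN_bound1 {F T ι : Type*} [Fintype F] [CommGroup T] (ev : T → F → ℂ)
    (hmul : ∀ c d x, ev (c * d) x = ev c x * ev d x) (H : ι → Finset T) (E : ι → F → Prop)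
    (B : ℝ) (hB : ∀ c ≠ 1, ‖∑ x, ev c x‖ ≤ B) (S : Finset ι) (h1 : ∀ i ∈ S, 1 ∈ H i)
    (hE : ∀ i ∈ S, ∀ x, (E i x → ∑ c ∈ H i, ev c x = (H i).card * ev 1 x) ∧
      (¬ E i x → ∑ c ∈ H i, ev c x = 0))
    (J : Finset ι) (hJ : J ⊆ S) : ∀ d : T,
    (∀ c : ι → T, (∀ i ∈ J, c i ∈ H i) → d * ∏ i ∈ J, c i ≠ 1) →
    ‖sieveN ev E J d‖ ≤ (∏ i ∈ J, (1 - 1 / ((H i).card : ℝ))) * 2 ^ J.card * B := by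
  classical
  induction J using Finset.induction_on with
  | empty =>
    intro d hd
    have : d ≠ 1 := by simpa using hd (fun _ => 1) (by simp)
    simpa [sieveN] using hB d this
  | insert i J hi ih =>
    intro d hd
    have hiS : i ∈ S := hJ (Finset.mem_insert_self _ _)
    have ih' := ih (fun j hj => hJ (Finset.mem_insert_of_mem hj))
    rw [sieveN_insert ev hmul H E J i hi (h1 i hiS) (hE i hiS)]
    have hm1 : 1 ≤ (H i).card := Finset.card_pos.2 ⟨1, h1 i hiS⟩
    have hm : (0 : ℝ) < (H i).card := by exact_mod_cast hm1
    set P := (∏ i ∈ J, (1 - 1 / ((H i).card : ℝ))) * 2 ^ J.card * B with hP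
    have hstep : ∀ c0 ∈ H i, ‖sieveN ev E J (d * c0)‖ ≤ P := by
      intro c0 hc0
      apply ih'
      intro c hc hcon
      refine hd (Function.update c i c0) ?_ ?_
      · intro j hj
        by_cases hji : j = i
        · subst hji; simpa using hc0
        · rw [Function.update_of_ne hji]
          exact hc j (Finset.mem_of_mem_insert_of_ne hj hji)
      · rw [Finset.prod_insert hi, Function.update_self, ← mul_assoc, ← hcon]
        congr 1
        refine Finset.prod_congr rfl fun j hj => Function.update_of_ne ?_ _ _
        rintro rfl; exact hi hj
    have hd1 := hstep 1 (h1 i hiS)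
    rw [mul_one] at hd1
    have hth : ‖(1 - 1 / ((H i).card : ℂ))‖ = 1 - 1 / ((H i).card : ℝ) := by
      have : (1 - 1 / ((H i).card : ℂ)) = ((1 - 1 / ((H i).card : ℝ) : ℝ) : ℂ) := by push_cast; rfl
      rw [this, Complex.norm_real, Real.norm_of_nonneg]
      rw [sub_nonneg, div_le_one hm]; exact_mod_cast hm1
    have hth0 : 0 ≤ 1 - 1 / ((H i).card : ℝ) := hth ▸ norm_nonneg _
    have hn2 : ‖1 / ((H i).card : ℂ) * ∑ c ∈ (H i).erase 1, sieveN ev E J (d * c)‖ ≤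
        (1 - 1 / ((H i).card : ℝ)) * P := by
      rw [norm_mul, norm_div, norm_one, Complex.norm_natCast]
      calc _ ≤ 1 / ((H i).card : ℝ) * ∑ c ∈ (H i).erase 1, P := by
            gcongr
            refine (norm_sum_le _ _).trans (Finset.sum_le_sum fun c hc => hstep c (Finset.mem_of_mem_erase hc))
        _ = _ := by
            rw [Finset.sum_const, Finset.card_erase_of_mem (h1 i hiS), nsmul_eq_mul,
              Nat.cast_sub hm1]
            field_simp
            push_cast; ring
    calc _ ≤ _ := norm_sub_le _ _
      _ ≤ (1 - 1 / ((H i).card : ℝ)) * P + (1 - 1 / ((H i).card : ℝ)) * P := by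
          refine add_le_add ?_ hn2
          rw [norm_mul, hth]; gcongr
      _ = _ := by
          rw [Finset.prod_insert hi, Finset.card_insert_of_notMem hi, hP]; ring

lemma sieve_ind_aux {T ι : Type*} [CommGroup T] (H : ι → Finset T) (S : Finset ι) (h1 : ∀ i ∈ S, 1 ∈ H i)
    (hind : ∀ c : ι → T, (∀ i ∈ S, c i ∈ H i) → ∏ i ∈ S, c i = 1 → ∀ i ∈ S, c i = 1)
    (J : Finset ι) (hJ : J ⊆ S) (i : ι) (hiS : i ∈ S) (hi : i ∉ J) (c0 : T)
    (hc0 : c0 ∈ H i) (hne : c0 ≠ 1) (c : ι → T) (hc : ∀ i ∈ J, c i ∈ H i) :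
    c0 * ∏ i ∈ J, c i ≠ 1 := by
  classical
  intro hcon
  have := hind (fun j => if j = i then c0 else if j ∈ J then c j else 1) ?_ ?_ i hiS
  · simp at this; exact hne this
  · intro j hj
    split_ifs with h h'
    · rw [h]; exact hc0
    · exact hc j h'
    · exact h1 j hj
  · refine Eq.trans ?_ hcon
    have : insert i J ⊆ S := Finset.insert_subset hiS hJ
    rw [← Finset.prod_subset this, Finset.prod_insert hi]
    · congr 1
      · simp
      · refine Finset.prod_congr rfl fun j hj => ?_
        rw [if_neg, if_pos hj]
        rintro rfl; exact hi hj
    · intro j hj hjn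
      rw [Finset.mem_insert, not_or] at hjn
      rw [if_neg hjn.1, if_neg hjn.2]

lemma sieveN_bound2 {F T ι : Type*} [Fintype F] [CommGroup T] (ev : T → F → ℂ)
    (hmul : ∀ c d x, ev (c * d) x = ev c x * ev d x) (H : ι → Finset T) (E : ι → F → Prop)
    (B : ℝ) (hB : ∀ c ≠ 1, ‖∑ x, ev c x‖ ≤ B) (S : Finset ι) (h1 : ∀ i ∈ S, 1 ∈ H i)
    (hE : ∀ i ∈ S, ∀ x, (E i x → ∑ c ∈ H i, ev c x = (H i).card * ev 1 x) ∧
      (¬ E i x → ∑ c ∈ H i, ev c x = 0))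
    (hind : ∀ c : ι → T, (∀ i ∈ S, c i ∈ H i) → ∏ i ∈ S, c i = 1 → ∀ i ∈ S, c i = 1)
    (J : Finset ι) (hJ : J ⊆ S) :
    ‖sieveN ev E J 1 - (∏ i ∈ J, (1 - 1 / ((H i).card : ℝ)) : ℝ) * ∑ x, ev 1 x‖ ≤
      (∏ i ∈ J, (1 - 1 / ((H i).card : ℝ))) * (2 ^ J.card - 1) * B := by
  classical
  induction J using Finset.induction_on with
  | empty => simp [sieveN]
  | insert i J hi ih =>
    have hiS : i ∈ S := hJ (Finset.mem_insert_self _ _)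
    have hJS : J ⊆ S := fun j hj => hJ (Finset.mem_insert_of_mem hj)
    have ih' := ih hJS
    rw [sieveN_insert ev hmul H E J i hi (h1 i hiS) (hE i hiS)]
    have hm1 : 1 ≤ (H i).card := Finset.card_pos.2 ⟨1, h1 i hiS⟩
    have hm : (0 : ℝ) < (H i).card := by exact_mod_cast hm1
    set th := ∏ i ∈ J, (1 - 1 / ((H i).card : ℝ)) with hthdef
    set P := th * 2 ^ J.card * B with hP
    have hth : ‖(1 - 1 / ((H i).card : ℂ))‖ = 1 - 1 / ((H i).card : ℝ) := by
      have : (1 - 1 / ((H i).card : ℂ)) = ((1 - 1 / ((H i).card : ℝ) : ℝ) : ℂ) := by push_cast; rfl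
      rw [this, Complex.norm_real, Real.norm_of_nonneg]
      rw [sub_nonneg, div_le_one hm]; exact_mod_cast hm1
    have hth0 : 0 ≤ 1 - 1 / ((H i).card : ℝ) := hth ▸ norm_nonneg _
    have hn2 : ‖1 / ((H i).card : ℂ) * ∑ c ∈ (H i).erase 1, sieveN ev E J (1 * c)‖ ≤
        (1 - 1 / ((H i).card : ℝ)) * P := by
      rw [norm_mul, norm_div, norm_one, Complex.norm_natCast]
      calc _ ≤ 1 / ((H i).card : ℝ) * ∑ c ∈ (H i).erase 1, P := by
            gcongr
            refine (norm_sum_le _ _).trans (Finset.sum_le_sum fun c hc => ?_)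
            rw [one_mul]
            exact sieveN_bound1 ev hmul H E B hB S h1 hE J hJS c (fun c' hc' =>
              sieve_ind_aux H S h1 hind J hJS i hiS hi c (Finset.mem_of_mem_erase hc)
                (Finset.ne_of_mem_erase hc) c' hc')
        _ = _ := by
            rw [Finset.sum_const, Finset.card_erase_of_mem (h1 i hiS), nsmul_eq_mul,
              Nat.cast_sub hm1]
            field_simp
            push_cast; ring
    have e : (1 - 1 / ((H i).card : ℂ)) * sieveN ev E J 1
      - 1 / ((H i).card : ℂ) * ∑ c ∈ (H i).erase 1, sieveN ev E J (1 * c) -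
      (∏ i ∈ insert i J, (1 - 1 / ((H i).card : ℝ)) : ℝ) * ∑ x, ev 1 x =
      (1 - 1 / ((H i).card : ℂ)) * (sieveN ev E J 1 - (th : ℝ) * ∑ x, ev 1 x) -
       1 / ((H i).card : ℂ) * ∑ c ∈ (H i).erase 1, sieveN ev E J (1 * c) := by
      rw [Finset.prod_insert hi, ← hthdef]; push_cast; ring
    rw [e]
    calc _ ≤ _ := norm_sub_le _ _
      _ ≤ (1 - 1 / ((H i).card : ℝ)) * (th * (2 ^ J.card - 1) * B)
          + (1 - 1 / ((H i).card : ℝ)) * P := by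
          refine add_le_add ?_ hn2
          rw [norm_mul, hth]; gcongr
      _ = _ := by
          rw [Finset.prod_insert hi, Finset.card_insert_of_notMem hi, hP]; ring

theorem sieve_main {F T ι : Type*} [Fintype F] [CommGroup T] (ev : T → F → ℂ)
    (hmul : ∀ c d x, ev (c * d) x = ev c x * ev d x) (H : ι → Finset T) (E : ι → F → Prop)
    (B : ℝ) (hB : ∀ c ≠ 1, ‖∑ x, ev c x‖ ≤ B) (S : Finset ι) (h1 : ∀ i ∈ S, 1 ∈ H i)
    (hE : ∀ i ∈ S, ∀ x, (E i x → ∑ c ∈ H i, ev c x = (H i).card * ev 1 x) ∧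
      (¬ E i x → ∑ c ∈ H i, ev c x = 0))
    (hind : ∀ c : ι → T, (∀ i ∈ S, c i ∈ H i) → ∏ i ∈ S, c i = 1 → ∀ i ∈ S, c i = 1)
    (hev1 : ∀ x, ev 1 x = 0 ∨ ev 1 x = 1) (A : ℝ)
    (hA : A ≤ (∑ x, ev 1 x).re) (J R : Finset ι) (hJS : J ⊆ S) (hRS : R ⊆ S)
    (hJR : Disjoint J R) (hm2 : ∀ i ∈ S, 2 ≤ (H i).card)
    (hδ : 0 < 1 - ∑ r ∈ R, 1 / ((H r).card : ℝ))
    (hnum : 2 ^ J.card * B * (R.card - 1 + 2 * (1 - ∑ r ∈ R, 1 / ((H r).card : ℝ))) <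
      (1 - ∑ r ∈ R, 1 / ((H r).card : ℝ)) * (A + B)) :
    ∃ x, ev 1 x = 1 ∧ (∀ i ∈ J, ¬ E i x) ∧ ∀ i ∈ R, ¬ E i x := by
  classical
  by_contra hcon
  push Not at hcon
  set th := ∏ i ∈ J, (1 - 1 / ((H i).card : ℝ)) with hth
  have hth0 : 0 < th := by
    refine Finset.prod_pos fun i hi => ?_
    have := hm2 i (hJS hi)
    have : (2 : ℝ) ≤ (H i).card := by exact_mod_cast this
    rw [sub_pos, div_lt_one (by linarith)]; linarith
  set δ := 1 - ∑ r ∈ R, 1 / ((H r).card : ℝ) with hδdef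
  set N := (sieveN ev E J 1).re with hN
  -- pointwise inequality
  have key : N ≤ ∑ r ∈ R, (N - (sieveN ev E (insert r J) 1).re) := by
    have e1 : ∀ J' : Finset ι, (sieveN ev E J' 1).re =
        ∑ x, if ev 1 x = 1 ∧ ∀ i ∈ J', ¬ E i x then (1 : ℝ) else 0 := by
      intro J'
      unfold sieveN
      rw [Complex.re_sum]
      refine Finset.sum_congr rfl fun x _ => ?_
      rcases hev1 x with h | h
      · simp [h]
      · by_cases h' : ∀ i ∈ J', ¬ E i x
        · rw [if_pos ⟨h, h'⟩, Finset.prod_congr rfl (g := fun _ => 1)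
            (fun i hi => by rw [if_neg (h' i hi)])]
          simp [h]
        · rw [if_neg (fun hh => h' hh.2)]
          push Not at h'
          obtain ⟨i, hi, hEi⟩ := h'
          rw [Finset.prod_eq_zero hi (by rw [if_pos hEi])]
          simp
    simp_rw [hN, e1, ← Finset.sum_sub_distrib]
    rw [Finset.sum_comm]
    refine Finset.sum_le_sum fun x _ => ?_
    have hnn : ∀ r ∈ R, 0 ≤ ((if ev 1 x = 1 ∧ ∀ i ∈ J, ¬ E i x then (1 : ℝ) else 0) -
        if ev 1 x = 1 ∧ ∀ i ∈ insert r J, ¬ E i x then (1 : ℝ) else 0) := by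
      intro r _
      rw [sub_nonneg]
      by_cases h : ev 1 x = 1 ∧ ∀ i ∈ insert r J, ¬ E i x
      · rw [if_pos h, if_pos ⟨h.1, fun i hi => h.2 i (Finset.mem_insert_of_mem hi)⟩]
      · rw [if_neg h]; split_ifs <;> norm_num
    by_cases h : ev 1 x = 1 ∧ ∀ i ∈ J, ¬ E i x
    · obtain ⟨r, hr, hEr⟩ := hcon x h.1 h.2
      refine le_trans ?_ (Finset.single_le_sum hnn hr)
      rw [if_pos h, if_neg (fun hh => hh.2 r (Finset.mem_insert_self _ _) hEr)]
      norm_num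
    · rw [if_neg h]
      exact Finset.sum_nonneg (fun r hr => by simpa [h] using hnn r hr)
  have hdiff : ∀ r ∈ R, N - (sieveN ev E (insert r J) 1).re ≤
      1 / ((H r).card : ℝ) * N + (1 - 1 / ((H r).card : ℝ)) * (th * 2 ^ J.card * B) := by
    intro r hr
    have hrS := hRS hr
    have hrJ : r ∉ J := fun h => Finset.disjoint_left.1 hJR h hr
    have hm1 : 1 ≤ (H r).card := Finset.card_pos.2 ⟨1, h1 r hrS⟩
    have hm : (0 : ℝ) < (H r).card := by exact_mod_cast hm1
    rw [sieveN_insert ev hmul H E J r hrJ (h1 r hrS) (hE r hrS)]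
    have hn2 : ‖1 / ((H r).card : ℂ) * ∑ c ∈ (H r).erase 1, sieveN ev E J (1 * c)‖ ≤
        (1 - 1 / ((H r).card : ℝ)) * (th * 2 ^ J.card * B) := by
      rw [norm_mul, norm_div, norm_one, Complex.norm_natCast]
      calc _ ≤ 1 / ((H r).card : ℝ) * ∑ c ∈ (H r).erase 1, (th * 2 ^ J.card * B) := by
            gcongr
            refine (norm_sum_le _ _).trans (Finset.sum_le_sum fun c hc => ?_)
            rw [one_mul]
            exact sieveN_bound1 ev hmul H E B hB S h1 hE J hJS c (fun c' hc' =>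
              sieve_ind_aux H S h1 hind J hJS r hrS hrJ c (Finset.mem_of_mem_erase hc)
                (Finset.ne_of_mem_erase hc) c' hc')
        _ = _ := by
            rw [Finset.sum_const, Finset.card_erase_of_mem (h1 r hrS), nsmul_eq_mul,
              Nat.cast_sub hm1]
            field_simp
            push_cast; ring
    have hn3 := (Complex.re_le_norm _).trans hn2
    have e : ((1 - 1 / ((H r).card : ℂ)) * sieveN ev E J 1).re = (1 - 1 / ((H r).card : ℝ)) * N := by
      have : (1 - 1 / ((H r).card : ℂ)) = ((1 - 1 / ((H r).card : ℝ) : ℝ) : ℂ) := by push_cast; rfl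
      rw [this, Complex.re_ofReal_mul]
    rw [Complex.sub_re, e]
    linarith
  have hsum := key.trans (Finset.sum_le_sum hdiff)
  rw [Finset.sum_add_distrib, ← Finset.sum_mul, ← Finset.sum_mul, Finset.sum_sub_distrib] at hsum
  simp only [Finset.sum_const, nsmul_eq_mul, mul_one] at hsum
  have hNlow : th * A - th * (2 ^ J.card - 1) * B ≤ N := by
    have h2 := sieveN_bound2 ev hmul H E B hB S h1 hE hind J hJS
    have h3 := (Complex.abs_re_le_norm _).trans h2
    rw [Complex.sub_re, Complex.re_ofReal_mul] at h3
    have h4 := (abs_le.1 h3).1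
    have h5 : th * A ≤ th * (∑ x, ev 1 x).re := mul_le_mul_of_nonneg_left hA hth0.le
    linarith
  have hs : ∑ r ∈ R, 1 / ((H r).card : ℝ) = 1 - δ := by rw [hδdef]; ring
  rw [hs] at hsum
  have h6 : δ * (th * A - th * (2 ^ J.card - 1) * B) ≤ δ * N := mul_le_mul_of_nonneg_left hNlow hδ.le
  have h7 := mul_lt_mul_of_pos_left hnum hth0
  nlinarith

section
variable (K L : Type*) [Field K] [Fintype K] [Field L] [Fintype L] [Algebra K L]

/-- The Frobenius as a `K`-linear endomorphism of `L`. -/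
noncomputable def frobL : Module.End K L := (FiniteField.frobeniusAlgHom K L).toLinearMap

variable {K L}

lemma frobL_pow_apply (i : ℕ) (y : L) : (frobL K L ^ i) y = y ^ Fintype.card K ^ i := by
  induction i generalizing y with
  | zero => simp
  | succ i ih =>
    rw [pow_succ, Module.End.mul_apply, ih]
    simp only [frobL, AlgHom.toLinearMap_apply, FiniteField.coe_frobeniusAlgHom]
    rw [← pow_mul, pow_succ']

lemma frob_ker_card_le (P : K[X]) (hP : P ≠ 0) :
    Nat.card (LinearMap.ker (aeval (frobL K L) P)) ≤ Fintype.card K ^ P.natDegree := by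
  classical
  set q := Fintype.card K with hq
  have hq1 : 1 < q := Fintype.one_lt_card
  -- the linearized polynomial
  set Λ : L[X] := ∑ i ∈ Finset.range (P.natDegree + 1), C (algebraMap K L (P.coeff i)) * X ^ (q ^ i)
    with hΛ
  have hev : ∀ y : L, Λ.eval y = aeval (frobL K L) P y := by
    intro y
    rw [aeval_eq_sum_range, hΛ, eval_finsetSum, LinearMap.sum_apply]
    refine Finset.sum_congr rfl fun i _ => ?_
    rw [LinearMap.smul_apply, frobL_pow_apply, eval_mul, eval_C, eval_pow, eval_X, Algebra.smul_def]
  have hdeg : Λ.natDegree ≤ q ^ P.natDegree := by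
    refine natDegree_sum_le_of_forall_le _ _ fun i hi => ?_
    refine (natDegree_C_mul_X_pow_le _ _).trans ?_
    exact Nat.pow_le_pow_right hq1.le (Nat.lt_succ_iff.1 (Finset.mem_range.1 hi))
  have hΛ0 : Λ ≠ 0 := by
    intro h0
    have hc : Λ.coeff (q ^ P.natDegree) = algebraMap K L P.leadingCoeff := by
      rw [hΛ, finsetSum_coeff, Finset.sum_eq_single P.natDegree]
      · simp
      · intro i _ hi
        rw [coeff_C_mul, coeff_X_pow, if_neg, mul_zero]
        intro h
        exact hi (Nat.pow_right_injective hq1 h).symm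
      · intro h; simp at h
    rw [h0, coeff_zero] at hc
    have := (map_eq_zero _).1 hc.symm
    exact hP (leadingCoeff_eq_zero.1 this)
  have hsub : (LinearMap.ker (aeval (frobL K L) P) : Set L) ⊆ (Λ.roots.toFinset : Set L) := by
    intro y hy
    rw [SetLike.mem_coe, LinearMap.mem_ker] at hy
    simp only [Finset.mem_coe, Multiset.mem_toFinset, mem_roots hΛ0, IsRoot.def]
    rw [hev, hy]
  calc Nat.card (LinearMap.ker (aeval (frobL K L) P))
      = Set.ncard (LinearMap.ker (aeval (frobL K L) P) : Set L) := rfl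
    _ ≤ Set.ncard (Λ.roots.toFinset : Set L) := Set.ncard_le_ncard hsub (Finset.finite_toSet _)
    _ = Λ.roots.toFinset.card := Set.ncard_coe_finset _
    _ ≤ _ := (Multiset.toFinset_card_le _).trans ((card_roots' _).trans hdeg)

lemma frob_card_mul (P : K[X]) :
    Nat.card (LinearMap.range (aeval (frobL K L) P)) * Nat.card (LinearMap.ker (aeval (frobL K L) P))
      = Fintype.card L := by
  have e := (aeval (frobL K L) P).quotKerEquivRange
  rw [← Nat.card_congr e.toEquiv, ← Nat.card_eq_fintype_card,
    Submodule.card_eq_card_quotient_mul_card (LinearMap.ker (aeval (frobL K L) P)), mul_comm]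

lemma frob_Xn (n : ℕ) (hL : Fintype.card L = Fintype.card K ^ n) :
    aeval (frobL K L) (X ^ n - 1 : K[X]) = 0 := by
  ext y
  rw [map_sub, map_pow, aeval_X, map_one, LinearMap.sub_apply, frobL_pow_apply, ← hL,
    FiniteField.pow_card]
  simp

lemma frob_range_le (n : ℕ) (hL : Fintype.card L = Fintype.card K ^ n) (P R : K[X])
    (hPR : X ^ n - 1 = P * R) :
    LinearMap.range (aeval (frobL K L) P) ≤ LinearMap.ker (aeval (frobL K L) R) := by
  rintro _ ⟨y, rfl⟩
  rw [LinearMap.mem_ker, ← Module.End.mul_apply, ← map_mul, mul_comm, ← hPR, frob_Xn n hL]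
  rfl

lemma frob_ker_card (n : ℕ) (hn : 0 < n) (hL : Fintype.card L = Fintype.card K ^ n) (P R : K[X])
    (hPR : X ^ n - 1 = P * R) :
    Nat.card (LinearMap.ker (aeval (frobL K L) P)) = Fintype.card K ^ P.natDegree ∧
    LinearMap.range (aeval (frobL K L) P) = LinearMap.ker (aeval (frobL K L) R) := by
  have h0 : (X ^ n - 1 : K[X]) ≠ 0 := (monic_X_pow_sub_C (1 : K) hn.ne').ne_zero
  have hP0 : P ≠ 0 := by rintro rfl; simp at hPR; exact h0 hPR
  have hR0 : R ≠ 0 := by rintro rfl; simp at hPR; exact h0 hPR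
  have hdeg : P.natDegree + R.natDegree = n := by
    rw [← natDegree_mul hP0 hR0, ← hPR]
    simpa using natDegree_X_pow_sub_C (n := n) (r := (1 : K))
  have hP := frob_ker_card_le (L := L) P hP0
  have hR := frob_ker_card_le (L := L) R hR0
  have hm := frob_card_mul (L := L) P
  have hle := frob_range_le n hL P R hPR
  have hcle : Nat.card (LinearMap.range (aeval (frobL K L) P)) ≤
      Nat.card (LinearMap.ker (aeval (frobL K L) R)) := by
    exact Set.ncard_le_ncard hle (Set.toFinite _)
  have hq : 0 < Fintype.card K := Fintype.card_pos
  rw [hL, ← hdeg, pow_add] at hm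
  have hkp : 0 < Nat.card (LinearMap.ker (aeval (frobL K L) P)) := Nat.card_pos
  have hrp : 0 < Nat.card (LinearMap.range (aeval (frobL K L) P)) := Nat.card_pos
  set a := Nat.card (LinearMap.range (aeval (frobL K L) P))
  set b := Nat.card (LinearMap.ker (aeval (frobL K L) P))
  set x := Fintype.card K ^ P.natDegree
  set y := Fintype.card K ^ R.natDegree
  have hx : 0 < x := pow_pos hq _
  have hy : 0 < y := pow_pos hq _
  have hay : a ≤ y := hcle.trans hR
  have hbx : b = x := by
    by_contra hne
    have hlt : b < x := lt_of_le_of_ne hP hne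
    have : a * b < x * y := by
      calc a * b ≤ y * b := Nat.mul_le_mul_right _ hay
        _ < y * x := Nat.mul_lt_mul_of_pos_left hlt hy
        _ = x * y := mul_comm _ _
    omega
  have hay' : a = y := by
    rw [hbx, mul_comm x] at hm
    exact Nat.eq_of_mul_eq_mul_right hx hm
  refine ⟨hbx, ?_⟩
  apply SetLike.coe_injective
  refine Set.eq_of_subset_of_ncard_le hle ?_ (Set.toFinite _)
  have : Nat.card (LinearMap.ker (aeval (frobL K L) R)) ≤ a := by rw [hay']; exact hR
  exact this

/-- Existence of additive characters detecting a subgroup. -/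
lemma addchar_subgroup (W : AddSubgroup L) (Hs : Finset (AddChar L ℂ))
    (hH : ∀ ψ, ψ ∈ Hs ↔ ∀ w ∈ W, ψ w = 1) :
    Hs.card = W.index ∧ ∀ x, (x ∉ W → ∑ ψ ∈ Hs, ψ x = 0) := by
  classical
  have : Fintype (L ⧸ W) := Fintype.ofFinite _
  let f : AddChar (L ⧸ W) ℂ → AddChar L ℂ := fun η => η.compAddMonoidHom (QuotientAddGroup.mk' W)
  have hf : Function.Injective f := by
    intro η η' h
    ext z
    obtain ⟨y, rfl⟩ := QuotientAddGroup.mk'_surjective W z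
    exact DFunLike.congr_fun h y
  have himg : Hs = Finset.univ.image f := by
    ext ψ
    rw [hH]
    simp only [Finset.mem_image, Finset.mem_univ, true_and]
    constructor
    · intro h
      have hle : W ≤ ψ.toAddMonoidHom.ker := by
        intro w hw
        rw [AddMonoidHom.mem_ker]
        exact h w hw
      refine ⟨AddChar.toAddMonoidHomEquiv.symm (QuotientAddGroup.lift W ψ.toAddMonoidHom hle), ?_⟩
      ext x
      rfl
    · rintro ⟨η, rfl⟩ w hw
      simp only [f, AddChar.compAddMonoidHom_apply]
      have : QuotientAddGroup.mk' W w = 0 := by simpa using hw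
      rw [this, AddChar.map_zero_eq_one]
  constructor
  · rw [himg, Finset.card_image_of_injective _ hf, Finset.card_univ, AddChar.card_eq,
      AddSubgroup.index, Nat.card_eq_fintype_card]
  · intro x hx
    rw [himg, Finset.sum_image (fun a _ b _ h => hf h)]
    have := AddChar.sum_apply_eq_ite (α := L ⧸ W) (QuotientAddGroup.mk' W x)
    rw [if_neg (by simpa using hx)] at this
    exact this

lemma mulchar_pow (p : ℕ) (hp : p.Prime) (hpQ : p ∣ Fintype.card L - 1)
    (Hs : Finset (MulChar L ℂ)) (hH : ∀ χ, χ ∈ Hs ↔ χ ^ p = 1) :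
    Hs.card = p ∧ ∀ x : L, (¬ ∃ y, y ^ p = x) → ∑ χ ∈ Hs, χ x = 0 := by
  classical
  have hcyc : IsCyclic (MulChar L ℂ) := by
    obtain ⟨e⟩ := MulChar.mulEquiv_units L ℂ
    exact isCyclic_of_surjective e.symm e.symm.surjective
  have hcard : Nat.card (MulChar L ℂ) = Fintype.card L - 1 := by
    rw [MulChar.card_eq_card_units_of_hasEnoughRootsOfUnity, Nat.card_eq_fintype_card,
      Fintype.card_units]
  constructor
  · have h := IsCyclic.card_powMonoidHom_ker (G := MulChar L ℂ) p
    rw [hcard, Nat.gcd_eq_right hpQ] at h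
    refine Eq.trans ?_ h
    rw [← Set.ncard_coe_finset Hs]
    apply Nat.card_congr
    refine Equiv.subtypeEquivRight fun χ => ?_
    rw [Finset.mem_coe, hH, MonoidHom.mem_ker, powMonoidHom_apply]
  · intro x hx
    have hx0 : x ≠ 0 := by
      rintro rfl; exact hx ⟨0, zero_pow hp.ne_zero⟩
    obtain ⟨u, rfl⟩ := isUnit_iff_ne_zero.2 hx0
    have hnot : u ∉ (powMonoidHom p : Lˣ →* Lˣ).range := by
      rintro ⟨v, hv⟩
      exact hx ⟨v, by rw [← Units.val_pow_eq_pow_val]; exact congrArg _ hv⟩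
    rw [← CommGroup.forall_monoidHom_apply_eq_one_iff ℂ] at hnot
    push Not at hnot
    obtain ⟨φ, hφ, hφu⟩ := hnot
    set χ0 := MulChar.ofUnitHom φ with hχ0
    have hmem : χ0 ^ p = 1 := by
      apply MulChar.ext
      intro a
      rw [MulChar.pow_apply' _ hp.ne_zero, MulChar.one_apply_coe, hχ0, MulChar.ofUnitHom_coe,
        ← Units.val_pow_eq_pow_val, ← map_pow]
      have := hφ (a ^ p) ⟨a, rfl⟩
      rw [this]; rfl
    have hne : χ0 u ≠ 1 := by
      rw [hχ0, MulChar.ofUnitHom_coe]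
      intro h
      exact hφu (Units.ext h)
    have hinv : χ0 u * ∑ χ ∈ Hs, χ u = ∑ χ ∈ Hs, χ u := by
      rw [Finset.mul_sum]
      refine Finset.sum_bij (fun χ _ => χ0 * χ) ?_ ?_ ?_ ?_
      · intro χ hχ
        rw [hH] at hχ ⊢
        rw [mul_pow, hmem, hχ, one_mul]
      · intro a _ b _ h
        exact mul_left_cancel h
      · intro b hb
        refine ⟨χ0⁻¹ * b, ?_, by simp⟩
        rw [hH] at hb ⊢
        rw [mul_pow, inv_pow, hmem, hb, inv_one, one_mul]
      · intro χ _
        rw [MulChar.mul_apply]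
    have h0 : (χ0 u - 1) * ∑ χ ∈ Hs, χ (u : L) = 0 := by rw [sub_mul, hinv, one_mul, sub_self]
    exact (mul_eq_zero.1 h0).resolve_left (sub_ne_zero.2 hne)
end

lemma ratEval_div {F : Type} [Field F] (f1 f2 : F[X]) (x : F) (h : f2.eval x ≠ 0) :
    ratEval (algebraMap F[X] (RatFunc F) f1 / algebraMap F[X] (RatFunc F) f2) x =
      f1.eval x / f2.eval x := by
  have hf2 : f2 ≠ 0 := by rintro rfl; simp at h
  set f := algebraMap F[X] (RatFunc F) f1 / algebraMap F[X] (RatFunc F) f2 with hf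
  have hd : f.denom ∣ f2 := RatFunc.denom_div_dvd f1 f2
  have hd0 : f.denom.eval x ≠ 0 := by
    obtain ⟨r, hr⟩ := hd
    intro h0
    apply h
    rw [hr, eval_mul, h0, zero_mul]
  have e : f.num * f2 = f1 * f.denom := by
    have h1 := RatFunc.num_div_denom f
    conv_rhs at h1 => rw [hf]
    rw [div_eq_div_iff (RatFunc.algebraMap_ne_zero f.denom_ne_zero) (RatFunc.algebraMap_ne_zero hf2),
      ← map_mul, ← map_mul] at h1
    exact RatFunc.algebraMap_injective F h1
  have e' := congrArg (eval x) e
  rw [eval_mul, eval_mul] at e'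
  rw [ratEval, RatFunc.eval, eval₂_id, eval₂_id, div_eq_div_iff hd0 h, e']

lemma primitive_of {L : Type} [Field L] [Fintype L] (x : L) (hx0 : x ≠ 0)
    (h : ∀ p ∈ (Fintype.card L - 1).primeFactors, ¬ ∃ y, y ^ p = x) : IsPrimitiveElem x := by
  classical
  have hcard : 0 < Fintype.card L - 1 := by
    have : 1 < Fintype.card L := Fintype.one_lt_card
    omega
  refine orderOf_eq_of_pow_and_pow_div_prime hcard (FiniteField.pow_card_sub_one_eq_one x hx0) ?_
  intro p hp hpd hpow
  refine h p (Nat.mem_primeFactors.2 ⟨hp, hpd, hcard.ne'⟩) ?_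
  obtain ⟨u, rfl⟩ := isUnit_iff_ne_zero.2 hx0
  obtain ⟨g, hg⟩ := IsCyclic.exists_monoid_generator (α := Lˣ)
  obtain ⟨k, hk⟩ := Submonoid.mem_powers_iff _ _ |>.1 (hg u)
  have hgo : orderOf g = Fintype.card L - 1 := by
    rw [← Fintype.card_units, ← Nat.card_eq_fintype_card]
    exact orderOf_eq_card_of_forall_mem_zpowers (fun y => by
      obtain ⟨k, hk⟩ := Submonoid.mem_powers_iff _ _ |>.1 (hg y)
      exact ⟨k, by simpa using hk⟩)
  obtain ⟨r, hr⟩ := hpd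
  have hr' : (Fintype.card L - 1) / p = r := by rw [hr, Nat.mul_div_cancel_left _ hp.pos]
  rw [hr'] at hpow
  have hpow' : u ^ r = 1 := Units.ext (by simpa using hpow)
  rw [← hk, ← pow_mul] at hpow'
  have hd := orderOf_dvd_of_pow_eq_one hpow'
  have hr0 : 0 < r := by
    rcases Nat.eq_zero_or_pos r with h0 | h0
    · rw [h0] at hr; omega
    · exact h0
  rw [hgo, hr] at hd
  have hpk : p ∣ k := Nat.dvd_of_mul_dvd_mul_right hr0 hd
  obtain ⟨m, rfl⟩ := hpk
  refine ⟨((g ^ m : Lˣ) : L), ?_⟩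
  rw [← hk, ← Units.val_pow_eq_pow_val, ← pow_mul, mul_comm m p]

lemma normal_of {K L : Type} [Field K] [Field L] [Fintype K] [Fintype L] [Algebra K L] (n : ℕ)
    (hn : 0 < n) (hL : Fintype.card L = Fintype.card K ^ n) (x : L)
    (h : ∀ P : K[X], P.Monic → Irreducible P → P ∣ X ^ n - 1 → ¬ ∃ y, aeval (frobL K L) P y = x) :
    IsNormalElem K n x := by
  classical
  have hXn : (X ^ n - 1 : K[X]) ≠ 0 := (monic_X_pow_sub_C (1 : K) hn.ne').ne_zero
  have hdegXn : (X ^ n - 1 : K[X]).natDegree = n := by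
    simpa using natDegree_X_pow_sub_C (n := n) (r := (1 : K))
  have hlin : LinearIndependent K (fun i : Fin n => x ^ Fintype.card K ^ (i : ℕ)) := by
    rw [Fintype.linearIndependent_iff]
    intro c hc
    by_contra hcon
    push Not at hcon
    obtain ⟨i0, hi0⟩ := hcon
    set f : K[X] := ∑ i : Fin n, C (c i) * X ^ (i : ℕ) with hf
    have hfx : aeval (frobL K L) f x = 0 := by
      rw [hf, map_sum, LinearMap.sum_apply, ← hc]
      refine Finset.sum_congr rfl fun i _ => ?_
      rw [map_mul, aeval_C, map_pow, aeval_X, Module.End.mul_apply, frobL_pow_apply,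
        Module.algebraMap_end_apply]
    have hf0 : f ≠ 0 := by
      intro h0
      have : f.coeff i0 = c i0 := by
        rw [hf, finsetSum_coeff, Finset.sum_eq_single i0]
        · simp
        · intro j _ hj
          rw [coeff_C_mul, coeff_X_pow, if_neg (fun h => hj (Fin.ext h.symm)), mul_zero]
        · simp
      rw [h0, coeff_zero] at this
      exact hi0 this.symm
    have hfd : f.natDegree < n := by
      refine lt_of_le_of_lt (natDegree_sum_le_of_forall_le (n := n - 1) _ _ fun i _ => ?_)
        (show n - 1 < n by omega)
      refine (natDegree_C_mul_X_pow_le _ _).trans ?_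
      have := i.2
      omega
    set d := EuclideanDomain.gcd f (X ^ n - 1) with hd
    obtain ⟨e, he⟩ : d ∣ X ^ n - 1 := EuclideanDomain.gcd_dvd_right _ _
    have hdx : aeval (frobL K L) d x = 0 := by
      rw [hd, EuclideanDomain.gcd_eq_gcd_ab, mul_comm f, map_add, map_mul, map_mul, LinearMap.add_apply,
        frob_Xn n hL, zero_mul, Module.End.mul_apply, hfx]
      simp
    have he0 : e ≠ 0 := by rintro rfl; rw [mul_zero] at he; exact hXn he
    have hd0 : d ≠ 0 := by rintro h0; rw [h0, zero_mul] at he; exact hXn he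
    have hdle : d.natDegree ≤ f.natDegree :=
      natDegree_le_of_dvd (EuclideanDomain.gcd_dvd_left _ _) hf0
    have heu : ¬ IsUnit e := by
      intro hu
      have := natDegree_mul hd0 he0
      rw [← he, hdegXn, natDegree_eq_zero_of_isUnit hu] at this
      omega
    obtain ⟨P, hPm, hPi, r, hr⟩ := exists_monic_irreducible_factor e heu
    have hPR : X ^ n - 1 = P * (r * d) := by rw [he, hr]; ring
    refine h P hPm hPi ⟨_, hPR⟩ ?_
    have hmem : x ∈ LinearMap.ker (aeval (frobL K L) (r * d)) := by
      rw [LinearMap.mem_ker, map_mul, Module.End.mul_apply, hdx, map_zero]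
    rw [← (frob_ker_card n hn hL P _ hPR).2] at hmem
    exact hmem
  refine ⟨hlin, ?_⟩
  have : Nonempty (Fin n) := ⟨⟨0, hn⟩⟩
  apply hlin.span_eq_top_of_card_eq_finrank
  rw [Fintype.card_fin]
  have hc := Module.card_eq_pow_finrank (K := K) (V := L)
  rw [hL] at hc
  exact Nat.pow_right_injective (Fintype.one_lt_card : 1 < Fintype.card K) hc

lemma ind_mul {G ι : Type*} [CommGroup G] (S : Finset ι) (c : ι → G) (e : ι → ℕ) (i : ι)
    (hi : i ∈ S) (hc : ∀ j ∈ S, c j ^ e j = 1) (hprod : ∏ j ∈ S, c j = 1)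
    (hcop : ∀ j ∈ S, j ≠ i → Nat.Coprime (e i) (e j)) : c i = 1 := by
  classical
  set M := ∏ j ∈ S.erase i, e j with hM
  have h1 : (∏ j ∈ S, c j) ^ M = 1 := by rw [hprod, one_pow]
  rw [← Finset.mul_prod_erase S c hi, mul_pow, ← Finset.prod_pow] at h1
  have h2 : ∏ j ∈ S.erase i, c j ^ M = 1 := by
    refine Finset.prod_eq_one fun j hj => ?_
    obtain ⟨t, ht⟩ := Finset.dvd_prod_of_mem e hj
    rw [hM, ht, pow_mul, hc j (Finset.mem_of_mem_erase hj), one_pow]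
  rw [h2, mul_one] at h1
  have h3 : Nat.Coprime (e i) M := Nat.Coprime.prod_right fun j hj =>
    hcop j (Finset.mem_of_mem_erase hj) (Finset.ne_of_mem_erase hj)
  have h4 := Nat.dvd_gcd (orderOf_dvd_of_pow_eq_one (hc i hi)) (orderOf_dvd_of_pow_eq_one h1)
  rw [h3.gcd_eq_one, Nat.dvd_one] at h4
  exact orderOf_eq_one_iff.1 h4

lemma addChar_prod_apply {A ι : Type*} [AddCommGroup A] (S : Finset ι) (c : ι → AddChar A ℂ)
    (x : A) : (∏ j ∈ S, c j) x = ∏ j ∈ S, c j x := by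
  classical
  induction S using Finset.induction_on with
  | empty => simp
  | insert a S ha ih => rw [Finset.prod_insert ha, Finset.prod_insert ha, AddChar.mul_apply, ih]

lemma ind_add {K L ι : Type*} [Field K] [Fintype K] [Field L] [Fintype L] [Algebra K L]
    (S : Finset ι) (c : ι → AddChar L ℂ) (e : ι → K[X]) (i : ι)
    (hi : i ∈ S) (hc : ∀ j ∈ S, ∀ y, c j (aeval (frobL K L) (e j) y) = 1)
    (hprod : ∏ j ∈ S, c j = 1)
    (hcop : ∀ j ∈ S, j ≠ i → IsCoprime (e i) (e j)) : c i = 1 := by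
  classical
  set M := ∏ j ∈ S.erase i, e j with hM
  have h1 : ∀ y, c i (aeval (frobL K L) M y) = 1 := by
    intro y
    have h2 : (∏ j ∈ S, c j) (aeval (frobL K L) M y) = 1 := by rw [hprod]; rfl
    rw [addChar_prod_apply, ← Finset.mul_prod_erase S _ hi] at h2
    rw [Finset.prod_eq_one, mul_one] at h2
    · exact h2
    · intro j hj
      obtain ⟨t, ht⟩ := Finset.dvd_prod_of_mem e hj
      rw [hM, ht, map_mul, Module.End.mul_apply]
      exact hc j (Finset.mem_of_mem_erase hj) _
  have h3 : IsCoprime (e i) M := IsCoprime.prod_right fun j hj =>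
    hcop j (Finset.mem_of_mem_erase hj) (Finset.ne_of_mem_erase hj)
  obtain ⟨a, b, hab⟩ := h3
  ext y
  have h4 : y = aeval (frobL K L) (e i) (aeval (frobL K L) a y) +
      aeval (frobL K L) M (aeval (frobL K L) b y) := by
    rw [← Module.End.mul_apply, ← Module.End.mul_apply, ← map_mul, ← map_mul, ← LinearMap.add_apply,
      ← map_add, mul_comm (e i), mul_comm M, hab, map_one]
    rfl
  rw [h4, AddChar.map_add_eq_mul, hc i hi, h1, AddChar.one_apply, one_mul]

/-- The evaluation of a triple of characters. -/
noncomputable def evT {L : Type} [Field L] (φ : L → L)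
    (c : MulChar L ℂ × MulChar L ℂ × AddChar L ℂ) (x : L) : ℂ :=
  c.1 x * c.2.1 (φ x) * c.2.2 x

lemma evT_mul {L : Type} [Field L] (φ : L → L) (c d : MulChar L ℂ × MulChar L ℂ × AddChar L ℂ)
    (x : L) : evT φ (c * d) x = evT φ c x * evT φ d x := by
  simp only [evT, Prod.fst_mul, Prod.snd_mul, MulChar.mul_apply, AddChar.mul_apply]
  ring

open Classical in
/-- The groups of characters attached to the events of the sieve. -/
noncomputable def Hset (K L : Type) [Field K] [Field L] [Fintype K] [Fintype L] [Algebra K L]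
    [Fintype (MulChar L ℂ)] :
    ℕ ⊕ ℕ ⊕ K[X] → Finset (MulChar L ℂ × MulChar L ℂ × AddChar L ℂ)
  | Sum.inl p => (Finset.univ.filter fun χ : MulChar L ℂ => χ ^ p = 1).image fun χ => (χ, 1, 1)
  | Sum.inr (Sum.inl p) =>
    (Finset.univ.filter fun χ : MulChar L ℂ => χ ^ p = 1).image fun χ => (1, χ, 1)
  | Sum.inr (Sum.inr P) =>
    (Finset.univ.filter fun ψ : AddChar L ℂ => ∀ y, ψ (aeval (frobL K L) P y) = 1).image
      fun ψ => (1, 1, ψ)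

/-- The events of the sieve. -/
def Eset (K L : Type) [Field K] [Field L] [Fintype K] [Algebra K L] (φ : L → L) :
    ℕ ⊕ ℕ ⊕ K[X] → L → Prop
  | Sum.inl p, x => ∃ y, y ^ p = x
  | Sum.inr (Sum.inl p), x => ∃ y, y ^ p = φ x
  | Sum.inr (Sum.inr P), x => ∃ y, aeval (frobL K L) P y = x

lemma one_mulChar_of_pow {L : Type} [Field L] (p : ℕ) (hp : p ≠ 0) (χ : MulChar L ℂ)
    (hχ : χ ^ p = 1) (x : L) (hx : ∃ y, y ^ p = x) : χ x = (1 : MulChar L ℂ) x := by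
  obtain ⟨y, rfl⟩ := hx
  by_cases hy : y = 0
  · subst hy
    rw [zero_pow hp, MulChar.map_zero, MulChar.map_zero]
  · rw [map_pow, ← MulChar.pow_apply' χ hp, hχ, map_pow,
      MulChar.one_apply (isUnit_iff_ne_zero.2 hy), one_pow]

/-- Admissible indices. -/
def IdxOK (K : Type) [Field K] (Q n : ℕ) : ℕ ⊕ ℕ ⊕ K[X] → Prop
  | Sum.inl p => p.Prime ∧ p ∣ Q - 1
  | Sum.inr (Sum.inl p) => p.Prime ∧ p ∣ Q - 1
  | Sum.inr (Sum.inr P) => P.Monic ∧ Irreducible P ∧ P ∣ X ^ n - 1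

/-- The size of the character groups. -/
noncomputable def mIdx (K : Type) [Field K] [Fintype K] : ℕ ⊕ ℕ ⊕ K[X] → ℕ
  | Sum.inl p => p
  | Sum.inr (Sum.inl p) => p
  | Sum.inr (Sum.inr P) => Fintype.card K ^ P.natDegree

section
variable {K L : Type} [Field K] [Field L] [Fintype K] [Fintype L] [Algebra K L]
    [Fintype (MulChar L ℂ)]

lemma Hset_one (i : ℕ ⊕ ℕ ⊕ K[X]) : 1 ∈ Hset K L i := by
  classical
  rcases i with p | p | P
  · exact Finset.mem_image.2 ⟨1, by simp, rfl⟩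
  · exact Finset.mem_image.2 ⟨1, by simp, rfl⟩
  · exact Finset.mem_image.2 ⟨1, by simp, rfl⟩

lemma Hset_spec (n : ℕ) (hn : 0 < n) (hL : Fintype.card L = Fintype.card K ^ n) (φ : L → L)
    (i : ℕ ⊕ ℕ ⊕ K[X]) (hi : IdxOK K (Fintype.card L) n i) :
    (Hset K L i).card = mIdx K i ∧
    ∀ x, (Eset K L φ i x → ∑ c ∈ Hset K L i, evT φ c x = (Hset K L i).card * evT φ 1 x) ∧
      (¬ Eset K L φ i x → ∑ c ∈ Hset K L i, evT φ c x = 0) := by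
  classical
  rcases i with p | p | P
  · have hinj : Function.Injective (fun χ : MulChar L ℂ =>
        ((χ, 1, 1) : MulChar L ℂ × MulChar L ℂ × AddChar L ℂ)) := fun a b h => congrArg Prod.fst h
    obtain ⟨h1, h2⟩ := mulchar_pow p hi.1 hi.2
      (Finset.univ.filter fun χ : MulChar L ℂ => χ ^ p = 1) (by simp)
    refine ⟨by rw [Hset, Finset.card_image_of_injective _ hinj, h1]; rfl, fun x => ⟨fun hE => ?_, fun hE => ?_⟩⟩
    · rw [← nsmul_eq_mul]
      refine Finset.sum_eq_card_nsmul fun c hc => ?_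
      obtain ⟨χ, hχ, rfl⟩ := Finset.mem_image.1 hc
      simp only [evT]
      rw [one_mulChar_of_pow p hi.1.ne_zero χ (by simpa using hχ) x hE]
      rfl
    · rw [Hset, Finset.sum_image (fun a _ b _ h => hinj h)]
      simp only [evT]
      rw [← Finset.sum_mul, ← Finset.sum_mul, h2 x hE, zero_mul, zero_mul]
  · have hinj : Function.Injective (fun χ : MulChar L ℂ =>
        ((1, χ, 1) : MulChar L ℂ × MulChar L ℂ × AddChar L ℂ)) :=
      fun a b h => congrArg (fun t => t.2.1) h
    obtain ⟨h1, h2⟩ := mulchar_pow p hi.1 hi.2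
      (Finset.univ.filter fun χ : MulChar L ℂ => χ ^ p = 1) (by simp)
    refine ⟨by rw [Hset, Finset.card_image_of_injective _ hinj, h1]; rfl, fun x => ⟨fun hE => ?_, fun hE => ?_⟩⟩
    · rw [← nsmul_eq_mul]
      refine Finset.sum_eq_card_nsmul fun c hc => ?_
      obtain ⟨χ, hχ, rfl⟩ := Finset.mem_image.1 hc
      simp only [evT]
      rw [one_mulChar_of_pow p hi.1.ne_zero χ (by simpa using hχ) (φ x) hE]
      rfl
    · rw [Hset, Finset.sum_image (fun a _ b _ h => hinj h)]
      simp only [evT]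
      rw [← Finset.sum_mul, ← Finset.mul_sum, h2 (φ x) hE, mul_zero, zero_mul]
  · have hinj : Function.Injective (fun ψ : AddChar L ℂ =>
        ((1, 1, ψ) : MulChar L ℂ × MulChar L ℂ × AddChar L ℂ)) :=
      fun a b h => congrArg (fun t => t.2.2) h
    obtain ⟨R, hR⟩ := hi.2.2
    obtain ⟨h1, h2⟩ := addchar_subgroup (LinearMap.range (aeval (frobL K L) P)).toAddSubgroup
      (Finset.univ.filter fun ψ : AddChar L ℂ => ∀ y, ψ (aeval (frobL K L) P y) = 1) (by
        intro ψ
        simp)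
    have hidx : (LinearMap.range (aeval (frobL K L) P)).toAddSubgroup.index =
        Fintype.card K ^ P.natDegree := by
      have e1 := frob_card_mul (K := K) (L := L) P
      have e2 := (LinearMap.range (aeval (frobL K L) P)).toAddSubgroup.card_mul_index
      rw [Nat.card_eq_fintype_card (α := L), ← e1, (frob_ker_card n hn hL P R hR).1] at e2
      exact Nat.eq_of_mul_eq_mul_left Nat.card_pos e2
    refine ⟨by rw [Hset, Finset.card_image_of_injective _ hinj, h1, hidx]; rfl,
      fun x => ⟨fun hE => ?_, fun hE => ?_⟩⟩
    · rw [← nsmul_eq_mul]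
      refine Finset.sum_eq_card_nsmul fun c hc => ?_
      obtain ⟨ψ, hψ, rfl⟩ := Finset.mem_image.1 hc
      obtain ⟨y, rfl⟩ := hE
      simp only [evT]
      rw [(Finset.mem_filter.1 hψ).2 y]
      rfl
    · rw [Hset, Finset.sum_image (fun a _ b _ h => hinj h)]
      simp only [evT]
      rw [← Finset.mul_sum, h2 x (fun h => hE (by obtain ⟨y, hy⟩ := h; exact ⟨y, hy⟩)), mul_zero]

lemma Hset_ind (n Q : ℕ) (S : Finset (ℕ ⊕ ℕ ⊕ K[X])) (hS : ∀ i ∈ S, IdxOK K Q n i)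
    (c : ℕ ⊕ ℕ ⊕ K[X] → MulChar L ℂ × MulChar L ℂ × AddChar L ℂ)
    (hc : ∀ i ∈ S, c i ∈ Hset K L i) (hprod : ∏ i ∈ S, c i = 1) : ∀ i ∈ S, c i = 1 := by
  classical
  have hp1 : ∏ i ∈ S, (c i).1 = 1 := by rw [← Prod.fst_prod, hprod]; rfl
  have hp2 : ∏ i ∈ S, (c i).2.1 = 1 := by rw [← Prod.fst_prod, ← Prod.snd_prod, hprod]; rfl
  have hp3 : ∏ i ∈ S, (c i).2.2 = 1 := by rw [← Prod.snd_prod, ← Prod.snd_prod, hprod]; rfl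
  intro i hi
  have hci := hc i hi
  rcases i with p | p | P
  · obtain ⟨χ, hχ, he⟩ := Finset.mem_image.1 hci
    have : (c (Sum.inl p)).1 = 1 := by
      refine ind_mul S (fun j => (c j).1) (fun j => Sum.elim id (fun _ => 1) j) (Sum.inl p) hi ?_ hp1 ?_
      · intro j hj
        have := hc j hj
        rcases j with p' | p' | P' <;> obtain ⟨χ', hχ', he'⟩ := Finset.mem_image.1 this <;> rw [← he']
        · simpa using hχ'
        · simp
        · simp
      · intro j hj hne
        rcases j with p' | j
        · exact (Nat.coprime_primes (hS _ hi).1 (hS _ hj).1).2 (fun h => hne (by rw [h]))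
        · simp
    rw [← he] at this ⊢
    exact Prod.ext this rfl
  · obtain ⟨χ, hχ, he⟩ := Finset.mem_image.1 hci
    have : (c (Sum.inr (Sum.inl p))).2.1 = 1 := by
      refine ind_mul S (fun j => (c j).2.1)
        (fun j => Sum.elim (fun _ => 1) (Sum.elim id (fun _ => 1)) j) (Sum.inr (Sum.inl p)) hi ?_ hp2 ?_
      · intro j hj
        have := hc j hj
        rcases j with p' | p' | P' <;> obtain ⟨χ', hχ', he'⟩ := Finset.mem_image.1 this <;> rw [← he']
        · simp
        · simpa using hχ'
        · simp
      · intro j hj hne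
        rcases j with p' | p' | j
        · simp
        · exact (Nat.coprime_primes (hS _ hi).1 (hS _ hj).1).2 (fun h => hne (by rw [h]))
        · simp
    rw [← he] at this ⊢
    exact Prod.ext rfl (Prod.ext this rfl)
  · obtain ⟨ψ, hψ, he⟩ := Finset.mem_image.1 hci
    have : (c (Sum.inr (Sum.inr P))).2.2 = 1 := by
      refine ind_add (K := K) S (fun j => (c j).2.2)
        (fun j => Sum.elim (fun _ => 1) (Sum.elim (fun _ => 1) id) j) (Sum.inr (Sum.inr P)) hi ?_ hp3 ?_
      · intro j hj
        have := hc j hj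
        rcases j with p' | p' | P' <;> obtain ⟨χ', hχ', he'⟩ := Finset.mem_image.1 this <;> rw [← he']
        · simp
        · simp
        · exact (Finset.mem_filter.1 hχ').2
      · intro j hj hne
        rcases j with p' | p' | P'
        · exact isCoprime_one_right
        · exact isCoprime_one_right
        · have h1 := hS _ hi
          have h2 := hS _ hj
          refine (h1.2.1.coprime_iff_not_dvd).2 ?_
          intro hd
          refine hne ?_
          have := eq_of_monic_of_associated h1.1 h2.1 ((h1.2.1.dvd_irreducible_iff_associated h2.2.1).1 hd)
          rw [this]
    rw [← he] at this ⊢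
    exact Prod.ext rfl (Prod.ext rfl this)
end

lemma upsilon_zero_count {L : Type} [Field L] [Fintype L] [DecidableEq L] (f1 f2 : L[X])
    (h0 : f1 * f2 ≠ 0) (hd1 : f1.natDegree ≤ 3) (hd2 : f2.natDegree ≤ 2) :
    (Finset.univ.filter fun x : L => ¬ (x ≠ 0 ∧ f1.eval x ≠ 0 ∧ f2.eval x ≠ 0)).card ≤ 6 := by
  have h1 : X * (f1 * f2) ≠ 0 := mul_ne_zero X_ne_zero h0
  have hsub : (Finset.univ.filter fun x : L => ¬ (x ≠ 0 ∧ f1.eval x ≠ 0 ∧ f2.eval x ≠ 0)) ⊆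
      (X * (f1 * f2)).roots.toFinset := by
    intro x hx
    rw [Multiset.mem_toFinset, mem_roots h1, IsRoot.def, eval_mul, eval_mul, eval_X]
    have := (Finset.mem_filter.1 hx).2
    by_contra hne
    apply this
    refine ⟨fun h => hne ?_, fun h => hne ?_, fun h => hne ?_⟩ <;> rw [h] <;> ring
  refine (Finset.card_le_card hsub).trans ((Multiset.toFinset_card_le _).trans ((card_roots' _).trans ?_))
  refine natDegree_mul_le.trans ?_
  have := natDegree_mul_le (p := f1) (q := f2)
  rw [natDegree_X]
  omega

theorem sieve_field {K L : Type} [Field K] [Field L] [Fintype K] [Fintype L] [Algebra K L]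
    (n : ℕ) (hn : 0 < n) (hL : Fintype.card L = Fintype.card K ^ n) (f : RatFunc L)
    (hf : f ∈ Upsilon L 3 2) (J1 R1 J2 R2 : Finset ℕ) (J3 R3 : Finset K[X])
    (h1 : ∀ p, p ∈ J1 ∨ p ∈ R1 ↔ p ∈ (Fintype.card L - 1).primeFactors) (d1 : Disjoint J1 R1)
    (h2 : ∀ p, p ∈ J2 ∨ p ∈ R2 ↔ p ∈ (Fintype.card L - 1).primeFactors) (d2 : Disjoint J2 R2)
    (h3 : ∀ P : K[X], P ∈ J3 ∨ P ∈ R3 ↔ P.Monic ∧ Irreducible P ∧ P ∣ X ^ n - 1)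
    (d3 : Disjoint J3 R3) (δ : ℝ)
    (hδ : δ = 1 - (∑ p ∈ R1, 1 / (p : ℝ) + (∑ p ∈ R2, 1 / (p : ℝ) +
      ∑ P ∈ R3, 1 / ((Fintype.card K : ℝ) ^ P.natDegree)))) (hδ0 : 0 < δ)
    (hnum : 6 * 2 ^ (J1.card + (J2.card + J3.card)) *
      (((R1.card + (R2.card + R3.card) : ℕ) : ℝ) - 1 + 2 * δ) ≤ δ * √(Fintype.card L)) :
    ∃ α : L, IsPrimitiveElem α ∧ IsNormalElem K n α ∧ IsPrimitiveElem (ratEval f α) := by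
  classical
  obtain ⟨f1, f2, hf2, rfl, hd1, hd2, hc, k, g, hk, hgm, hg, hgX, hkq, hg1, hg2⟩ := hf
  have hf12 : f1 * f2 ≠ 0 := by
    intro h; rw [h] at hg2; exact hg2 (dvd_zero _)
  have hfin : Finite (MulChar L ℂ) := inferInstance
  let _ : Fintype (MulChar L ℂ) := Fintype.ofFinite _
  set φ : L → L := fun x => f1.eval x / f2.eval x with hφ
  set J := J1.disjSum (J2.disjSum J3) with hJ
  set R := R1.disjSum (R2.disjSum R3) with hR
  have hOK : ∀ i ∈ J ∪ R, IdxOK K (Fintype.card L) n i := by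
    intro i hi
    rw [Finset.mem_union] at hi
    rcases i with p | p | P
    · have : p ∈ J1 ∨ p ∈ R1 := by simpa [hJ, hR] using hi
      have := (h1 p).1 this
      exact ⟨Nat.prime_of_mem_primeFactors this, Nat.dvd_of_mem_primeFactors this⟩
    · have : p ∈ J2 ∨ p ∈ R2 := by simpa [hJ, hR] using hi
      have := (h2 p).1 this
      exact ⟨Nat.prime_of_mem_primeFactors this, Nat.dvd_of_mem_primeFactors this⟩
    · have : P ∈ J3 ∨ P ∈ R3 := by simpa [hJ, hR] using hi
      exact (h3 P).1 this
  have hspec := fun i hi => Hset_spec (K := K) (L := L) n hn hL φ i (hOK i hi)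
  have hdisj : Disjoint J R := by
    rw [Finset.disjoint_left]
    intro i hi hi'
    rcases i with p | p | P
    · exact Finset.disjoint_left.1 d1 (by simpa [hJ] using hi) (by simpa [hR] using hi')
    · exact Finset.disjoint_left.1 d2 (by simpa [hJ] using hi) (by simpa [hR] using hi')
    · exact Finset.disjoint_left.1 d3 (by simpa [hJ] using hi) (by simpa [hR] using hi')
  have hm2 : ∀ i ∈ J ∪ R, 2 ≤ (Hset K L i).card := by
    intro i hi
    rw [(hspec i hi).1]
    have h := hOK i hi
    rcases i with p | p | P
    · exact h.1.two_le
    · exact h.1.two_le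
    · have hq : 2 ≤ Fintype.card K := Fintype.one_lt_card
      exact hq.trans (Nat.le_self_pow (Irreducible.natDegree_pos h.2.1).ne' _)
  have hsum : 1 - ∑ r ∈ R, 1 / ((Hset K L r).card : ℝ) = δ := by
    have : ∑ r ∈ R, 1 / ((Hset K L r).card : ℝ) = ∑ r ∈ R, 1 / (mIdx K r : ℝ) :=
      Finset.sum_congr rfl fun r hr => by rw [(hspec r (Finset.mem_union_right _ hr)).1]
    rw [this, hR, Finset.sum_disjSum, Finset.sum_disjSum, hδ]
    simp [mIdx]
  have hQ1 : (1 : ℝ) < √(Fintype.card L) := by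
    rw [Real.lt_sqrt (by norm_num)]
    have : 1 < Fintype.card L := Fintype.one_lt_card
    exact_mod_cast (by simpa using this)
  have hev1 : ∀ x, evT φ 1 x = if (x ≠ 0 ∧ f1.eval x ≠ 0 ∧ f2.eval x ≠ 0) then 1 else 0 := by
    intro x
    simp only [evT, Prod.fst_one, Prod.snd_one, AddChar.one_apply, mul_one]
    by_cases hx : x = 0
    · rw [hx, MulChar.map_zero, zero_mul, if_neg (by simp)]
    · by_cases hy : φ x = 0
      · rw [hy, MulChar.map_zero, mul_zero, if_neg]
        rintro ⟨-, ha, hb⟩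
        exact div_ne_zero ha hb hy
      · rw [MulChar.one_apply (isUnit_iff_ne_zero.2 hx), MulChar.one_apply (isUnit_iff_ne_zero.2 hy),
          if_pos, one_mul]
        exact ⟨hx, fun h => hy (by simp [hφ, h]), fun h => hy (by simp [hφ, h])⟩
  have hA : (Fintype.card L : ℝ) - 6 ≤ (∑ x, evT φ 1 x).re := by
    simp_rw [hev1]
    rw [Finset.sum_boole]
    have hz := upsilon_zero_count f1 f2 hf12 hd1 hd2
    have hs := Finset.card_filter_add_card_filter_not (s := (Finset.univ : Finset L))
      (fun x => x ≠ 0 ∧ f1.eval x ≠ 0 ∧ f2.eval x ≠ 0)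
    rw [Finset.card_univ] at hs
    rw [Complex.natCast_re, ← hs]
    push_cast
    have : ((Finset.univ.filter fun x : L => ¬ (x ≠ 0 ∧ f1.eval x ≠ 0 ∧ f2.eval x ≠ 0)).card : ℝ) ≤ 6 := by
      exact_mod_cast hz
    linarith
  have hB : ∀ c : MulChar L ℂ × MulChar L ℂ × AddChar L ℂ, c ≠ 1 →
      ‖∑ x, evT φ c x‖ ≤ 6 * √(Fintype.card L) := by
    intro c hc1
    refine charsum6 f1 f2 hd1 hd2 hc k g hk hgm hg hgX hkq hg1 hg2 c.1 c.2.1 c.2.2 ?_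
    rintro ⟨ha, hb, hc'⟩
    exact hc1 (Prod.ext ha (Prod.ext hb hc'))
  obtain ⟨x, hx1, hxJ, hxR⟩ := sieve_main (evT φ) (fun c d x => evT_mul φ c d x)
    (Hset K L) (Eset K L φ) (6 * √(Fintype.card L)) hB (J ∪ R) (fun i _ => Hset_one i)
    (fun i hi => (hspec i hi).2)
    (fun c hc' hp => Hset_ind n (Fintype.card L) (J ∪ R) hOK c hc' hp)
    (fun x => by rw [hev1]; split_ifs <;> simp) ((Fintype.card L : ℝ) - 6) hA J R
    Finset.subset_union_left Finset.subset_union_right hdisj hm2 (by rw [hsum]; exact hδ0)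
    (by
      rw [hsum]
      have hs : √(Fintype.card L : ℝ) * √(Fintype.card L : ℝ) = Fintype.card L :=
        Real.mul_self_sqrt (Nat.cast_nonneg _)
      have e1 := mul_le_mul_of_nonneg_right hnum (Real.sqrt_nonneg (Fintype.card L : ℝ))
      rw [mul_assoc δ, hs] at e1
      have hcJ : J.card = J1.card + (J2.card + J3.card) := by
        rw [hJ, Finset.card_disjSum, Finset.card_disjSum]
      have hcR : R.card = R1.card + (R2.card + R3.card) := by
        rw [hR, Finset.card_disjSum, Finset.card_disjSum]
      rw [hcJ, hcR]
      calc _ = 6 * 2 ^ (J1.card + (J2.card + J3.card)) *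
            (((R1.card + (R2.card + R3.card) : ℕ) : ℝ) - 1 + 2 * δ) * √(Fintype.card L) := by ring
        _ ≤ _ := e1
        _ < _ := by
          have := mul_pos hδ0 (sub_pos.2 hQ1)
          nlinarith)
  have hx : x ≠ 0 ∧ f1.eval x ≠ 0 ∧ f2.eval x ≠ 0 := by
    rw [hev1] at hx1
    by_contra h
    rw [if_neg h] at hx1
    exact zero_ne_one hx1
  have hall : ∀ i ∈ J ∪ R, ¬ Eset K L φ i x := by
    intro i hi
    rcases Finset.mem_union.1 hi with h | h
    exacts [hxJ i h, hxR i h]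
  refine ⟨x, ?_, ?_, ?_⟩
  · refine primitive_of x hx.1 fun p hp => ?_
    exact hall (Sum.inl p) (by simpa [hJ, hR] using (h1 p).2 hp)
  · refine normal_of n hn hL x fun P hP hPi hPd => ?_
    exact hall (Sum.inr (Sum.inr P)) (by simpa [hJ, hR] using (h3 P).2 ⟨hP, hPi, hPd⟩)
  · rw [ratEval_div f1 f2 x hx.2.2]
    refine primitive_of _ (div_ne_zero hx.2.1 hx.2.2) fun p hp => ?_
    exact hall (Sum.inr (Sum.inl p)) (by simpa [hJ, hR] using (h2 p).2 hp)

/-- A splitting of the prime factors of `m` in a core of at most `u` primes, and at most `r`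
remaining primes, whose sum of inverses is at most `S / M`. -/
def PrimeSplit (m M u r S : ℕ) : Prop :=
  ∃ A : Finset ℕ, (m.primeFactors.filter (· ∈ A)).card ≤ u ∧
    (m.primeFactors.filter (· ∉ A)).card ≤ r ∧
    (M : ℝ) * ∑ p ∈ m.primeFactors.filter (· ∉ A), 1 / (p : ℝ) ≤ S

open Classical in
/-- The same for the irreducible factors of `X ^ n - 1`. -/
def PolySplit (K : Type) [Field K] [Fintype K] (n M u r S : ℕ) : Prop :=
  ∃ J R : Finset K[X], Disjoint J R ∧
    (∀ P : K[X], P ∈ J ∨ P ∈ R ↔ P.Monic ∧ Irreducible P ∧ P ∣ X ^ n - 1) ∧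
    J.card ≤ u ∧ R.card ≤ r ∧
    (M : ℝ) * ∑ P ∈ R, 1 / ((Fintype.card K : ℝ) ^ P.natDegree) ≤ S

lemma crit_num (c c' t t' δ δ' s : ℝ) (hc : 0 < c) (hcc : c ≤ c') (hδ' : 0 < δ')
    (hδ : δ' ≤ δ) (ht : 0 ≤ t') (htt : t ≤ t')
    (h : 6 * c' * (t' + 2 * δ') ≤ δ' * s) : 6 * c * (t + 2 * δ) ≤ δ * s := by
  have h1 : 6 * c * (t' + 2 * δ') ≤ δ' * s := by
    refine le_trans ?_ h
    have : 0 ≤ t' + 2 * δ' := by positivity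
    gcongr
  have h2 : 12 * c ≤ s := by
    have : 12 * c * δ' ≤ s * δ' := by nlinarith [mul_nonneg hc.le ht]
    exact le_of_mul_le_mul_right this hδ'
  nlinarith [mul_nonneg hc.le (sub_nonneg.2 htt), mul_nonneg (sub_nonneg.2 hδ) (sub_nonneg.2 h2)]

theorem crit {K L : Type} [Field K] [Field L] [Fintype K] [Fintype L] [Algebra K L]
    (n : ℕ) (hn : 0 < n) (hL : Fintype.card L = Fintype.card K ^ n) (f : RatFunc L)
    (hf : f ∈ Upsilon L 3 2) (M x u1 r1 S1 u2 r2 S2 u3 r3 S3 : ℕ)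
    (h1 : PrimeSplit (Fintype.card L - 1) M u1 r1 S1)
    (h2 : PrimeSplit (Fintype.card L - 1) M u2 r2 S2)
    (h3 : PolySplit K n M u3 r3 S3) (hx : 0 < x) (hM : S1 + S2 + S3 + x ≤ M)
    (hnum : (6 * 2 ^ (u1 + u2 + u3) * ((r1 + r2 + r3 - 1) * M + 2 * x)) ^ 2 ≤
      x ^ 2 * Fintype.card L) :
    ∃ α : L, IsPrimitiveElem α ∧ IsNormalElem K n α ∧ IsPrimitiveElem (ratEval f α) := by
  classical
  obtain ⟨A1, hu1, hr1, hS1⟩ := h1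
  obtain ⟨A2, hu2, hr2, hS2⟩ := h2
  obtain ⟨J3, R3, hd3, hm3, hu3, hr3, hS3⟩ := h3
  have hM0 : (0 : ℝ) < M := by exact_mod_cast (by omega : 0 < M)
  have hx0 : (0 : ℝ) < x := by exact_mod_cast hx
  set T1 := ∑ p ∈ (Fintype.card L - 1).primeFactors.filter (· ∉ A1), 1 / (p : ℝ) with hT1
  set T2 := ∑ p ∈ (Fintype.card L - 1).primeFactors.filter (· ∉ A2), 1 / (p : ℝ) with hT2
  set T3 := ∑ P ∈ R3, 1 / ((Fintype.card K : ℝ) ^ P.natDegree) with hT3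
  have hT1n : 0 ≤ T1 := Finset.sum_nonneg fun _ _ => by positivity
  have hT2n : 0 ≤ T2 := Finset.sum_nonneg fun _ _ => by positivity
  have hT3n : 0 ≤ T3 := Finset.sum_nonneg fun _ _ => by positivity
  have hM' : (S1 : ℝ) + S2 + S3 + x ≤ M := by exact_mod_cast hM
  have hδ : (x : ℝ) / M ≤ 1 - (T1 + (T2 + T3)) := by
    rw [div_le_iff₀ hM0]
    nlinarith
  have hδ0 : 0 < (x : ℝ) / M := by positivity
  refine sieve_field n hn hL f hf
    ((Fintype.card L - 1).primeFactors.filter (· ∈ A1))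
    ((Fintype.card L - 1).primeFactors.filter (· ∉ A1))
    ((Fintype.card L - 1).primeFactors.filter (· ∈ A2))
    ((Fintype.card L - 1).primeFactors.filter (· ∉ A2)) J3 R3 (fun p => ?_)
    (Finset.disjoint_filter_filter_not _ _ (· ∈ A1)) (fun p => ?_)
    (Finset.disjoint_filter_filter_not _ _ (· ∈ A2)) hm3 hd3
    (1 - (T1 + (T2 + T3))) rfl (hδ0.trans_le hδ) ?_
  · simp only [Finset.mem_filter]; tauto
  · simp only [Finset.mem_filter]; tauto
  · have hnum' : 6 * 2 ^ (u1 + u2 + u3) * (((r1 + r2 + r3 - 1 : ℕ) : ℝ) * M + 2 * x) ≤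
        x * √(Fintype.card L) := by
      have h := Real.sqrt_le_sqrt (by exact_mod_cast hnum :
        ((6 * 2 ^ (u1 + u2 + u3) * (((r1 + r2 + r3 - 1 : ℕ) : ℝ) * M + 2 * x)) ^ 2 : ℝ) ≤
          (x : ℝ) ^ 2 * (Fintype.card L : ℝ))
      rwa [Real.sqrt_sq (by positivity), Real.sqrt_mul (by positivity),
        Real.sqrt_sq (by positivity)] at h
    refine crit_num _ (2 ^ (u1 + u2 + u3)) _ ((r1 + r2 + r3 - 1 : ℕ) : ℝ) _ ((x : ℝ) / M) _
      (by positivity) ?_ hδ0 hδ (by positivity) ?_ ?_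
    · exact pow_le_pow_right₀ (by norm_num) (by omega)
    · rw [sub_le_iff_le_add]
      exact_mod_cast (by omega)
    · have e : 6 * 2 ^ (u1 + u2 + u3) * (((r1 + r2 + r3 - 1 : ℕ) : ℝ) + 2 * ((x : ℝ) / M)) =
        6 * 2 ^ (u1 + u2 + u3) * (((r1 + r2 + r3 - 1 : ℕ) : ℝ) * M + 2 * x) / M := by
        field_simp
      rw [e, div_mul_eq_mul_div]
      gcongr

lemma sum_deg_le {K : Type} [Field K] (S : Finset K[X]) (A : K[X]) (hA : A ≠ 0)
    (hS : ∀ P ∈ S, P.Monic ∧ Irreducible P ∧ P ∣ A) : ∑ P ∈ S, P.natDegree ≤ A.natDegree := by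
  have h : ∏ P ∈ S, P ∣ A := by
    refine Finset.prod_dvd_of_coprime ?_ (fun P hP => (hS P hP).2.2)
    intro P hP R hR hne
    refine ((hS P hP).2.1.coprime_iff_not_dvd).2 fun hd => hne ?_
    exact eq_of_monic_of_associated (hS P hP).1 (hS R hR).1
      (((hS P hP).2.1.dvd_irreducible_iff_associated (hS R hR).2.1).1 hd)
  rw [← natDegree_prod_of_monic _ _ (fun P hP => (hS P hP).1)]
  exact natDegree_le_of_dvd h hA

lemma sum_deg_eq {K : Type} [Field K] (S : Finset K[X]) (A : K[X]) (hA : A.Monic)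
    (hsq : Squarefree A)
    (hS : ∀ P, P ∈ S ↔ P.Monic ∧ Irreducible P ∧ P ∣ A) : ∑ P ∈ S, P.natDegree = A.natDegree := by
  classical
  have hA0 : A ≠ 0 := hA.ne_zero
  have hnd := (UniqueFactorizationMonoid.squarefree_iff_nodup_normalizedFactors hA0).1 hsq
  have hSe : S = (UniqueFactorizationMonoid.normalizedFactors A).toFinset := by
    ext P
    rw [hS, Multiset.mem_toFinset, Polynomial.mem_normalizedFactors_iff hA0]
    tauto
  have hprod : (UniqueFactorizationMonoid.normalizedFactors A).prod = A := by
    rw [UniqueFactorizationMonoid.prod_normalizedFactors_eq, hA.normalize_eq_self]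
    exact hA0
  have h2 : ∏ P ∈ S, P = A := by
    rw [hSe, Finset.prod, Multiset.toFinset_val, hnd.dedup, Multiset.map_id', hprod]
  rw [← natDegree_prod_of_monic _ _ (fun P hP => ((hS P).1 hP).1), h2]

lemma dvd_X_gcd {K : Type} [Field K] (P : K[X]) (a b : ℕ) (ha : P ∣ X ^ a - 1) (hb : P ∣ X ^ b - 1) :
    P ∣ X ^ (a.gcd b) - 1 := by
  have e : ∀ m : ℕ, P ∣ X ^ m - 1 ↔ (AdjoinRoot.root P) ^ m = 1 := by
    intro m
    rw [← AdjoinRoot.mk_eq_zero, map_sub, map_pow, AdjoinRoot.mk_X, map_one, sub_eq_zero]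
  rw [e] at ha hb ⊢
  exact pow_gcd_eq_one.2 ⟨ha, hb⟩

lemma X_pow_sub_one_dvd {K : Type} [Field K] (a b : ℕ) (h : a ∣ b) : (X ^ a - 1 : K[X]) ∣ X ^ b - 1 := by
  obtain ⟨c, rfl⟩ := h
  rw [pow_mul]
  simpa using sub_dvd_pow_sub_pow (X ^ a : K[X]) 1 c

section
variable {K : Type} [Field K] [Fintype K]

lemma irr_dvd_iff (n d : ℕ) (hn : 0 < n) (P : K[X]) (hP : Irreducible P) :
    P ∣ X ^ (n.gcd (Fintype.card K ^ d - 1)) - 1 ↔ P ∣ X ^ n - 1 ∧ P.natDegree ∣ d := by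
  have hq : 1 < Fintype.card K := Fintype.one_lt_card
  have hqd : 1 ≤ Fintype.card K ^ d := Nat.one_le_pow _ _ (by omega)
  have hX : (X ^ (Nat.card K) ^ d - X : K[X]) = X * (X ^ (Fintype.card K ^ d - 1) - 1) := by
    rw [Nat.card_eq_fintype_card, mul_sub, ← pow_succ', Nat.sub_add_cancel hqd, mul_one]
  have hiff := hP.natDegree_dvd_iff_dvd_X_pow_card_pow_sub_X (n := d)
  constructor
  · intro h
    refine ⟨h.trans (X_pow_sub_one_dvd _ _ (Nat.gcd_dvd_left _ _)), ?_⟩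
    rw [hiff, hX]
    exact (h.trans (X_pow_sub_one_dvd _ _ (Nat.gcd_dvd_right _ _))).mul_left _
  · rintro ⟨h1, h2⟩
    rw [hiff, hX] at h2
    refine dvd_X_gcd P _ _ h1 ?_
    rcases hP.prime.dvd_or_dvd h2 with h | h
    · exfalso
      have h3 : P ∣ X ^ n := h.trans (dvd_pow_self _ hn.ne')
      have h4 : P ∣ 1 := by simpa using dvd_sub h3 h1
      exact hP.not_isUnit (isUnit_of_dvd_one h4)
    · exact h

lemma sum_deg_dvd (S : Finset K[X]) (n d : ℕ) (hn : 0 < n) (hd : 0 < d)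
    (hS : ∀ P, P ∈ S ↔ P.Monic ∧ Irreducible P ∧ P ∣ X ^ n - 1) :
    ∑ P ∈ S.filter (fun P => P.natDegree ∣ d), P.natDegree = n.gcd (Fintype.card K ^ d - 1) := by
  set g := n.gcd (Fintype.card K ^ d - 1) with hg
  have hg0 : 0 < g := Nat.gcd_pos_of_pos_left _ hn
  have hqd : 1 ≤ Fintype.card K ^ d := Nat.one_le_pow _ _ Fintype.card_pos
  have hgK : (g : K) ≠ 0 := by
    intro h0
    obtain ⟨c, hc⟩ := Nat.gcd_dvd_right n (Fintype.card K ^ d - 1)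
    have : ((Fintype.card K ^ d - 1 : ℕ) : K) = 0 := by rw [hc, ← hg, Nat.cast_mul, h0, zero_mul]
    rw [Nat.cast_sub hqd, Nat.cast_pow, FiniteField.cast_card_eq_zero, zero_pow hd.ne'] at this
    simp at this
  have hmon : (X ^ g - 1 : K[X]).Monic := by simpa using monic_X_pow_sub_C (1 : K) hg0.ne'
  rw [sum_deg_eq _ (X ^ g - 1 : K[X]) hmon (X_pow_sub_one_separable_iff.2 hgK).squarefree ?_]
  · simpa using natDegree_X_pow_sub_C (n := g) (r := (1 : K))
  · intro P
    rw [Finset.mem_filter, hS]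
    constructor
    · rintro ⟨⟨a, b, c⟩, e⟩
      exact ⟨a, b, (irr_dvd_iff n d hn P b).2 ⟨c, e⟩⟩
    · rintro ⟨a, b, c⟩
      have := (irr_dvd_iff n d hn P b).1 c
      exact ⟨⟨a, b, this.1⟩, this.2⟩

lemma sum_deg_total (S : Finset K[X]) (n : ℕ) (hn : 0 < n)
    (hS : ∀ P, P ∈ S ↔ P.Monic ∧ Irreducible P ∧ P ∣ X ^ n - 1) :
    ∑ P ∈ S, P.natDegree ≤ n / n.gcd (Fintype.card K ^ n) := by
  obtain ⟨p, hp⟩ := CharP.exists K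
  obtain ⟨k, hpp, hk⟩ := FiniteField.card K p
  have : Fact p.Prime := ⟨hpp⟩
  set g := n.gcd (Fintype.card K ^ n) with hg
  have hgd : g ∣ p ^ ((k : ℕ) * n) := by
    rw [pow_mul, ← hk]; exact Nat.gcd_dvd_right _ _
  obtain ⟨a, -, ha⟩ := (Nat.dvd_prime_pow hpp).1 hgd
  obtain ⟨m, hm⟩ := Nat.gcd_dvd_left n (Fintype.card K ^ n)
  rw [← hg] at hm
  have hg0 : 0 < g := Nat.gcd_pos_of_pos_left _ hn
  have hm0 : 0 < m := Nat.pos_of_ne_zero (by rintro rfl; omega)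
  have hnm : n / g = m := by rw [hm]; exact Nat.mul_div_cancel_left _ hg0
  have hpow : (X ^ n - 1 : K[X]) = (X ^ m - 1) ^ p ^ a := by
    rw [sub_pow_char_pow, one_pow, ← pow_mul, ← ha, mul_comm m, ← hm]
  rw [hnm]
  refine (sum_deg_le S (X ^ m - 1) (monic_X_pow_sub_C (1 : K) hm0.ne').ne_zero ?_).trans ?_
  · intro P hP
    obtain ⟨h1, h2, h3⟩ := (hS P).1 hP
    rw [hpow] at h3
    exact ⟨h1, h2, h2.prime.dvd_of_dvd_pow h3⟩
  · exact (natDegree_X_pow_sub_C (n := m) (r := (1 : K))).le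


lemma exists_polyFin (n : ℕ) (hn : 0 < n) :
    ∃ S : Finset K[X], ∀ P, P ∈ S ↔ P.Monic ∧ Irreducible P ∧ P ∣ X ^ n - 1 := by
  classical
  have h0 : (X ^ n - 1 : K[X]) ≠ 0 := (monic_X_pow_sub_C (1 : K) hn.ne').ne_zero
  refine ⟨(UniqueFactorizationMonoid.normalizedFactors (X ^ n - 1 : K[X])).toFinset, fun P => ?_⟩
  rw [Multiset.mem_toFinset, Polynomial.mem_normalizedFactors_iff h0]
  tauto

/-- The number of factors of low degree. -/
theorem poly_data (n : ℕ) (hn : 0 < n) (S : Finset K[X])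
    (hS : ∀ P, P ∈ S ↔ P.Monic ∧ Irreducible P ∧ P ∣ X ^ n - 1) :
    (S.filter (fun P => P.natDegree = 1)).card = n.gcd (Fintype.card K - 1) ∧
    (S.filter (fun P => P.natDegree = 1)).card + 2 * (S.filter (fun P => P.natDegree = 2)).card =
      n.gcd (Fintype.card K ^ 2 - 1) ∧
    (S.filter (fun P => P.natDegree = 1)).card + 3 * (S.filter (fun P => P.natDegree = 3)).card =
      n.gcd (Fintype.card K ^ 3 - 1) ∧
    (S.filter (fun P => P.natDegree = 1)).card + 2 * (S.filter (fun P => P.natDegree = 2)).card +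
      3 * (S.filter (fun P => P.natDegree = 3)).card +
      4 * (S.filter (fun P => 4 ≤ P.natDegree)).card ≤ n / n.gcd (Fintype.card K ^ n) := by
  have hpos : ∀ P ∈ S, 0 < P.natDegree := fun P hP => ((hS P).1 hP).2.1.natDegree_pos
  have e1 := sum_deg_dvd S n 1 hn (by norm_num) hS
  have e2 := sum_deg_dvd S n 2 hn (by norm_num) hS
  have e3 := sum_deg_dvd S n 3 hn (by norm_num) hS
  have e4 := sum_deg_total S n hn hS
  rw [Finset.sum_filter] at e1 e2 e3
  simp only [Finset.card_filter, Finset.mul_sum, ← Finset.sum_add_distrib]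
  rw [← e2, ← e3]
  rw [pow_one] at e1
  rw [← e1]
  refine ⟨Finset.sum_congr rfl fun P hP => ?_, Finset.sum_congr rfl fun P hP => ?_,
    Finset.sum_congr rfl fun P hP => ?_, le_trans (Finset.sum_le_sum fun P hP => ?_) e4⟩
  all_goals
    have := hpos P hP
    generalize P.natDegree = d at *
  · by_cases h : d = 1
    · subst h; simp
    · have : ¬ d ∣ 1 := by rwa [Nat.dvd_one]
      simp [h]
  · rcases Nat.lt_or_ge 2 d with h | h
    · have h' : ¬ d ∣ 2 := fun h' => absurd (Nat.le_of_dvd (by norm_num) h') (by omega)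
      rw [if_neg h', if_neg (by omega), if_neg (by omega), mul_zero, add_zero]
    · interval_cases d <;> simp
  · rcases Nat.lt_or_ge 3 d with h | h
    · have h' : ¬ d ∣ 3 := fun h' => absurd (Nat.le_of_dvd (by norm_num) h') (by omega)
      rw [if_neg h', if_neg (by omega), if_neg (by omega), mul_zero, add_zero]
    · interval_cases d <;> simp
  · split_ifs <;> omega

end

lemma M_div_le (M a : ℕ) (ha : 0 < a) : (M : ℝ) * (1 / (a : ℝ)) ≤ ((M / a + 1 : ℕ) : ℝ) := by
  have ha' : (0 : ℝ) < a := by exact_mod_cast ha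
  rw [mul_one_div, div_le_iff₀ ha']
  have : M ≤ (M / a + 1) * a := by
    have := Nat.div_add_mod M a
    have := Nat.mod_lt M ha
    nlinarith
  exact_mod_cast this

/-- Splitting of the polynomial factors by the degree. -/
theorem polySplit_of (K : Type) [Field K] [Fintype K] (n M d0 N1 N2 N3 N4 : ℕ) (hn : 0 < n)
    (h1 : N1 = n.gcd (Fintype.card K - 1)) (h2 : N2 = (n.gcd (Fintype.card K ^ 2 - 1) - N1) / 2)
    (h3 : N3 = (n.gcd (Fintype.card K ^ 3 - 1) - N1) / 3)
    (h4 : N4 = (n / n.gcd (Fintype.card K ^ n) - (N1 + 2 * N2 + 3 * N3)) / 4) :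
    PolySplit K n M
      ((if 1 ≤ d0 then N1 else 0) + (if 2 ≤ d0 then N2 else 0) + (if 3 ≤ d0 then N3 else 0)
        + (if 4 ≤ d0 then N4 else 0))
      ((if 1 ≤ d0 then 0 else N1) + (if 2 ≤ d0 then 0 else N2) + (if 3 ≤ d0 then 0 else N3)
        + (if 4 ≤ d0 then 0 else N4))
      ((if 1 ≤ d0 then 0 else N1 * (M / Fintype.card K + 1))
        + (if 2 ≤ d0 then 0 else N2 * (M / Fintype.card K ^ 2 + 1))
        + (if 3 ≤ d0 then 0 else N3 * (M / Fintype.card K ^ 3 + 1))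
        + (if 4 ≤ d0 then 0 else N4 * (M / Fintype.card K ^ 4 + 1))) := by
  classical
  obtain ⟨S, hS⟩ := exists_polyFin (K := K) n hn
  obtain ⟨e1, e2, e3, e4⟩ := poly_data n hn S hS
  have hq : 1 ≤ Fintype.card K := Fintype.card_pos
  have hpos : ∀ P ∈ S, 0 < P.natDegree := fun P hP => ((hS P).1 hP).2.1.natDegree_pos
  have f1 : (S.filter (fun P => P.natDegree = 1)).card ≤ N1 := by omega
  have f2 : (S.filter (fun P => P.natDegree = 2)).card ≤ N2 := by omega
  have f3 : (S.filter (fun P => P.natDegree = 3)).card ≤ N3 := by omega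
  have f4 : (S.filter (fun P => 4 ≤ P.natDegree)).card ≤ N4 := by omega
  have key : ∀ w1 w2 w3 w4 : ℕ, ∑ P ∈ S, ((if P.natDegree = 1 then w1 else 0) +
      (if P.natDegree = 2 then w2 else 0) + (if P.natDegree = 3 then w3 else 0) +
      (if 4 ≤ P.natDegree then w4 else 0)) ≤ N1 * w1 + N2 * w2 + N3 * w3 + N4 * w4 := by
    intro w1 w2 w3 w4
    simp only [Finset.sum_add_distrib, ← Finset.sum_filter, Finset.sum_const, smul_eq_mul]
    gcongr
  refine ⟨S.filter (fun P => min P.natDegree 4 ≤ d0), S.filter (fun P => ¬ min P.natDegree 4 ≤ d0),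
    Finset.disjoint_filter_filter_not _ _ _, fun P => ?_, ?_, ?_, ?_⟩
  · rw [← hS P]
    simp only [Finset.mem_filter]
    tauto
  · refine le_trans ?_ (le_trans (key (if 1 ≤ d0 then 1 else 0) (if 2 ≤ d0 then 1 else 0)
      (if 3 ≤ d0 then 1 else 0) (if 4 ≤ d0 then 1 else 0)) ?_)
    · rw [Finset.card_filter]
      refine Finset.sum_le_sum fun P hP => ?_
      have := hpos P hP
      split_ifs <;> omega
    · simp only [mul_ite, mul_one, mul_zero]; rfl
  · refine le_trans ?_ (le_trans (key (if 1 ≤ d0 then 0 else 1) (if 2 ≤ d0 then 0 else 1)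
      (if 3 ≤ d0 then 0 else 1) (if 4 ≤ d0 then 0 else 1)) ?_)
    · rw [Finset.card_filter]
      refine Finset.sum_le_sum fun P hP => ?_
      have := hpos P hP
      split_ifs <;> omega
    · simp only [mul_ite, mul_one, mul_zero]; rfl
  · have hk := key (if 1 ≤ d0 then 0 else (M / Fintype.card K + 1))
      (if 2 ≤ d0 then 0 else (M / Fintype.card K ^ 2 + 1))
      (if 3 ≤ d0 then 0 else (M / Fintype.card K ^ 3 + 1))
      (if 4 ≤ d0 then 0 else (M / Fintype.card K ^ 4 + 1))
    simp only [mul_ite, mul_zero] at hk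
    refine le_trans ?_ (Nat.cast_le.2 hk)
    rw [Finset.mul_sum, Nat.cast_sum, Finset.sum_filter]
    refine Finset.sum_le_sum fun P hP => ?_
    have hP0 := hpos P hP
    generalize P.natDegree = d at *
    have hb : (M : ℝ) * (1 / (Fintype.card K : ℝ) ^ d) ≤ ((M / Fintype.card K ^ d + 1 : ℕ) : ℝ) := by
      have := M_div_le M (Fintype.card K ^ d) (Nat.pow_pos hq)
      rwa [Nat.cast_pow] at this
    by_cases hd : min d 4 ≤ d0
    · rw [if_neg (not_not.2 hd)]; positivity
    · rw [if_pos hd]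
      refine hb.trans (Nat.cast_le.2 ?_)
      rcases Nat.lt_or_ge d 4 with h | h
      · interval_cases d
        · have : ¬ 1 ≤ d0 := by omega
          simp [this]
        · have : ¬ 2 ≤ d0 := by omega
          simp [this]
        · have : ¬ 3 ≤ d0 := by omega
          simp [this]
      · have : ¬ 4 ≤ d0 := by omega
        rw [if_neg (by omega), if_neg (by omega), if_neg (by omega), if_pos h, if_neg this]
        have := Nat.div_le_div_left (a := M) (Nat.pow_le_pow_right hq h) (Nat.pow_pos (n := 4) hq)
        omega

/-- Splitting of the prime factors by trial division by the primes in `ps`. -/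
theorem primeSplit_of (m M u e B : ℕ) (ps ks : List ℕ) (c : ℕ) (hm : 0 < m) (hB : 0 < B)
    (hps : ps.Nodup) (hpr : ∀ p ∈ ps, p.Prime) (hcomp : ∀ p, p.Prime → p < B → p ∈ ps)
    (hks : ks = ps.filter (fun p => m % p == 0)) (k : ℕ)
    (hc : c = m / m.gcd (ks.prod ^ k)) (hce : c < B ^ (e + 1)) :
    PrimeSplit m M u (ks.length - u + e)
      (((ks.drop u).map (fun p => M / p + 1)).sum + e * (M / B + 1)) := by
  classical
  have hnd : ks.Nodup := hks ▸ hps.filter _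
  set U := m.primeFactors.filter (· ∉ ks.toFinset) with hU
  have hUB : ∀ p ∈ U, B ≤ p := by
    intro p hp
    have hp' := Finset.mem_filter.1 hp
    by_contra hlt
    apply hp'.2
    rw [List.mem_toFinset, hks, List.mem_filter]
    refine ⟨hcomp p (Nat.prime_of_mem_primeFactors hp'.1) (by omega), ?_⟩
    simpa using Nat.mod_eq_zero_of_dvd (Nat.dvd_of_mem_primeFactors hp'.1)
  have hg0 : 0 < m.gcd (ks.prod ^ k) := Nat.gcd_pos_of_pos_left _ hm
  have hmc : m = m.gcd (ks.prod ^ k) * c := by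
    rw [hc, Nat.mul_div_cancel' (Nat.gcd_dvd_left _ _)]
  have hc0 : 0 < c := Nat.pos_of_ne_zero (by rintro h; rw [h] at hmc; omega)
  have hksp : ∀ p ∈ ks, p ∣ m := by
    intro p hp
    rw [hks, List.mem_filter] at hp
    exact Nat.dvd_of_mod_eq_zero (by simpa using hp.2)
  have hUc : ∀ p ∈ U, p ∣ c := by
    intro p hp
    have hp' := Finset.mem_filter.1 hp
    have hpp := Nat.prime_of_mem_primeFactors hp'.1
    have hd := Nat.dvd_of_mem_primeFactors hp'.1
    rw [hmc] at hd
    rcases hpp.dvd_mul.1 hd with h | h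
    · exfalso
      have h2 : p ∣ ks.prod := hpp.dvd_of_dvd_pow (h.trans (Nat.gcd_dvd_right _ _))
      obtain ⟨a, ha, hpa⟩ := (Prime.dvd_prod_iff hpp.prime).1 h2
      have ha' : a.Prime := hpr a (by rw [hks] at ha; exact (List.mem_filter.1 ha).1)
      have : p = a := (Nat.prime_dvd_prime_iff_eq hpp ha').1 hpa
      exact hp'.2 (List.mem_toFinset.2 (this ▸ ha))
    · exact h
  have hUcard : U.card ≤ e := by
    have h1 : ∏ p ∈ U, p ∣ c := by
      refine Finset.prod_primes_dvd c (fun p hp => ?_) hUc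
      exact (Nat.prime_of_mem_primeFactors (Finset.mem_filter.1 hp).1).prime
    have h2 : B ^ U.card ≤ ∏ p ∈ U, p := Finset.pow_card_le_prod _ _ _ hUB
    have h3 : B ^ U.card < B ^ (e + 1) := lt_of_le_of_lt (h2.trans (Nat.le_of_dvd hc0 h1)) hce
    by_contra hcon
    exact absurd (Nat.pow_le_pow_right hB (by omega : e + 1 ≤ U.card)) (by omega)
  have hsub : m.primeFactors.filter (· ∉ (ks.take u).toFinset) ⊆ (ks.drop u).toFinset ∪ U := by
    intro p hp
    have hp' := Finset.mem_filter.1 hp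
    rw [Finset.mem_union]
    by_cases hk : p ∈ ks
    · left
      rw [← List.take_append_drop u ks, List.mem_append] at hk
      rcases hk with h | h
      · exact absurd (List.mem_toFinset.2 h) hp'.2
      · exact List.mem_toFinset.2 h
    · right
      exact Finset.mem_filter.2 ⟨hp'.1, by rwa [List.mem_toFinset]⟩
  refine ⟨(ks.take u).toFinset, ?_, ?_, ?_⟩
  · refine (Finset.card_le_card (t := (ks.take u).toFinset) fun p hp => (Finset.mem_filter.1 hp).2).trans ?_
    exact (List.toFinset_card_le _).trans (by simp)
  · refine (Finset.card_le_card hsub).trans ((Finset.card_union_le _ _).trans ?_)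
    have := List.toFinset_card_le (ks.drop u)
    rw [List.length_drop] at this
    omega
  · rw [Finset.mul_sum]
    refine (Finset.sum_le_sum_of_subset_of_nonneg hsub fun _ _ _ => by positivity).trans ?_
    have hdisj : Disjoint (ks.drop u).toFinset U := by
      rw [Finset.disjoint_left]
      intro p hp hpU
      exact (Finset.mem_filter.1 hpU).2 (List.mem_toFinset.2 (List.mem_of_mem_drop (List.mem_toFinset.1 hp)))
    have hks0 : ∀ p ∈ ks, 0 < p := fun p hp => (hpr p (by rw [hks] at hp; exact (List.mem_filter.1 hp).1)).pos
    rw [Finset.sum_union hdisj, Nat.cast_add]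
    refine add_le_add ?_ ?_
    · rw [← List.sum_toFinset _ (hnd.sublist (List.drop_sublist u ks)), Nat.cast_sum]
      refine Finset.sum_le_sum fun p hp => ?_
      exact M_div_le M p (hks0 p (List.mem_of_mem_drop (List.mem_toFinset.1 hp)))
    · have h1 : ∀ p ∈ U, (M : ℝ) * (1 / (p : ℝ)) ≤ ((M / B + 1 : ℕ) : ℝ) := by
        intro p hp
        refine le_trans ?_ (M_div_le M B hB)
        have hB' : (0 : ℝ) < B := by exact_mod_cast hB
        have : (B : ℝ) ≤ p := by exact_mod_cast hUB p hp
        gcongr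
      refine (Finset.sum_le_card_nsmul _ _ _ h1).trans ?_
      rw [nsmul_eq_mul, Nat.cast_mul]
      gcongr

/-- The primes below 100. -/
def primes100 : List ℕ :=
  [2, 3, 5, 7, 11, 13, 17, 19, 23, 29, 31, 37, 41, 43, 47, 53, 59, 61, 67, 71, 73, 79, 83,
  89, 97]

/-- The primes below 400. -/
def primes400 : List ℕ :=
  [2, 3, 5, 7, 11, 13, 17, 19, 23, 29, 31, 37, 41, 43, 47, 53, 59, 61, 67, 71, 73, 79, 83,
  89, 97, 101, 103, 107, 109, 113, 127, 131, 137, 139, 149, 151, 157, 163, 167, 173, 179,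
  181, 191, 193, 197, 199, 211, 223, 227, 229, 233, 239, 241, 251, 257, 263, 269, 271, 277,
  281, 283, 293, 307, 311, 313, 317, 331, 337, 347, 349, 353, 359, 367, 373, 379, 383, 389,
  397]

lemma primes100_prime : ∀ p ∈ primes100, p.Prime := by
  intro p hp
  simp only [primes100, List.mem_cons, List.not_mem_nil, or_false] at hp
  rcases hp with h | h | h | h | h | h | h | h | h | h | h | h | h | h | h | h | h | h | h | h | h |
    h | h | h | h <;> subst h <;> norm_num

lemma sieve_list (l ds : List ℕ) (B : ℕ)
    (h : (List.range B).all (fun p => l.contains p || Nat.blt p 2 ||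
      ds.any (fun d => Nat.blt 1 d && Nat.blt d p && (p % d == 0))) = true) :
    ∀ p, p.Prime → p < B → p ∈ l := by
  intro p hp hlt
  have := List.all_eq_true.1 h p (List.mem_range.2 hlt)
  simp only [Bool.or_eq_true, List.contains_iff_mem, List.any_eq_true, Bool.and_eq_true,
    beq_iff_eq, Nat.blt_eq] at this
  rcases this with (h | h) | ⟨d, _, ⟨hd1, hd2⟩, hd3⟩
  · exact h
  · exact absurd hp.two_le (by omega)
  · rcases (Nat.dvd_prime hp).1 (Nat.dvd_of_mod_eq_zero hd3) with h | h <;> omega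

lemma primes100_complete : ∀ p, p.Prime → p < 100 → p ∈ primes100 :=
  sieve_list primes100 [2, 3, 5, 7] 100 (by decide +kernel)

lemma primes400_complete : ∀ p, p.Prime → p < 400 → p ∈ primes400 :=
  sieve_list primes400 [2, 3, 5, 7, 11, 13, 17, 19] 400 (by decide +kernel)

lemma prime_of_no_div (p : ℕ) (h2 : 2 ≤ p) (h : p < 400)
    (hd : [2, 3, 5, 7, 11, 13, 17, 19].all (fun d => !(p % d == 0) || Nat.ble p d) = true) :
    p.Prime := by
  by_contra hp
  have hm := Nat.minFac_prime (n := p) (by omega)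
  have hsq : p.minFac ^ 2 ≤ p := Nat.minFac_sq_le_self (by omega) hp
  have hlt : p.minFac < 20 := by nlinarith
  have hmem : p.minFac ∈ [2, 3, 5, 7, 11, 13, 17, 19] := by
    have := sieve_list [2, 3, 5, 7, 11, 13, 17, 19] [2, 3] 20 (by decide +kernel) _ hm hlt
    exact this
  have := List.all_eq_true.1 hd _ hmem
  simp only [Bool.or_eq_true, Bool.not_eq_true', beq_eq_false_iff_ne, Nat.ble_eq] at this
  rcases this with h | h
  · exact h (Nat.mod_eq_zero_of_dvd (Nat.minFac_dvd p))
  · have := hm.two_le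
    have h3 : 2 * p.minFac ≤ p.minFac * p.minFac := Nat.mul_le_mul_right _ this
    rw [sq] at hsq
    omega

lemma primes400_prime : ∀ p ∈ primes400, p.Prime := by
  intro p hp
  have h : primes400.all (fun p => Nat.ble 2 p && Nat.blt p 400 &&
      [2, 3, 5, 7, 11, 13, 17, 19].all (fun d => !(p % d == 0) || Nat.ble p d)) = true := by
    decide +kernel
  have := List.all_eq_true.1 h p hp
  simp only [Bool.and_eq_true, Nat.ble_eq, Nat.blt_eq] at this
  exact prime_of_no_div p this.1.1 this.1.2 this.2

/-- The first `e` with `c < B ^ (e + 1)`, searched with the given fuel. -/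
def eFind (B c : ℕ) : ℕ → ℕ → ℕ
  | 0, e => e
  | k + 1, e => bif Nat.blt c (B ^ (e + 1)) then e else eFind B c k (e + 1)

/-- The numerical part of the sieve test. -/
def numTest (M Q S t c : ℕ) : Bool :=
  Nat.blt S M && Nat.ble ((6 * 2 ^ c * ((t - 1) * M + 2 * (M - S))) ^ 2) ((M - S) ^ 2 * Q)

/-- The sieve test, with trial division already done. -/
def chkA (q Q M N1 N2 N3 N4 B e u1 u2 d0 : ℕ) (ks : List ℕ) : Bool :=
  numTest M Q
    ((((ks.drop u1).map (fun p => M / p + 1)).sum + e * (M / B + 1)) +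
      (((ks.drop u2).map (fun p => M / p + 1)).sum + e * (M / B + 1)) +
      ((if 1 ≤ d0 then 0 else N1 * (M / q + 1)) + (if 2 ≤ d0 then 0 else N2 * (M / q ^ 2 + 1))
        + (if 3 ≤ d0 then 0 else N3 * (M / q ^ 3 + 1))
        + (if 4 ≤ d0 then 0 else N4 * (M / q ^ 4 + 1))))
    ((ks.length - u1 + e) + (ks.length - u2 + e) +
      ((if 1 ≤ d0 then 0 else N1) + (if 2 ≤ d0 then 0 else N2) + (if 3 ≤ d0 then 0 else N3)
        + (if 4 ≤ d0 then 0 else N4)))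
    (u1 + u2 +
      ((if 1 ≤ d0 then N1 else 0) + (if 2 ≤ d0 then N2 else 0) + (if 3 ≤ d0 then N3 else 0)
        + (if 4 ≤ d0 then N4 else 0)))

/-- The sieve test with given list of primes `ps` (those below `B`). -/
def chkB (q n B : ℕ) (ps : List ℕ) (u1 u2 d0 : ℕ) : Bool :=
  let Q := q ^ n
  let ks := ps.filter (fun p => (Q - 1) % p == 0)
  let c := (Q - 1) / (Q - 1).gcd (ks.prod ^ 104)
  let e := eFind B c 20 0
  let N1 := n.gcd (q - 1)
  let N2 := (n.gcd (q ^ 2 - 1) - N1) / 2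
  let N3 := (n.gcd (q ^ 3 - 1) - N1) / 3
  let N4 := (n / n.gcd (q ^ n) - (N1 + 2 * N2 + 3 * N3)) / 4
  Nat.blt c (B ^ (e + 1)) && chkA q Q (2 ^ 24) N1 N2 N3 N4 B e u1 u2 d0 ks

theorem chkB_sound (q n B : ℕ) (ps : List ℕ) (u1 u2 d0 : ℕ) (hq : 2 ≤ q) (hn : 0 < n) (hB : 0 < B)
    (hps : ps.Nodup) (hpr : ∀ p ∈ ps, p.Prime) (hcomp : ∀ p, p.Prime → p < B → p ∈ ps)
    (h : chkB q n B ps u1 u2 d0 = true) : memB 3 2 q n := by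
  intro K L _ _ _ _ _ hK hL f hf
  simp only [chkB, chkA, numTest, Bool.and_eq_true, Nat.blt_eq, Nat.ble_eq] at h
  obtain ⟨hc, hS, hnum⟩ := h
  have hm : 0 < Fintype.card L - 1 := by
    rw [hL]
    have : q ^ 1 ≤ q ^ n := Nat.pow_le_pow_right (by omega) hn
    rw [pow_one] at this
    omega
  have hmL : Fintype.card L - 1 = q ^ n - 1 := by rw [hL]
  have P1 := primeSplit_of (Fintype.card L - 1) (2 ^ 24) u1 _ B ps _ _ hm hB hps hpr hcomp rfl 104
    rfl (by rw [hmL]; exact hc)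
  have P2 := primeSplit_of (Fintype.card L - 1) (2 ^ 24) u2 _ B ps _ _ hm hB hps hpr hcomp rfl 104
    rfl (by rw [hmL]; exact hc)
  have P3 := polySplit_of K n (2 ^ 24) d0 _ _ _ _ hn rfl rfl rfl rfl
  rw [hmL] at P1 P2
  rw [hK] at P3
  refine crit n hn (by rw [hL, hK]) f hf (2 ^ 24) _ _ _ _ _ _ _ _ _ _ (by rw [hmL]; exact P1)
    (by rw [hmL]; exact P2) P3 (Nat.sub_pos_of_lt hS) ?_ ?_
  · exact (Nat.add_sub_of_le hS.le).le
  · rw [hL]; exact hnum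

/-- The list of possible exceptions. -/
abbrev Exc (q n : ℕ) : Prop :=
  (n = 3 ∧ ((q ≤ 37 ∧ q ≠ 8) ∨
            q ∈ ({43, 49, 61, 67, 71, 79, 81, 121, 151, 211, 331} : Finset ℕ))) ∨
         (n = 4 ∧ (q ≤ 37 ∨ q ∈ ({41, 43, 47, 83} : Finset ℕ))) ∨
         (n = 5 ∧ q ∈ ({3, 4, 5, 7, 9, 11, 16} : Finset ℕ)) ∨
         (n = 6 ∧ q ∈ ({2, 3, 4, 5, 7, 9, 11, 13, 19} : Finset ℕ)) ∨
         (n = 7 ∧ q ∈ ({3, 4, 8} : Finset ℕ)) ∨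
         (n = 8 ∧ q ∈ ({2, 3, 4, 5, 7, 9} : Finset ℕ)) ∨
         (q = 2 ∧ n ∈ ({9, 10, 12, 14, 15, 16, 18, 20, 24} : Finset ℕ)) ∨
         (q = 3 ∧ n ∈ ({9, 10, 12, 16} : Finset ℕ)) ∨
         (q = 4 ∧ n ∈ ({9, 10, 12} : Finset ℕ)) ∨
         ((q, n) ∈ ({(5, 12), (7, 12)} : Finset (ℕ × ℕ)))

/-- The four pairs treated by hand. -/
abbrev Special (q n : ℕ) : Prop :=
  (q = 2 ∧ n = 5) ∨ (q = 2 ∧ n = 7) ∨ (q = 2 ∧ n = 11) ∨ (q = 8 ∧ n = 3)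

/-- A necessary condition for being a prime power, if `q < 2 ^ 14`. -/
def ppTest (q : ℕ) : Bool :=
  primes100.all (fun d => !(q % d == 0) || (d ^ 14 % q == 0))

lemma ppTest_of (q : ℕ) (h : IsPrimePow q) (hq : q < 2 ^ 14) : ppTest q = true := by
  obtain ⟨p, k, hp, hk, rfl⟩ := h
  have hp := hp.nat_prime
  rw [ppTest, List.all_eq_true]
  intro d hd
  simp only [Bool.or_eq_true, Bool.not_eq_true', beq_eq_false_iff_ne, beq_iff_eq]
  by_cases h : p ^ k % d = 0
  · right
    have hdp := primes100_prime d hd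
    have : d ∣ p := hdp.dvd_of_dvd_pow (Nat.dvd_of_mod_eq_zero h)
    have : d = p := (Nat.prime_dvd_prime_iff_eq hdp hp).1 this
    subst this
    refine Nat.mod_eq_zero_of_dvd (pow_dvd_pow _ ?_)
    have h2 : 2 ^ k ≤ d ^ k := Nat.pow_le_pow_left hp.two_le k
    have : 2 ^ k < 2 ^ 14 := by omega
    exact ((Nat.pow_lt_pow_iff_right (by norm_num)).1 this).le
  · left; exact h

/-- The combined sieve test. -/
def chk (q n : ℕ) : Bool :=
  chkB q n 400 primes400 2 3 0 || chkB q n 400 primes400 3 3 4 || chkB q n 400 primes400 1 1 2 ||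
  chkB q n 400 primes400 2 2 0 || chkB q n 400 primes400 1 1 0 || chkB q n 100 primes100 0 0 2 ||
  chkB q n 400 primes400 3 4 0 || chkB q n 100 primes100 2 2 1 || chkB q n 400 primes400 5 5 0

lemma chk_sound (q n : ℕ) (hq : 2 ≤ q) (hn : 0 < n) (h : chk q n = true) : memB 3 2 q n := by
  have h1 := fun u1 u2 d0 => chkB_sound q n 100 primes100 u1 u2 d0 hq hn (by norm_num)
    (by decide +kernel) primes100_prime primes100_complete
  have h4 := fun u1 u2 d0 => chkB_sound q n 400 primes400 u1 u2 d0 hq hn (by norm_num)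
    (by decide +kernel) primes400_prime primes400_complete
  simp only [chk, Bool.or_eq_true] at h
  rcases h with (((((((h | h) | h) | h) | h) | h) | h) | h) | h
  · exact h4 _ _ _ h
  · exact h4 _ _ _ h
  · exact h4 _ _ _ h
  · exact h4 _ _ _ h
  · exact h4 _ _ _ h
  · exact h1 _ _ _ h
  · exact h4 _ _ _ h
  · exact h1 _ _ _ h
  · exact h4 _ _ _ h

/-- The test for one pair. -/
def pairTest (q n : ℕ) : Bool :=
  !ppTest q || !(Nat.blt (q ^ n) (2 ^ 40) || (Nat.blt q (16 * n) && Nat.blt (q ^ n) (2 ^ 104))) ||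
    chk q n || decide (Exc q n) || decide (Special q n)

/-- The test for an interval of values of `q`. -/
def rangeTest (n lo len : ℕ) : Bool := (List.range' lo len).all (fun q => pairTest q n)

lemma rangeTest_sound (n lo len q : ℕ) (h : rangeTest n lo len = true) (h1 : lo ≤ q)
    (h2 : q < lo + len) : pairTest q n = true :=
  List.all_eq_true.1 h q (List.mem_range'_1.2 ⟨h1, h2⟩)

lemma test_three : (List.range 11).all (fun i => rangeTest 3 (2 + 1000 * i) 1000) = true := by
  decide +kernel

lemma test_four : rangeTest 4 2 1022 = true := by decide +kernel

lemma test_five : rangeTest 5 2 254 = true := by decide +kernel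

lemma test_mid : (List.range' 6 13).all (fun n => rangeTest n 2 286) = true := by decide +kernel

lemma test_high : (List.range' 19 85).all (fun n => rangeTest n 2 46) = true := by decide +kernel

theorem pair_ok (q n : ℕ) (hq : 2 ≤ q) (hn : 3 ≤ n)
    (hreg : q ^ n < 2 ^ 40 ∨ (q < 16 * n ∧ q ^ n < 2 ^ 104)) :
    pairTest q n = true ∧ q < 2 ^ 14 := by
  have key : ∀ a, a ≤ q → a ^ n ≤ q ^ n := fun a ha => Nat.pow_le_pow_left ha n
  have h104 : q ^ n < 2 ^ 104 := by
    rcases hreg with h | h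
    · exact h.trans (by norm_num)
    · exact h.2
  have hn104 : n < 104 := by
    have := (Nat.pow_le_pow_left hq n).trans_lt h104
    exact (Nat.pow_lt_pow_iff_right (by norm_num)).1 this
  have mono : ∀ a m, a ≤ q → 1 ≤ a → m ≤ n → a ^ m ≤ q ^ n := fun a m ha h1 hm =>
    (Nat.pow_le_pow_right h1 hm).trans (key a ha)
  rcases Nat.lt_or_ge n 6 with h6 | h6
  · have hq16 : q ^ n < 2 ^ 40 ∨ q < 80 := by omega
    interval_cases n
    · have hb : q < 10400 := by
        by_contra hc
        have := mono 10400 3 (by omega) (by norm_num) le_rfl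
        omega
      have h := List.all_eq_true.1 test_three ((q - 2) / 1000) (List.mem_range.2 (by omega))
      exact ⟨rangeTest_sound _ _ _ _ h (by omega) (by omega), by omega⟩
    · have hb : q < 1024 := by
        by_contra hc
        have := mono 1024 4 (by omega) (by norm_num) le_rfl
        omega
      exact ⟨rangeTest_sound _ _ _ _ test_four (by omega) (by omega), by omega⟩
    · have hb : q < 256 := by
        by_contra hc
        have := mono 256 5 (by omega) (by norm_num) le_rfl
        omega
      exact ⟨rangeTest_sound _ _ _ _ test_five (by omega) (by omega), by omega⟩
  · rcases Nat.lt_or_ge n 19 with h19 | h19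
    · have hb : q < 288 := by
        rcases hreg with h | h
        · by_contra hc
          have := mono 288 6 (by omega) (by norm_num) h6
          omega
        · omega
      have h := List.all_eq_true.1 test_mid n (List.mem_range'_1.2 ⟨h6, by omega⟩)
      exact ⟨rangeTest_sound _ _ _ _ h (by omega) (by omega), by omega⟩
    · have hb : q < 48 := by
        by_contra hc
        have := mono 48 19 (by omega) (by norm_num) h19
        omega
      have h := List.all_eq_true.1 test_high n (List.mem_range'_1.2 ⟨h19, by omega⟩)
      exact ⟨rangeTest_sound _ _ _ _ h (by omega) (by omega), by omega⟩

theorem finite_ok (q n : ℕ) (hpp : IsPrimePow q) (hn : 3 ≤ n) (hexc : ¬ Exc q n)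
    (hsp : ¬ Special q n) (hreg : q ^ n < 2 ^ 40 ∨ (q < 16 * n ∧ q ^ n < 2 ^ 104)) :
    memB 3 2 q n := by
  have hq : 2 ≤ q := hpp.two_le
  obtain ⟨h, hq14⟩ := pair_ok q n hq hn hreg
  rw [pairTest, decide_eq_false hexc, decide_eq_false hsp, ppTest_of q hpp hq14] at h
  have hr : (Nat.blt (q ^ n) (2 ^ 40) || (Nat.blt q (16 * n) && Nat.blt (q ^ n) (2 ^ 104))) = true := by
    simp only [Bool.or_eq_true, Bool.and_eq_true, Nat.blt_eq]
    exact hreg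
  rw [hr] at h
  exact chk_sound q n hq (by omega) (by simpa using h)

/-- No prime up to 31 divides `x` properly. -/
def roughTest (x : ℕ) : Bool :=
  [2, 3, 5, 7, 11, 13, 17, 19, 23, 29, 31].all (fun d => !(x % d == 0) || Nat.ble x d)

lemma roughTest_prime (p : ℕ) (hp : p.Prime) : roughTest p = true := by
  rw [roughTest, List.all_eq_true]
  intro d hd
  simp only [Bool.or_eq_true, Bool.not_eq_true', beq_eq_false_iff_ne, Nat.ble_eq]
  by_cases h : p % d = 0
  · right
    rcases (Nat.dvd_prime hp).1 (Nat.dvd_of_mod_eq_zero h) with h1 | h1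
    · subst h1; simp at hd
    · omega
  · left; exact h

/-- The first rough number from `y` on, searched with the given fuel. -/
def nextRough : ℕ → ℕ → ℕ
  | 0, y => y
  | k + 1, y => bif roughTest y then y else nextRough k (y + 1)

lemma nextRough_le (p : ℕ) (hp : p.Prime) : ∀ k y, y ≤ p → nextRough k y ≤ p := by
  intro k
  induction k with
  | zero => intro y hy; exact hy
  | succ k ih =>
    intro y hy
    rw [nextRough]
    by_cases h : roughTest y = true
    · rw [h]; exact hy
    · rw [Bool.not_eq_true] at h
      rw [h]
      refine ih (y + 1) ?_
      rcases Nat.lt_or_ge y p with h1 | h1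
      · exact h1
      · have : y = p := by omega
        rw [this, roughTest_prime p hp] at h
        simp at h

lemma le_nextRough : ∀ k y, y ≤ nextRough k y := by
  intro k
  induction k with
  | zero => intro y; exact le_rfl
  | succ k ih =>
    intro y
    rw [nextRough]
    cases roughTest y
    · exact (Nat.le_succ y).trans (ih (y + 1))
    · exact le_rfl

/-- Lower bounds for the first `w` primes from `y` on. -/
def plist : ℕ → ℕ → List ℕ
  | 0, _ => []
  | w + 1, y => nextRough 40 y :: plist w (nextRough 40 y + 1)

/-- The bound for what follows `plist w y`. -/
def pafter : ℕ → ℕ → ℕ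
  | 0, y => y
  | w + 1, y => pafter w (nextRough 40 y + 1)

lemma plist_length : ∀ w y, (plist w y).length = w := by
  intro w
  induction w with
  | zero => intro y; rfl
  | succ w ih => intro y; rw [plist, List.length_cons, ih]

lemma plist_append (b : ℕ) : ∀ a y, plist (a + b) y = plist a y ++ plist b (pafter a y) := by
  intro a
  induction a with
  | zero => intro y; rw [Nat.zero_add]; rfl
  | succ a ih =>
    intro y
    rw [show a + 1 + b = (a + b) + 1 by ring, plist, plist, pafter, ih, List.cons_append]

lemma plist_prod_ge : ∀ w y, y ^ w ≤ (plist w y).prod := by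
  intro w
  induction w with
  | zero => intro y; simp [plist]
  | succ w ih =>
    intro y
    rw [plist, List.prod_cons, pow_succ']
    have h1 := le_nextRough 40 y
    exact Nat.mul_le_mul h1 ((Nat.pow_le_pow_left (by omega) w).trans (ih _))

lemma plist_pos : ∀ w y, 1 ≤ y → ∀ a ∈ plist w y, 1 ≤ a := by
  intro w
  induction w with
  | zero => intro y _ a ha; simp [plist] at ha
  | succ w ih =>
    intro y hy a ha
    have h1 := le_nextRough 40 y
    rw [plist, List.mem_cons] at ha
    rcases ha with h | h
    · omega
    · exact ih _ (by omega) a h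

lemma plist_forall : ∀ (s : List ℕ) (y : ℕ), s.Pairwise (· < ·) → (∀ p ∈ s, p.Prime) →
    (∀ p ∈ s, y ≤ p) → List.Forall₂ (· ≤ ·) (plist s.length y) s := by
  intro s
  induction s with
  | nil => intro y _ _ _; exact List.Forall₂.nil
  | cons a s ih =>
    intro y hs hp hy
    rw [List.length_cons, plist]
    have ha := nextRough_le a (hp a List.mem_cons_self) 40 y (hy a List.mem_cons_self)
    rw [List.pairwise_cons] at hs
    refine List.Forall₂.cons ha (ih _ hs.2 (fun p h => hp p (List.mem_cons_of_mem _ h)) ?_)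
    intro p h
    have := hs.1 p h
    omega

lemma forall2_prod : ∀ (l s : List ℕ), List.Forall₂ (· ≤ ·) l s → l.prod ≤ s.prod := by
  intro l s h
  induction h with
  | nil => exact le_rfl
  | cons h _ ih => rw [List.prod_cons, List.prod_cons]; exact Nat.mul_le_mul h ih

lemma forall2_sum (M : ℕ) : ∀ (l s : List ℕ), List.Forall₂ (· ≤ ·) l s → (∀ a ∈ l, 1 ≤ a) →
    (M : ℝ) * (s.map (fun p : ℕ => 1 / (p : ℝ))).sum ≤ ((l.map (fun p => M / p + 1)).sum : ℕ) := by
  intro l s h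
  induction h with
  | nil => intro _; simp
  | @cons a b l s h _ ih =>
    intro hl
    rw [List.map_cons, List.map_cons, List.sum_cons, List.sum_cons, mul_add, Nat.cast_add]
    have ha := hl a List.mem_cons_self
    refine add_le_add ?_ (ih fun x hx => hl x (List.mem_cons_of_mem _ hx))
    refine (M_div_le M b (by omega)).trans (Nat.cast_le.2 ?_)
    exact Nat.add_le_add_right (Nat.div_le_div_left h ha) 1

theorem profile (m : ℕ) (hm : 0 < m) : ∃ w, (plist w 2).prod ≤ m ∧ ∀ M u,
    PrimeSplit m M u (w - u) ((((plist w 2).drop u).map (fun p => M / p + 1)).sum) := by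
  classical
  set s := m.primeFactors.sort (· ≤ ·) with hs
  have hmem : ∀ p, p ∈ s ↔ p ∈ m.primeFactors := fun p => Finset.mem_sort _
  have hnd : s.Nodup := Finset.sort_nodup _ _
  have hlt : s.Pairwise (· < ·) := by
    have := Finset.sortedLT_sort m.primeFactors
    exact this.pairwise
  have hF := plist_forall s 2 hlt
    (fun p hp => Nat.prime_of_mem_primeFactors ((hmem p).1 hp))
    (fun p hp => (Nat.prime_of_mem_primeFactors ((hmem p).1 hp)).two_le)
  refine ⟨s.length, ?_, fun M u => ?_⟩
  · refine (forall2_prod _ _ hF).trans ?_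
    have h1 : s.prod = ∏ p ∈ m.primeFactors, p := by
      have : m.primeFactors = s.toFinset := by ext p; rw [List.mem_toFinset, hmem]
      rw [this, List.prod_toFinset _ hnd, List.map_id']
    rw [h1]
    exact Nat.le_of_dvd hm (Nat.prod_primeFactors_dvd m)
  · have hfil : m.primeFactors.filter (· ∉ (s.take u).toFinset) ⊆ (s.drop u).toFinset := by
      intro p hp
      have hp' := Finset.mem_filter.1 hp
      have hk := (hmem p).2 hp'.1
      rw [← List.take_append_drop u s, List.mem_append] at hk
      rcases hk with h | h
      · exact absurd (List.mem_toFinset.2 h) hp'.2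
      · exact List.mem_toFinset.2 h
    refine ⟨(s.take u).toFinset, ?_, ?_, ?_⟩
    · refine (Finset.card_le_card (t := (s.take u).toFinset)
        fun p hp => (Finset.mem_filter.1 hp).2).trans ?_
      exact (List.toFinset_card_le _).trans (by simp)
    · refine (Finset.card_le_card hfil).trans ((List.toFinset_card_le _).trans ?_)
      rw [List.length_drop]
    · have h1 := forall2_sum M _ _ (List.forall₂_drop u hF)
        (fun a ha => plist_pos _ _ (by norm_num) a (List.mem_of_mem_drop ha))
      refine le_trans ?_ h1
      rw [← List.sum_toFinset _ (hnd.sublist (List.drop_sublist u s))]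
      refine mul_le_mul_of_nonneg_left ?_ (Nat.cast_nonneg M)
      exact Finset.sum_le_sum_of_subset_of_nonneg hfil fun _ _ _ => by positivity

theorem poly_counts (K : Type) [Field K] [Fintype K] (n : ℕ) (hn : 0 < n) :
    ∃ N1 N2 N3 N4 : ℕ, N1 ≤ Fintype.card K - 1 ∧ N1 + 2 * N2 ≤ Fintype.card K ^ 2 - 1 ∧
      N1 + 3 * N3 ≤ Fintype.card K ^ 3 - 1 ∧ N1 + 2 * N2 + 3 * N3 + 4 * N4 ≤ n ∧ 1 ≤ N1 ∧
      ∀ M, PolySplit K n M (N1 + N2 + N3 + N4) 0 0 ∧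
        PolySplit K n M 0 n (n * (M / Fintype.card K + 1)) := by
  classical
  obtain ⟨S, hS⟩ := exists_polyFin (K := K) n hn
  obtain ⟨e1, e2, e3, e4⟩ := poly_data n hn S hS
  have hq : 1 < Fintype.card K := Fintype.one_lt_card
  have hpos : ∀ P ∈ S, 0 < P.natDegree := fun P hP => ((hS P).1 hP).2.1.natDegree_pos
  have hcard : S.card = (S.filter (fun P => P.natDegree = 1)).card +
      (S.filter (fun P => P.natDegree = 2)).card + (S.filter (fun P => P.natDegree = 3)).card +
      (S.filter (fun P => 4 ≤ P.natDegree)).card := by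
    simp only [Finset.card_filter, ← Finset.sum_add_distrib]
    rw [Finset.card_eq_sum_ones]
    refine Finset.sum_congr rfl fun P hP => ?_
    have := hpos P hP
    split_ifs <;> omega
  have e4' := e4.trans (Nat.div_le_self _ _)
  have hq2 : 0 < Fintype.card K ^ 2 - 1 := Nat.sub_pos_of_lt (Nat.one_lt_pow (by norm_num) hq)
  have hq3 : 0 < Fintype.card K ^ 3 - 1 := Nat.sub_pos_of_lt (Nat.one_lt_pow (by norm_num) hq)
  have g1 := Nat.gcd_le_right n (by omega : 0 < Fintype.card K - 1)
  have g2 := Nat.gcd_le_right n hq2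
  have g3 := Nat.gcd_le_right n hq3
  have g0 := Nat.gcd_pos_of_pos_left (Fintype.card K - 1) hn
  refine ⟨_, _, _, _, by omega, by omega, by omega, e4', by omega, fun M => ⟨?_, ?_⟩⟩
  · refine ⟨S, ∅, Finset.disjoint_empty_right _, fun P => ?_, hcard.le, by simp, by simp⟩
    rw [← hS P]; simp
  · refine ⟨∅, S, Finset.disjoint_empty_left _, fun P => ?_, by simp, by omega, ?_⟩
    · rw [← hS P]; simp
    · have h1 : ∀ P ∈ S, 1 / ((Fintype.card K : ℝ) ^ P.natDegree) ≤ 1 / (Fintype.card K : ℝ) := by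
        intro P hP
        have hq' : (1 : ℝ) ≤ Fintype.card K := by exact_mod_cast hq.le
        have := pow_le_pow_right₀ hq' (hpos P hP)
        rw [Nat.succ_eq_add_one, zero_add, pow_one] at this
        exact one_div_le_one_div_of_le (by linarith) this
      have h2 := Finset.sum_le_card_nsmul _ _ _ h1
      rw [nsmul_eq_mul] at h2
      have h3 := M_div_le M (Fintype.card K) (by omega)
      have h4 : (S.card : ℝ) ≤ n := by exact_mod_cast (by omega : S.card ≤ n)
      calc (M : ℝ) * ∑ P ∈ S, 1 / ((Fintype.card K : ℝ) ^ P.natDegree)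
          ≤ M * (S.card * (1 / (Fintype.card K : ℝ))) := by gcongr
        _ = S.card * (M * (1 / (Fintype.card K : ℝ))) := by ring
        _ ≤ n * ((M / Fintype.card K + 1 : ℕ) : ℝ) := by gcongr
        _ = _ := by push_cast; ring

lemma PolySplit.mono {K : Type} [Field K] [Fintype K] {n M u r S r' S' : ℕ}
    (h : PolySplit K n M u r S) (hr : r ≤ r') (hS : S ≤ S') : PolySplit K n M u r' S' := by
  obtain ⟨J, R, h1, h2, h3, h4, h5⟩ := h
  exact ⟨J, R, h1, h2, h3, h4.trans hr, h5.trans (by exact_mod_cast hS)⟩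

lemma pow_cmp (a b A B n : ℕ) (hab : a ≤ b) (hn : 27 ≤ n) (h : A * a ^ 27 ≤ B * b ^ 27) :
    A * a ^ n ≤ B * b ^ n := by
  obtain ⟨j, rfl⟩ := Nat.exists_eq_add_of_le hn
  rw [pow_add, pow_add, ← mul_assoc, ← mul_assoc]
  exact Nat.mul_le_mul h (Nat.pow_le_pow_left hab j)

/-- The number of irreducible factors is small. -/
lemma core_bound (q n N1 N2 N3 N4 : ℕ) (hq : 2 ≤ q) (h1 : N1 ≤ q - 1) (h2 : N1 + 2 * N2 ≤ q ^ 2 - 1)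
    (h3 : N1 + 3 * N3 ≤ q ^ 3 - 1) (h4 : N1 + 2 * N2 + 3 * N3 + 4 * N4 ≤ n) (h5 : 1 ≤ N1)
    (hQ : 2 ^ 104 ≤ q ^ n) : 16 ^ (N1 + N2 + N3 + N4) ≤ 128 * q ^ n := by
  rcases Nat.lt_or_ge q 16 with hlt | hge
  · have hn : 27 ≤ n := by
      by_contra hc
      have ha : q ^ n ≤ 15 ^ n := Nat.pow_le_pow_left (by omega) n
      have hb : 15 ^ n ≤ 15 ^ 26 := Nat.pow_le_pow_right (by norm_num) (by omega)
      have : 15 ^ 26 < 2 ^ 104 := by norm_num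
      omega
    rcases Nat.lt_or_ge q 5 with h5' | h5'
    · interval_cases q
      · have hk : 4 * (N1 + N2 + N3 + N4) ≤ n + 7 := by omega
        calc 16 ^ (N1 + N2 + N3 + N4) = 2 ^ (4 * (N1 + N2 + N3 + N4)) := by rw [pow_mul]; norm_num
          _ ≤ 2 ^ (n + 7) := Nat.pow_le_pow_right (by norm_num) hk
          _ = 128 * 2 ^ n := by rw [pow_add]; ring
      · have hk : 3 * (N1 + N2 + N3 + N4) ≤ n + 7 := by omega
        refine (Nat.pow_le_pow_iff_left (n := 3) (by norm_num)).1 ?_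
        rw [← pow_mul, mul_comm _ 3]
        refine (Nat.pow_le_pow_right (by norm_num) hk).trans ?_
        have := pow_cmp 16 27 (16 ^ 7) (128 ^ 3) n (by norm_num) hn (by norm_num)
        calc 16 ^ (n + 7) = 16 ^ 7 * 16 ^ n := by rw [pow_add, mul_comm]
          _ ≤ _ := this
          _ = _ := by rw [mul_pow, ← pow_mul, mul_comm n 3, pow_mul]; norm_num
      · have hk : 3 * (N1 + N2 + N3 + N4) ≤ n + 12 := by omega
        refine (Nat.pow_le_pow_iff_left (n := 3) (by norm_num)).1 ?_
        rw [← pow_mul, mul_comm _ 3]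
        refine (Nat.pow_le_pow_right (by norm_num) hk).trans ?_
        have := pow_cmp 16 64 (16 ^ 12) (128 ^ 3) n (by norm_num) hn (by norm_num)
        calc 16 ^ (n + 12) = 16 ^ 12 * 16 ^ n := by rw [pow_add, mul_comm]
          _ ≤ _ := this
          _ = _ := by rw [mul_pow, ← pow_mul, mul_comm n 3, pow_mul]; norm_num
    · have hk : 2 * (N1 + N2 + N3 + N4) ≤ n + (q - 1) := by omega
      refine (Nat.pow_le_pow_iff_left (n := 2) (by norm_num)).1 ?_
      rw [← pow_mul, mul_comm _ 2]
      refine (Nat.pow_le_pow_right (by norm_num) hk).trans ?_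
      have : 16 ^ (q - 1) * 16 ^ n ≤ 128 ^ 2 * (q ^ 2) ^ n := by
        refine pow_cmp 16 (q ^ 2) _ _ n (by nlinarith) hn ?_
        clear hk h1 h2 h3 hQ h4
        interval_cases q <;> norm_num
      calc 16 ^ (n + (q - 1)) = 16 ^ (q - 1) * 16 ^ n := by rw [pow_add, mul_comm]
        _ ≤ _ := this
        _ = _ := by rw [mul_pow, ← pow_mul, ← pow_mul, mul_comm n 2]
  · calc 16 ^ (N1 + N2 + N3 + N4) ≤ 16 ^ n := Nat.pow_le_pow_right (by norm_num) (by omega)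
      _ ≤ q ^ n := Nat.pow_le_pow_left hge n
      _ ≤ 128 * q ^ n := by omega

/-- The numerical test for `Q ≥ 2 ^ 104`. -/
def bigTest (w u : ℕ) : Bool :=
  let M := 2 ^ 24
  let S := (((plist w 2).drop u).map (fun p => M / p + 1)).sum
  let x := M - (S + S)
  Nat.blt (S + S) M && Nat.ble (128 * (6 * 4 ^ u * (((w - u) + (w - u) - 1) * M + 2 * x)) ^ 4)
    (x ^ 4 * max (2 ^ 104) (plist w 2).prod)

lemma bigTest_all : (List.range 161).all (fun w => (List.range 24).any (bigTest w)) = true := by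
  decide +kernel

/-- The numerical test for `2 ^ 40 ≤ Q < 2 ^ 104`. -/
def midTest (w u : ℕ) : Bool :=
  let M := 2 ^ 24
  let S := (((plist w 2).drop u).map (fun p => M / p + 1)).sum
  let x := M - (S + S + (M / 16 + 18))
  Nat.blt (S + S + (M / 16 + 18)) M &&
    Nat.ble ((6 * 4 ^ u * (((w - u) + (w - u) + 18 - 1) * M + 2 * x)) ^ 2)
    (x ^ 2 * max (2 ^ 40) (plist w 2).prod)

lemma midTest_all : (List.range 27).all (fun w => (List.range 10).any (midTest w)) = true := by
  decide +kernel

theorem big_ok (q n : ℕ) (hq : 2 ≤ q) (hn : 3 ≤ n) (hQ : 2 ^ 104 ≤ q ^ n) : memB 3 2 q n := by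
  intro K L _ _ _ _ _ hK hL f hf
  have hm : 0 < Fintype.card L - 1 := by omega
  obtain ⟨w, hw, hsp⟩ := profile _ hm
  obtain ⟨N1, N2, N3, N4, g1, g2, g3, g4, g5, hps⟩ := poly_counts K n (by omega)
  rw [hK] at g1 g2 g3
  have hcore := core_bound q n N1 N2 N3 N4 hq g1 g2 g3 g4 g5 hQ
  rw [← hL] at hcore hQ
  set k := N1 + N2 + N3 + N4
  set Q := Fintype.card L
  have main : ∀ x Y c : ℕ, 128 * (6 * 4 ^ c * Y) ^ 4 ≤ x ^ 4 * Q →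
      (6 * 2 ^ (c + c + k) * Y) ^ 2 ≤ x ^ 2 * Q := by
    intro x Y c h
    refine (Nat.pow_le_pow_iff_left (n := 2) (by norm_num)).1 ?_
    have e1 : ((6 * 2 ^ (c + c + k) * Y) ^ 2) ^ 2 = (6 * 4 ^ c * Y) ^ 4 * 16 ^ k := by
      have e4 : 4 ^ c = 2 ^ (2 * c) := by rw [pow_mul]; norm_num
      have e16 : 16 ^ k = 2 ^ (4 * k) := by rw [pow_mul]; norm_num
      rw [e4, e16]
      ring
    rw [e1]
    calc (6 * 4 ^ c * Y) ^ 4 * 16 ^ k ≤ (6 * 4 ^ c * Y) ^ 4 * (128 * Q) := by gcongr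
      _ = 128 * (6 * 4 ^ c * Y) ^ 4 * Q := by ring
      _ ≤ x ^ 4 * Q * Q := by gcongr
      _ = _ := by ring
  rcases Nat.lt_or_ge w 161 with h | h
  · obtain ⟨u, -, hu⟩ := List.any_eq_true.1 (List.all_eq_true.1 bigTest_all w (List.mem_range.2 h))
    simp only [bigTest, Bool.and_eq_true, Nat.blt_eq, Nat.ble_eq] at hu
    obtain ⟨hS, hnum⟩ := hu
    refine crit n (by omega) (by rw [hK]; exact hL) f hf (2 ^ 24) _ _ _ _ _ _ _ _ _ _ (hsp (2 ^ 24) u)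
      (hsp (2 ^ 24) u) (hps (2 ^ 24)).1 (Nat.sub_pos_of_lt hS) (Nat.add_sub_of_le hS.le).le ?_
    refine main _ _ _ (hnum.trans (Nat.mul_le_mul_left _ ?_))
    exact max_le hQ (hw.trans (Nat.sub_le _ _))
  · have hP := hsp 1 w
    rw [List.drop_eq_nil_of_le (by rw [plist_length]), Nat.sub_self] at hP
    refine crit n (by omega) (by rw [hK]; exact hL) f hf 1 1 _ _ _ _ _ _ _ _ _ hP
      hP (hps 1).1 (by norm_num) (by simp) ?_
    refine main _ _ _ ?_
    have hw2 : 2654208 * 256 ^ w ≤ Q := by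
      obtain ⟨b, rfl⟩ := Nat.exists_eq_add_of_le h
      rw [plist_append, List.prod_append] at hw
      have h1 := plist_prod_ge b (pafter 161 2)
      have h2 : (256 : ℕ) ≤ pafter 161 2 := by decide +kernel
      have h3 : 2654208 * 256 ^ 161 ≤ (plist 161 2).prod := by
        have : Nat.ble (2654208 * 256 ^ 161) (plist 161 2).prod = true := by decide +kernel
        rwa [Nat.ble_eq] at this
      have h4 := Nat.mul_le_mul h3 ((Nat.pow_le_pow_left h2 b).trans h1)
      rw [pow_add, ← mul_assoc]
      omega
    calc 128 * (6 * 4 ^ w * ((0 + 0 + 0 - 1) * 1 + 2 * 1)) ^ 4 = 2654208 * 256 ^ w := by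
          rw [show (256 : ℕ) = 4 ^ 4 by norm_num, ← pow_mul, mul_comm 4 w, pow_mul]
          simp only [Nat.add_zero, Nat.zero_sub, Nat.zero_add, Nat.mul_one]
          ring
      _ ≤ 1 ^ 4 * Q := by rw [one_pow, one_mul]; exact hw2

theorem mid_ok (q n : ℕ) (hn : 3 ≤ n) (hqn : 16 * n ≤ q) (hQ : 2 ^ 40 ≤ q ^ n)
    (hQ2 : q ^ n < 2 ^ 104) : memB 3 2 q n := by
  intro K L _ _ _ _ _ hK hL f hf
  have hm : 0 < Fintype.card L - 1 := by omega
  obtain ⟨w, hw, hsp⟩ := profile _ hm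
  obtain ⟨N1, N2, N3, N4, -, -, -, -, -, hps⟩ := poly_counts K n (by omega)
  have hn18 : n ≤ 18 := by
    by_contra hc
    have h1 : 304 ^ 19 ≤ q ^ n := (Nat.pow_le_pow_right (by norm_num) (by omega)).trans
      (Nat.pow_le_pow_left (by omega : 304 ≤ q) n)
    have : 2 ^ 104 < 304 ^ 19 := by norm_num
    omega
  have hw26 : w < 27 := by
    by_contra hc
    obtain ⟨b, rfl⟩ := Nat.exists_eq_add_of_le (Nat.le_of_not_lt hc)
    rw [plist_append, List.prod_append] at hw
    have h1 := plist_prod_ge b (pafter 27 2)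
    have h2 : 1 ≤ pafter 27 2 := by decide +kernel
    have h3 : 2 ^ 104 ≤ (plist 27 2).prod := by
      have : Nat.ble (2 ^ 104) (plist 27 2).prod = true := by decide +kernel
      exact Nat.le_of_ble_eq_true this
    have h4 := Nat.mul_le_mul h3 ((Nat.one_le_pow b _ h2).trans h1)
    omega
  obtain ⟨u, -, hu⟩ := List.any_eq_true.1 (List.all_eq_true.1 midTest_all w (List.mem_range.2 hw26))
  simp only [midTest, Bool.and_eq_true, Nat.blt_eq, Nat.ble_eq] at hu
  obtain ⟨hS, hnum⟩ := hu
  have hP3 : PolySplit K n (2 ^ 24) 0 18 (2 ^ 24 / 16 + 18) := by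
    refine (hps (2 ^ 24)).2.mono hn18 ?_
    rw [hK]
    have h1 : 2 ^ 24 / q ≤ 2 ^ 24 / (16 * n) := Nat.div_le_div_left hqn (by omega)
    have h2 : n * (2 ^ 24 / (16 * n)) ≤ 2 ^ 24 / 16 := by
      rw [← Nat.div_div_eq_div_mul]
      exact Nat.mul_div_le _ _
    calc n * (2 ^ 24 / q + 1) ≤ n * (2 ^ 24 / (16 * n) + 1) := by gcongr
      _ = n * (2 ^ 24 / (16 * n)) + n := by ring
      _ ≤ _ := by omega
  refine crit n (by omega) (by rw [hK]; exact hL) f hf (2 ^ 24) _ _ _ _ _ _ _ _ _ _ (hsp (2 ^ 24) u)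
    (hsp (2 ^ 24) u) hP3 (Nat.sub_pos_of_lt hS) (Nat.add_sub_of_le hS.le).le ?_
  rw [Nat.add_zero, ← two_mul u, pow_mul, show 2 ^ 2 = 4 by norm_num]
  refine hnum.trans (Nat.mul_le_mul_left _ ?_)
  exact max_le (by rw [hL]; exact hQ) (hw.trans (Nat.sub_le _ _))

theorem generic_ok (q n : ℕ) (hpp : IsPrimePow q) (hn : 3 ≤ n) (hexc : ¬ Exc q n)
    (hsp : ¬ Special q n) : memB 3 2 q n := by
  have hq := hpp.two_le
  rcases Nat.lt_or_ge (q ^ n) (2 ^ 104) with h | h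
  · rcases Nat.lt_or_ge (q ^ n) (2 ^ 40) with h1 | h1
    · exact finite_ok q n hpp hn hexc hsp (Or.inl h1)
    · rcases Nat.lt_or_ge q (16 * n) with h2 | h2
      · exact finite_ok q n hpp hn hexc hsp (Or.inr ⟨h2, h⟩)
      · exact mid_ok q n hn h2 h1 h
  · exact big_ok q n hq hn h

theorem triv_ok {K L : Type} [Field K] [Field L] [Fintype K] [Fintype L] [Algebra K L]
    (n : ℕ) (hn : 0 < n) (hL : Fintype.card L = Fintype.card K ^ n) (f : RatFunc L)
    (hf : f ∈ Upsilon L 3 2) (A r S : ℕ) (hA : Fintype.card L ≤ A + (Fintype.card L - 1).totient)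
    (h3 : PolySplit K n (Fintype.card L) 0 r S) (hnum : 4 * A + 3 + S < Fintype.card L) :
    ∃ α : L, IsPrimitiveElem α ∧ IsNormalElem K n α ∧ IsPrimitiveElem (ratEval f α) := by
  classical
  obtain ⟨f1, f2, hf2, hfe, hd1, hd2, hcop, k, g, hk, hgm, hgi, hgX, -, hgd, hgn⟩ := hf
  have h0 : f1 * f2 ≠ 0 := by
    intro h; rw [h] at hgn; exact hgn (dvd_zero _)
  set NP : Finset L := Finset.univ.filter fun x => ¬ IsPrimitiveElem x with hNP
  have hQ1 : 1 < Fintype.card L := Fintype.one_lt_card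
  have hNPc : NP.card ≤ A := by
    have h1 : (Finset.univ.filter fun u : Lˣ => orderOf u = Fintype.card L - 1).card =
        (Fintype.card L - 1).totient := by
      refine IsCyclic.card_orderOf_eq_totient ?_
      rw [Fintype.card_units]
    have h2 : (Finset.univ.filter fun u : Lˣ => orderOf u = Fintype.card L - 1).card ≤
        (Finset.univ.filter fun x : L => IsPrimitiveElem x).card := by
      refine Finset.card_le_card_of_injOn (fun u => (u : L)) ?_ (fun _ _ _ _ h => Units.ext h)
      intro u hu
      simp only [Finset.coe_filter, Finset.mem_univ, true_and, Set.mem_ofPred_eq] at hu ⊢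
      rw [IsPrimitiveElem, orderOf_units, hu]
    have h3 : (Finset.univ.filter fun x : L => IsPrimitiveElem x).card + NP.card =
        Fintype.card L := by
      rw [hNP, ← Finset.card_univ]
      convert Finset.card_filter_add_card_filter_not (s := (Finset.univ : Finset L)) _
    omega
  have h0NP : (0 : L) ∈ NP := by
    rw [hNP, Finset.mem_filter]
    refine ⟨Finset.mem_univ _, fun h => ?_⟩
    rw [IsPrimitiveElem, orderOf_zero] at h
    omega
  have hZ := upsilon_zero_count f1 f2 h0 hd1 hd2
  obtain ⟨J, R, -, hJR, hJ, -, hS⟩ := h3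
  have hJ0 : J = ∅ := Finset.card_eq_zero.1 (by omega)
  set Z : Finset L := Finset.univ.filter fun x : L => ¬ (x ≠ 0 ∧ f1.eval x ≠ 0 ∧ f2.eval x ≠ 0)
  set NN : K[X] → Finset L := fun P =>
    Finset.univ.filter fun x : L => ∃ y, aeval (frobL K L) P y = x with hNN
  set BF : L → Finset L := fun c => (f1 - C c * f2).roots.toFinset with hBF
  have hNNc : (R.biUnion NN).card ≤ S := by
    have h1 : ((R.biUnion NN).card : ℝ) ≤ ∑ P ∈ R, ((NN P).card : ℝ) := by
      exact_mod_cast Finset.card_biUnion_le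
    have h2 : ∀ P ∈ R, ((NN P).card : ℝ) =
        (Fintype.card L : ℝ) * (1 / (Fintype.card K : ℝ) ^ P.natDegree) := by
      intro P hP
      obtain ⟨P', hP'⟩ := ((hJR P).1 (Or.inr hP)).2.2
      have e1 := (frob_ker_card (L := L) n hn hL P P' hP').1
      have e2 := frob_card_mul (L := L) P
      rw [e1] at e2
      have e3 : (NN P).card = Nat.card (LinearMap.range (aeval (frobL K L) P)) := by
        rw [← Nat.card_eq_finsetCard]
        refine Nat.card_congr (Equiv.subtypeEquivRight fun x => ?_)
        simp [hNN]
      have hq : (0 : ℝ) < (Fintype.card K : ℝ) ^ P.natDegree := by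
        have : 0 < Fintype.card K := Fintype.card_pos
        positivity
      rw [mul_one_div, eq_div_iff hq.ne', e3]
      exact_mod_cast e2
    rw [Finset.sum_congr rfl h2, ← Finset.mul_sum] at h1
    exact_mod_cast h1.trans hS
  have hBFc : ((NP.erase 0).biUnion BF).card ≤ (NP.erase 0).card * 3 := by
    refine Finset.card_biUnion_le_card_mul _ _ _ fun c _ => ?_
    refine (Multiset.toFinset_card_le _).trans ((card_roots' _).trans ?_)
    refine (natDegree_sub_le _ _).trans (max_le hd1 ?_)
    exact (natDegree_C_mul_le c f2).trans (hd2.trans (by norm_num))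
  rw [Finset.card_erase_of_mem h0NP] at hBFc
  have hNP0 : 0 < NP.card := Finset.card_pos.2 ⟨0, h0NP⟩
  have hU : (NP ∪ R.biUnion NN ∪ Z ∪ (NP.erase 0).biUnion BF).card < Fintype.card L := by
    have h1 := Finset.card_union_le (NP ∪ R.biUnion NN ∪ Z) ((NP.erase 0).biUnion BF)
    have h2 := Finset.card_union_le (NP ∪ R.biUnion NN) Z
    have h3 := Finset.card_union_le NP (R.biUnion NN)
    omega
  obtain ⟨α, hα⟩ : ∃ α, α ∉ NP ∪ R.biUnion NN ∪ Z ∪ (NP.erase 0).biUnion BF := by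
    by_contra hcon
    push Not at hcon
    have := Finset.card_le_card (s := Finset.univ) fun x _ => hcon x
    rw [Finset.card_univ] at this
    omega
  simp only [Finset.mem_union, not_or] at hα
  obtain ⟨⟨⟨a1, a2⟩, a3⟩, a4⟩ := hα
  have b3 : α ≠ 0 ∧ f1.eval α ≠ 0 ∧ f2.eval α ≠ 0 := by
    by_contra hc
    exact a3 (Finset.mem_filter.2 ⟨Finset.mem_univ _, hc⟩)
  refine ⟨α, ?_, ?_, ?_⟩
  · by_contra hc
    exact a1 (Finset.mem_filter.2 ⟨Finset.mem_univ _, hc⟩)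
  · refine normal_of n hn hL α fun P hP1 hP2 hP3 hy => a2 ?_
    have hPR : P ∈ R := by
      rcases (hJR P).2 ⟨hP1, hP2, hP3⟩ with h | h
      · rw [hJ0] at h; simp at h
      · exact h
    exact Finset.mem_biUnion.2 ⟨P, hPR, Finset.mem_filter.2 ⟨Finset.mem_univ _, hy⟩⟩
  · by_contra hc
    rw [hfe, ratEval_div _ _ _ b3.2.2] at hc
    set c := f1.eval α / f2.eval α with hcdef
    have hc0 : c ≠ 0 := div_ne_zero b3.2.1 b3.2.2
    refine a4 (Finset.mem_biUnion.2 ⟨c, Finset.mem_erase.2 ⟨hc0, ?_⟩, ?_⟩)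
    · exact Finset.mem_filter.2 ⟨Finset.mem_univ _, hc⟩
    · rw [hBF, Multiset.mem_toFinset, mem_roots']
      constructor
      · intro he
        have he' : f1 = C c * f2 := sub_eq_zero.1 he
        rw [he'] at hcop
        have hu2 : IsUnit f2 := hcop.isUnit_of_dvd' (dvd_mul_left _ _) dvd_rfl
        have hu1 : IsUnit (f1 * f2) := by
          rw [he']
          exact ((isUnit_C.2 hc0.isUnit).mul hu2).mul hu2
        exact hgi.not_isUnit (isUnit_of_dvd_unit ((dvd_pow_self g hk.ne').trans hgd) hu1)
      · rw [IsRoot, eval_sub, eval_mul, eval_C, hcdef, div_mul_cancel₀ _ b3.2.2, sub_self]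

theorem special_ok (q n : ℕ) (h : Special q n) : memB 3 2 q n := by
  intro K L _ _ _ _ _ hK hL f hf
  have key : ∀ A r S, 0 < n → q ^ n ≤ A + (q ^ n - 1).totient → PolySplit K n (q ^ n) 0 r S →
      4 * A + 3 + S < q ^ n →
      ∃ α : L, IsPrimitiveElem α ∧ IsNormalElem K n α ∧ IsPrimitiveElem (ratEval f α) := by
    intro A r S hn h1 h2 h3
    exact triv_ok n hn (by rw [hL, hK]) f hf A r S (by rw [hL]; exact h1) (by rw [hL]; exact h2)
      (by rw [hL]; exact h3)
  have hP := fun M hn => polySplit_of K n M 0 _ _ _ _ hn rfl rfl rfl rfl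
  rw [hK] at hP
  rcases h with ⟨rfl, rfl⟩ | ⟨rfl, rfl⟩ | ⟨rfl, rfl⟩ | ⟨rfl, rfl⟩
  · refine key 2 _ _ (by norm_num) ?_ (hP _ (by norm_num)) (by norm_num)
    have : Nat.totient 31 = 30 := by decide +kernel
    norm_num [this]
  · refine key 2 _ _ (by norm_num) ?_ (hP _ (by norm_num)) (by norm_num)
    have : Nat.totient 127 = 126 := by decide +kernel
    norm_num [this]
  · refine key 112 _ _ (by norm_num) ?_ (hP _ (by norm_num)) (by norm_num)
    have : Nat.totient 2047 = 1936 := by decide +kernel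
    norm_num [this]
  · refine key 80 _ _ (by norm_num) ?_ (hP _ (by norm_num)) (by norm_num)
    have : Nat.totient 511 = 432 := by decide +kernel
    norm_num [this]

lemma neg_core_23 {F : Type} [Field F] (a : F) (hp : (2 : F) = 0) (hN : a ^ 7 = 1) (e1 : a ^ 1
  ≠ 1) (r0 : a^4 + a^2 + a ≠ 0) : a^3 + a^2 + 1 = 0 := by
  have hPhi : a^6 + a^5 + a^4 + a^3 + a^2 + a + 1 = 0 := by
    have h : (a^6 + a^5 + a^4 + a^3 + a^2 + a + 1) * ((a^1 - 1)) = 0 := by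
      linear_combination (1) * hN
    rcases mul_eq_zero.1 h with h | h
    · exact h
    · exact absurd (sub_eq_zero.1 h) e1
  have hprod : (a^3 + a^2 + 1) * (a^3 + a + 1) = 0 := by
        linear_combination hPhi + (a^3) * hp
  simp only [mul_eq_zero] at hprod
  rcases hprod with h | h
  · linear_combination (1) * h + (0) * hp
  · refine absurd ?_ r0
    linear_combination (a) * h + (0) * hp

lemma neg_core_24 {F : Type} [Field F] (a : F) (hp : (2 : F) = 0) (hN : a ^ 15 = 1) (e5 : a ^ 5
  ≠ 1) (e3 : a ^ 3 ≠ 1) (r0 : a^8 + a^4 + a^2 + a ≠ 0) : (a^3 + a) ^ 3 = (1) ^ 3 := by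
  have hPhi : a^8 - a^7 + a^5 - a^4 + a^3 - a + 1 = 0 := by
    have h : (a^8 - a^7 + a^5 - a^4 + a^3 - a + 1) * ((a^5 - 1)*(a^3 - 1)) = 0 := by
      linear_combination ((a^1 - 1)) * hN
    rcases mul_eq_zero.1 h with h | h
    · exact h
    · rcases mul_eq_zero.1 h with h | h
      · exact absurd (sub_eq_zero.1 h) e5
      · exact absurd (sub_eq_zero.1 h) e3
  have hprod : (a^4 + a^3 + 1) * (a^4 + a + 1) = 0 := by
        linear_combination hPhi + (a^7 + 2*a^4 + a) * hp
  simp only [mul_eq_zero] at hprod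
  rcases hprod with h | h
  · linear_combination (a^5 + a^4 + 1) * h + (-a^8 + a^7 + a^5 - a^4 - 1) * hp
  · refine absurd ?_ r0
    linear_combination (a^4 + a) * h + (-a^5) * hp

lemma neg_core_26 {F : Type} [Field F] (a : F) (hp : (2 : F) = 0) (hN : a ^ 63 = 1) (e21 : a ^
  21 ≠ 1) (e9 : a ^ 9 ≠ 1) (r0 : a^32 + a^16 + a^8 + a^4 + a^2 + a ≠ 0) (r1 : a^16 + a^8 + a^2
  + a ≠ 0) : (a^2 + a + 1) ^ 9 = (1) ^ 9 ∨ (a^2 + a + 1) ^ 21 = (1) ^ 21 := by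
  have hPhi : a^36 - a^33 + a^27 - a^24 + a^18 - a^12 + a^9 - a^3 + 1 = 0 := by
    have h : (a^36 - a^33 + a^27 - a^24 + a^18 - a^12 + a^9 - a^3 + 1) * ((a^21 - 1)*(a^9 - 1)) = 0 := by
      linear_combination ((a^3 - 1)) * hN
    rcases mul_eq_zero.1 h with h | h
    · exact h
    · rcases mul_eq_zero.1 h with h | h
      · exact absurd (sub_eq_zero.1 h) e21
      · exact absurd (sub_eq_zero.1 h) e9
  have hprod : (a^6 + a^5 + 1) * (a^6 + a^5 + a^3 + a^2 + 1) * (a^6 + a + 1) * (a^6 + a^5 + a^4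
  + a + 1) * (a^6 + a^4 + a^3 + a + 1) * (a^6 + a^5 + a^2 + a + 1) = 0 := by
        linear_combination hPhi + (2*a^35 + 4*a^34 + 7*a^33 + 10*a^32 + 15*a^31 + 24*a^30 +
      36*a^29 + 48*a^28 + 61*a^27 + 76*a^26 + 94*a^25 + 119*a^24 + 138*a^23 + 151*a^22 +
      164*a^21 + 174*a^20 + 186*a^19 + 194*a^18 + 186*a^17 + 174*a^16 + 164*a^15 + 151*a^14 +
      138*a^13 + 119*a^12 + 94*a^11 + 76*a^10 + 61*a^9 + 48*a^8 + 36*a^7 + 24*a^6 + 15*a^5 +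
      10*a^4 + 7*a^3 + 4*a^2 + 2*a) * hp
  simp only [mul_eq_zero] at hprod
  rcases hprod with ((((h | h) | h) | h) | h) | h
  · refine Or.inr ?_
    linear_combination (a^36 + a^34 + a^33 + a^31 + a^30 + a^29 + a^28 + a^27 + a^25 + a^23 +
      a^21 + a^18 + a^16 + a^15 + a^11 + a^10 + a^5 + a^4 + a^2 + a) * h + (10*a^41 + 115*a^40
      + 874*a^39 + 5092*a^38 + 24139*a^37 + 96623*a^36 + 334646*a^35 + 1020441*a^34 +
      2775376*a^33 + 6799957*a^32 + 15126089*a^31 + 30738294*a^30 + 57350264*a^29 +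
      98639354*a^28 + 156908877*a^27 + 231459700*a^26 + 317284600*a^25 + 404838367*a^24 +
      481401584*a^23 + 533946199*a^22 + 552675363*a^21 + 533946199*a^20 + 481401585*a^19 +
      404838367*a^18 + 317284600*a^17 + 231459699*a^16 + 156908877*a^15 + 98639355*a^14 +
      57350265*a^13 + 30738295*a^12 + 15126089*a^11 + 6799956*a^10 + 2775377*a^9 + 1020442*a^8
      + 334646*a^7 + 96624*a^6 + 24139*a^5 + 5092*a^4 + 875*a^3 + 115*a^2 + 10*a) * hp
  · refine absurd ?_ r1
    linear_combination (a^10 + a^9 + a^8 + a^3 + a^2 + a) * h + (-a^15 - a^14 - a^13 - a^12 -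
      a^11 - a^10 - a^9 - a^8 - a^7 - a^6 - a^5 - a^4 - a^3) * hp
  · refine absurd ?_ r0
    linear_combination (a^26 + a^21 + a^20 + a^16 + a^14 + a^11 + a^9 + a^8 + a^6 + a^5 + a^4 +
      a) * h + (-a^27 - a^26 - a^22 - a^21 - a^20 - a^17 - a^15 - a^14 - a^12 - a^11 - a^10 -
      a^9 - a^7 - a^6 - a^5) * hp
  · refine Or.inl ?_
    linear_combination (a^12 + a^7 + a^5 + a) * h + (4*a^17 + 22*a^16 + 78*a^15 + 207*a^14 +
      440*a^13 + 776*a^12 + 1151*a^11 + 1453*a^10 + 1569*a^9 + 1453*a^8 + 1151*a^7 + 776*a^6 +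
      440*a^5 + 207*a^4 + 78*a^3 + 22*a^2 + 4*a) * hp
  · refine absurd ?_ r0
    linear_combination (a^26 + a^24 + a^23 + a^22 + a^21 + a^20 + a^19 + a^16 + a^14 + a^12 +
      a^10 + a^6 + a^5 + a) * h + (-a^30 - a^29 - a^28 - 2*a^27 - 2*a^26 - 2*a^25 - 2*a^24 -
      2*a^23 - 2*a^22 - a^21 - 2*a^20 - a^19 - a^18 - a^17 - a^16 - a^15 - a^14 - a^13 - a^12 -
      a^11 - a^10 - a^9 - a^7 - a^6 - a^5) * hp
  · refine Or.inr ?_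
    linear_combination (a^36 + a^34 + a^33 + a^32 + a^31 + a^26 + a^22 + a^19 + a^18 + a^14 +
      a^13 + a^12 + a^8 + a^7 + a^3 + a) * h + (10*a^41 + 115*a^40 + 874*a^39 + 5091*a^38 +
      24138*a^37 + 96623*a^36 + 334646*a^35 + 1020441*a^34 + 2775376*a^33 + 6799956*a^32 +
      15126089*a^31 + 30738295*a^30 + 57350265*a^29 + 98639354*a^28 + 156908877*a^27 +
      231459700*a^26 + 317284600*a^25 + 404838366*a^24 + 481401584*a^23 + 533946199*a^22 +
      552675364*a^21 + 533946198*a^20 + 481401583*a^19 + 404838366*a^18 + 317284600*a^17 +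
      231459700*a^16 + 156908877*a^15 + 98639353*a^14 + 57350263*a^13 + 30738294*a^12 +
      15126090*a^11 + 6799957*a^10 + 2775376*a^9 + 1020441*a^8 + 334646*a^7 + 96624*a^6 +
      24139*a^5 + 5092*a^4 + 874*a^3 + 115*a^2 + 10*a) * hp

lemma neg_core_33 {F : Type} [Field F] (a : F) (hp : (3 : F) = 0) (hN : a ^ 26 = 1) (e13 : a ^
  13 ≠ 1) (e2 : a ^ 2 ≠ 1) (r0 : a^9 + a^3 + a ≠ 0) : (a^3) ^ 13 = (-a^2 - a + 1) ^ 13 := by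
  have hPhi : a^12 - a^11 + a^10 - a^9 + a^8 - a^7 + a^6 - a^5 + a^4 - a^3 + a^2 - a + 1 = 0 := by
    have h : (a^12 - a^11 + a^10 - a^9 + a^8 - a^7 + a^6 - a^5 + a^4 - a^3 + a^2 - a + 1) * ((a^13 - 1)*(a^2 - 1)) = 0 := by
      linear_combination ((a^1 - 1)) * hN
    rcases mul_eq_zero.1 h with h | h
    · exact h
    · rcases mul_eq_zero.1 h with h | h
      · exact absurd (sub_eq_zero.1 h) e13
      · exact absurd (sub_eq_zero.1 h) e2
  have hprod : (a^3 - a^2 + 1) * (a^3 - a^2 + a + 1) * (a^3 - a + 1) * (a^3 + a^2 - a + 1) = 0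
  := by
        linear_combination hPhi + (-a^10 + 3*a^9 - 2*a^8 - 2*a^7 + 5*a^6 - 2*a^5 - 2*a^4 +
      3*a^3 - a^2) * hp
  simp only [mul_eq_zero] at hprod
  rcases hprod with ((h | h) | h) | h
  · linear_combination (a^36 + a^35 + a^34 - a^32 + a^31 + a^30 - a^29 + a^28 + a^26 + a^22 +
    a^20 + a^19 + a^17 - a^16 - a^13 + a^12 - a^11 + a^10 - a^9 - a^8 - a^6 - a^5 + a^4 + a -
    1) * h + (-a^34 + a^32 - a^31 + 4*a^25 + 22*a^24 + 43*a^23 - 22*a^22 - 238*a^21 - 239*a^20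
    + 477*a^19 + 953*a^18 - 477*a^17 - 1906*a^16 + 216*a^15 + 2579*a^14 - 52*a^13 - 2578*a^12 +
    217*a^11 + 1906*a^10 - 476*a^9 - 953*a^8 + 476*a^7 + 239*a^6 - 238*a^5 + 21*a^4 + 44*a^3 -
    22*a^2 + 4*a) * hp
  · linear_combination (a^36 + a^35 + a^33 - a^31 + a^30 - a^29 - a^28 - a^27 + a^26 + a^22 -
    a^18 + a^17 + a^16 - a^15 + a^14 - a^13 + a^12 - a^11 - a^9 - a^8 - a^7 - a^6 + a^4 + a^2 -
    a - 1) * h + (-a^36 - a^33 + a^32 + a^28 + 4*a^25 + 22*a^24 + 43*a^23 - 22*a^22 - 238*a^21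
    - 239*a^20 + 477*a^19 + 954*a^18 - 478*a^17 - 1906*a^16 + 216*a^15 + 2579*a^14 - 52*a^13 -
    2578*a^12 + 217*a^11 + 1907*a^10 - 476*a^9 - 953*a^8 + 477*a^7 + 239*a^6 - 239*a^5 + 22*a^4
    + 43*a^3 - 22*a^2 + 5*a) * hp
  · refine absurd ?_ r0
    linear_combination (a^6 + a^4 - a^3 + a^2 + a) * h + (-a^4 + a^3) * hp
  · linear_combination (a^36 - a^35 - a^34 - a^33 + a^32 - a^31 + a^29 + a^27 + a^26 + a^22 +
    a^21 + a^20 - a^18 - a^17 - a^16 - a^15 - a^14 - a^13 + a^11 + a^10 - a^9 - a^6 + a^4 + a^3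
    - a^2 - 1) * h + (a^37 + a^33 - a^32 - a^29 + 4*a^25 + 21*a^24 + 43*a^23 - 22*a^22 -
    238*a^21 - 238*a^20 + 477*a^19 + 954*a^18 - 476*a^17 - 1906*a^16 + 217*a^15 + 2578*a^14 -
    52*a^13 - 2578*a^12 + 217*a^11 + 1906*a^10 - 476*a^9 - 953*a^8 + 476*a^7 + 238*a^6 -
    238*a^5 + 22*a^4 + 43*a^3 - 21*a^2 + 4*a) * hp

lemma neg_core_34 {F : Type} [Field F] (a : F) (hp : (3 : F) = 0) (hN : a ^ 80 = 1) (e40 : a ^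
  40 ≠ 1) (e16 : a ^ 16 ≠ 1) (r0 : a^27 + a^9 + a^3 + a ≠ 0) (r1 : -a^27 + a^9 - a^3 + a ≠ 0)
  (r2 : -a^9 + a ≠ 0) : (a^2) ^ 5 = (a + 1) ^ 5 ∨ (a^2) ^ 8 = (a + 1) ^ 8 ∨ (a^2) ^ 16 = (a +
  1) ^ 16 ∨ (a^2) ^ 40 = (a + 1) ^ 40 := by
  have hPhi : a^32 - a^24 + a^16 - a^8 + 1 = 0 := by
    have h : (a^32 - a^24 + a^16 - a^8 + 1) * ((a^40 - 1)*(a^16 - 1)) = 0 := by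
      linear_combination ((a^8 - 1)) * hN
    rcases mul_eq_zero.1 h with h | h
    · exact h
    · rcases mul_eq_zero.1 h with h | h
      · exact absurd (sub_eq_zero.1 h) e40
      · exact absurd (sub_eq_zero.1 h) e16
  have hprod : (a^4 + a^3 - 1) * (a^4 - a^3 - 1) * (a^4 + a - 1) * (a^4 - a^3 + a^2 + a - 1) *
  (a^4 - a^3 - a^2 + a - 1) * (a^4 - a - 1) * (a^4 + a^3 + a^2 - a - 1) * (a^4 + a^3 - a^2 - a
  - 1) = 0 := by
        linear_combination hPhi + (-a^30 - a^28 + 2*a^26 + 9*a^24 - 5*a^22 - 22*a^20 + 2*a^18 +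
      32*a^16 + 2*a^14 - 22*a^12 - 5*a^10 + 9*a^8 + 2*a^6 - a^4 - a^2) * hp
  simp only [mul_eq_zero] at hprod
  rcases hprod with ((((((h | h) | h) | h) | h) | h) | h) | h
  · refine Or.inr (Or.inr (Or.inl ?_))
    linear_combination (a^28 - a^27 + a^26 - a^25 - a^24 + a^22 + a^21 + a^20 - a^19 - a^18 -
      a^17 - a^16 - a^14 + a^12 + a^11 + a^10 - a^8 - a^7 + a^6 + a^5 + a^4 + a + 1) * h +
      (a^28 - a^25 - a^24 + a^22 + a^21 + a^20 - a^16 - 6*a^15 - 41*a^14 - 187*a^13 - 606*a^12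
      - 1455*a^11 - 2669*a^10 - 3814*a^9 - 4291*a^8 - 3814*a^7 - 2669*a^6 - 1456*a^5 - 607*a^4
      - 187*a^3 - 40*a^2 - 5*a) * hp
  · refine Or.inr (Or.inr (Or.inr ?_))
    linear_combination (a^76 + a^75 + a^74 + a^73 - a^72 + a^70 - a^69 + a^68 + a^67 - a^66 +
      a^65 - a^64 - a^62 - a^60 - a^59 + a^58 + a^57 - a^55 + a^53 + a^52 + a^49 - a^48 - a^47
      - a^46 - a^44 + a^43 - a^40 + a^36 - a^33 - a^32 - a^31 - a^30 + a^29 + a^27 - a^26 -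
      a^24 - a^23 + a^22 + a^21 - a^19 + a^17 + a^16 + a^13 - a^12 - a^11 - a^10 - a^9 - a^7 +
      a^5 + a^4 + a + 1) * h + (a^76 + a^73 - a^72 + a^70 - a^69 + a^68 - a^62 + a^52 - a^47 -
      a^40 - 13*a^39 - 260*a^38 - 3293*a^37 - 30463*a^36 - 219336*a^35 - 1279460*a^34 -
      6214521*a^33 - 25634895*a^32 - 91146294*a^31 - 282553509*a^30 - 770600480*a^29 -
      1862284493*a^28 - 4011074293*a^27 - 7735643281*a^26 - 13408448352*a^25 - 20950700550*a^24
      - 29577459600*a^23 - 37793420600*a^22 - 43760802800*a^21 - 45948842940*a^20 -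
      43760802800*a^19 - 37793420600*a^18 - 29577459600*a^17 - 20950700549*a^16 -
      13408448352*a^15 - 7735643280*a^14 - 4011074293*a^13 - 1862284494*a^12 - 770600480*a^11 -
      282553510*a^10 - 91146294*a^9 - 25634895*a^8 - 6214520*a^7 - 1279460*a^6 - 219336*a^5 -
      30463*a^4 - 3293*a^3 - 260*a^2 - 13*a) * hp
  · refine absurd ?_ r0
    linear_combination (a^23 - a^20 + a^19 + a^17 + a^16 + a^15 - a^14 - a^11 - a^10 + a^8 -
      a^6 + a^4 + a^3 - a^2 - a) * h + (-a^20 + a^15 + a^3) * hp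
  · refine Or.inr (Or.inl ?_)
    linear_combination (a^12 + a^11 + a^9 + a^8 + a^7 - a^6 + a^5 + a^4 - a^2 + 1) * h + (-a^13
      - a^9 - 2*a^7 - 10*a^6 - 19*a^5 - 23*a^4 - 18*a^3 - 10*a^2 - 3*a) * hp
  · refine absurd ?_ r1
    linear_combination (-a^23 - a^22 + a^21 + a^20 - a^19 + a^18 + a^15 - a^14 + a^12 - a^9 -
      a^7 - a^5 + a^3 - a^2 - a) * h + (-a^25 + a^23 - a^22 + a^20 - a^19 + a^18 - a^16 + a^15
      - a^7 + a^6 - a^4) * hp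
  · refine absurd ?_ r0
    linear_combination (a^23 + a^20 + a^19 + a^17 - a^16 + a^15 + a^14 - a^11 + a^10 - a^8 +
      a^6 - a^4 + a^3 + a^2 - a) * h + (a^20 + a^15 + a^3) * hp
  · refine Or.inl ?_
    linear_combination (a^6 - a^5 - a^3 + a^2 + a + 1) * h + (a^7 - a^5 - 3*a^4 - 4*a^3 - 3*a^2
      - a) * hp
  · refine absurd ?_ r1
    linear_combination (-a^23 + a^22 + a^21 - a^20 - a^19 - a^18 + a^15 + a^14 - a^12 - a^9 -
      a^7 - a^5 + a^3 + a^2 - a) * h + (-a^25 + a^23 + a^22 - a^20 - a^19 - a^18 + a^16 + a^15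
      - a^7 - a^6 + a^4) * hp

lemma neg_of (p n : ℕ) [Fact p.Prime] (hn : n ≠ 0)
    (h : ∀ (L : Type) [Field L] [Fintype L] [Algebra (ZMod p) L], Fintype.card L = p ^ n →
      (p : L) = 0 → ∃ f ∈ Upsilon L 3 2, ∀ α : L, IsPrimitiveElem α →
        IsNormalElem (ZMod p) n α → ¬ IsPrimitiveElem (ratEval f α)) : ¬ memB 3 2 p n := by
  intro hB
  let _ : Fintype (GaloisField p n) := Fintype.ofFinite _
  have hc : Fintype.card (GaloisField p n) = p ^ n := by
    rw [← Nat.card_eq_fintype_card]; exact GaloisField.card p n hn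
  have hp : ((p : ℕ) : GaloisField p n) = 0 := CharP.cast_eq_zero _ p
  obtain ⟨f, hf, hneg⟩ := h (GaloisField p n) hc hp
  obtain ⟨α, h1, h2, h3⟩ := hB (ZMod p) (GaloisField p n) (ZMod.card p) hc f hf
  exact hneg α h1 h2 h3

lemma normal_rel_ne {p n : ℕ} [Fact p.Prime] {L : Type} [Field L] [Algebra (ZMod p) L]
    {a : L} (h : IsNormalElem (ZMod p) n a) (c : Fin n → ℤ) (i : Fin n)
    (hi : ((c i : ℤ) : ZMod p) ≠ 0) : ∑ j : Fin n, (c j : L) * a ^ p ^ (j : ℕ) ≠ 0 := by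
  intro h0
  apply hi
  have := Fintype.linearIndependent_iff.1 h.1 (fun j => ((c j : ℤ) : ZMod p)) ?_ i
  · exact this
  · rw [← h0]
    refine Finset.sum_congr rfl fun j _ => ?_
    rw [Algebra.smul_def, map_intCast, ZMod.card]

lemma prim_pow_ne {L : Type} [Field L] [Fintype L] {a : L} (h : IsPrimitiveElem a) (d : ℕ)
    (hd : d ≠ 0) (hlt : d < Fintype.card L - 1) : a ^ d ≠ 1 := by
  apply pow_ne_one_of_lt_orderOf hd
  rw [h]; exact hlt

lemma prim_pow_eq {L : Type} [Field L] [Fintype L] {a : L} (h : IsPrimitiveElem a) {N : ℕ}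
    (hN : Fintype.card L = N + 1) : a ^ N = 1 := by
  have h2 := pow_orderOf_eq_one a
  rw [h, hN] at h2
  exact h2

lemma ups_mem {L : Type} [Field L] [Fintype L] (f₁ f₂ D : L[X]) (a : ℕ)
    (h2 : f₂ ≠ 0) (d1 : f₁.natDegree ≤ 3) (d2 : f₂.natDegree ≤ 2) (hc : IsCoprime f₁ f₂)
    (hf : f₁ * f₂ = X ^ a * D) (hD : IsCoprime D (derivative D)) (h0 : D.eval 0 ≠ 0)
    (hdeg : ¬ IsUnit D) :
    algebraMap L[X] (RatFunc L) f₁ / algebraMap L[X] (RatFunc L) f₂ ∈ Upsilon L 3 2 := by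
  obtain ⟨g, gm, gi, gd⟩ := exists_monic_irreducible_factor D hdeg
  have hX : ¬ g ∣ X := by
    intro hg
    have := gi.associated_of_dvd irreducible_X hg
    have h3 : X ∣ D := this.symm.dvd.trans gd
    rw [X_dvd_iff, coeff_zero_eq_eval_zero] at h3
    exact h0 h3
  refine ⟨f₁, f₂, h2, rfl, d1, d2, hc, 1, g, one_pos, gm, gi, ?_, ?_, ?_, ?_⟩
  · rintro rfl; exact hX dvd_rfl
  · simp
  · rw [pow_one, hf]; exact gd.mul_left _
  · rw [hf]
    intro hd
    have hco : IsCoprime (g ^ (1 + 1)) (X ^ a) :=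
      IsCoprime.pow ((gi.coprime_iff_not_dvd).2 hX)
    have := hco.dvd_of_dvd_mul_left hd
    rw [one_add_one_eq_two, pow_two] at this
    exact gi.not_isUnit ((Separable.squarefree hD) g this)

lemma not_prim_div {L : Type} [Field L] [Fintype L] {x y : L} (d : ℕ) (hd : 0 < d)
    (hlt : d < Fintype.card L - 1) (hy : y ≠ 0) (h : x ^ d = y ^ d) :
    ¬ IsPrimitiveElem (x / y) := by
  intro hp
  refine prim_pow_ne hp d hd.ne' hlt ?_
  rw [div_pow, h, div_self (pow_ne_zero _ hy)]

lemma not_unit_of_root {L : Type} [Field L] (D : L[X]) (h : 0 < D.natDegree) : ¬ IsUnit D := by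
  intro hu
  rw [natDegree_eq_zero_of_isUnit hu] at h
  exact lt_irrefl _ h

lemma neg_23 : ¬ memB 3 2 2 3 := by
  have : Fact (Nat.Prime 2) := ⟨Nat.prime_two⟩
  refine neg_of 2 3 (by norm_num) ?_
  intro L _ _ _ hc hp
  have hp' : (2 : L) = 0 := by exact_mod_cast hp
  have hpX : (2 : L[X]) = 0 := by
    have : (C (2 : L)) = 0 := by rw [hp', C_0]
    rwa [C_ofNat] at this
  refine ⟨_, ups_mem (X ^ 3 + X ^ 2 + 1) 1 (X ^ 3 + X ^ 2 + 1) 0 one_ne_zero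
    (by compute_degree!) (by simp) isCoprime_one_right (by ring) ⟨1, -(X + 1), ?_⟩ (by simp) ?_, ?_⟩
  · simp only [derivative_add, derivative_X_pow, derivative_one]
    simp only [Nat.cast_ofNat, map_ofNat]
    linear_combination (-X ^ 3 - 2 * X ^ 2 - X) * hpX
  · apply not_unit_of_root
    have : (X ^ 3 + X ^ 2 + 1 : L[X]).natDegree = 3 := by compute_degree!
    omega
  · intro α h1 h2
    have hN := prim_pow_eq h1 (N := 7) (by rw [hc]; norm_num)
    have e1 := prim_pow_ne h1 1 (by norm_num) (by rw [hc]; norm_num)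
    have r0 := normal_rel_ne h2 ![1, 1, 1] 0 (by simp)
    simp only [Fin.sum_univ_succ, Fin.sum_univ_zero] at r0
    have key := neg_core_23 α hp' hN e1 (by intro h; apply r0; simp; linear_combination h)
    rw [ratEval_div _ _ _ (by simp)]
    simp only [eval_add, eval_pow, eval_X, eval_one, key, zero_div]
    unfold IsPrimitiveElem
    rw [orderOf_zero, hc]; norm_num

lemma neg_24 : ¬ memB 3 2 2 4 := by
  have : Fact (Nat.Prime 2) := ⟨Nat.prime_two⟩
  refine neg_of 2 4 (by norm_num) ?_
  intro L _ _ _ hc hp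
  have hp' : (2 : L) = 0 := by exact_mod_cast hp
  have hpX : (2 : L[X]) = 0 := by
    have : (C (2 : L)) = 0 := by rw [hp', C_0]
    rwa [C_ofNat] at this
  have hfac : (X ^ 3 + X) * 1 = (X - C 1 : L[X]) ^ 2 * X := by
    rw [C_1]
    linear_combination (X ^ 2) * hpX
  refine ⟨algebraMap _ _ (X ^ 3 + X) / algebraMap _ _ 1, ⟨X ^ 3 + X, 1, one_ne_zero, rfl,
    by compute_degree!, by simp, isCoprime_one_right, 2, X - C 1, by norm_num, monic_X_sub_C _,
    irreducible_X_sub_C _, ?_, ?_, ?_, ?_⟩, ?_⟩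
  · intro h
    have := congrArg (eval 0) h
    simp at this
  · rw [hc]; norm_num
  · rw [hfac]; exact dvd_mul_right _ _
  · rw [hfac, pow_succ]
    intro h
    have := (mul_dvd_mul_iff_left (pow_ne_zero 2 (X_sub_C_ne_zero (1 : L)))).1 h
    rw [dvd_iff_isRoot] at this
    simp at this
  · intro α h1 h2
    have hN := prim_pow_eq h1 (N := 15) (by rw [hc]; norm_num)
    have e5 := prim_pow_ne h1 5 (by norm_num) (by rw [hc]; norm_num)
    have e3 := prim_pow_ne h1 3 (by norm_num) (by rw [hc]; norm_num)
    have r0 := normal_rel_ne h2 ![1, 1, 1, 1] 0 (by simp)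
    simp only [Fin.sum_univ_succ, Fin.sum_univ_zero] at r0
    have key := neg_core_24 α hp' hN e5 e3 (by intro h; apply r0; simp; linear_combination h)
    rw [ratEval_div _ _ _ (by simp)]
    simp only [eval_add, eval_pow, eval_X, eval_one]
    exact not_prim_div 3 (by norm_num) (by rw [hc]; norm_num) one_ne_zero key

lemma neg_26 : ¬ memB 3 2 2 6 := by
  have : Fact (Nat.Prime 2) := ⟨Nat.prime_two⟩
  refine neg_of 2 6 (by norm_num) ?_
  intro L _ _ _ hc hp
  have hp' : (2 : L) = 0 := by exact_mod_cast hp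
  have hpX : (2 : L[X]) = 0 := by
    have : (C (2 : L)) = 0 := by rw [hp', C_0]
    rwa [C_ofNat] at this
  refine ⟨_, ups_mem (X ^ 2 + X + 1) 1 (X ^ 2 + X + 1) 0 one_ne_zero
    (by compute_degree!) (by simp) isCoprime_one_right (by ring) ⟨0, 1, ?_⟩ (by simp) ?_, ?_⟩
  · simp only [derivative_add, derivative_X_pow, derivative_one, derivative_X]
    simp only [Nat.cast_ofNat, map_ofNat]
    linear_combination X * hpX
  · apply not_unit_of_root
    have : (X ^ 2 + X + 1 : L[X]).natDegree = 2 := by compute_degree!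
    omega
  · intro α h1 h2
    have hN := prim_pow_eq h1 (N := 63) (by rw [hc]; norm_num)
    have e21 := prim_pow_ne h1 21 (by norm_num) (by rw [hc]; norm_num)
    have e9 := prim_pow_ne h1 9 (by norm_num) (by rw [hc]; norm_num)
    have r0 := normal_rel_ne h2 ![1, 1, 1, 1, 1, 1] 0 (by simp)
    have r1 := normal_rel_ne h2 ![1, 1, 0, 1, 1, 0] 0 (by simp)
    simp only [Fin.sum_univ_succ, Fin.sum_univ_zero] at r0 r1
    have key := neg_core_26 α hp' hN e21 e9 (by intro h; apply r0; simp; linear_combination h)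
      (by intro h; apply r1; simp; linear_combination h)
    rw [ratEval_div _ _ _ (by simp)]
    simp only [eval_add, eval_pow, eval_X, eval_one]
    rcases key with key | key
    · exact not_prim_div 9 (by norm_num) (by rw [hc]; norm_num) one_ne_zero key
    · exact not_prim_div 21 (by norm_num) (by rw [hc]; norm_num) one_ne_zero key

lemma neg_33 : ¬ memB 3 2 3 3 := by
  have : Fact (Nat.Prime 3) := ⟨Nat.prime_three⟩
  refine neg_of 3 3 (by norm_num) ?_
  intro L _ _ _ hc hp
  have hp' : (3 : L) = 0 := by exact_mod_cast hp
  have hpX : (3 : L[X]) = 0 := by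
    have : (C (3 : L)) = 0 := by rw [hp', C_0]
    rwa [C_ofNat] at this
  have hdeg : (-X ^ 2 - X + 1 : L[X]).natDegree = 2 := by compute_degree!
  have hne : (-X ^ 2 - X + 1 : L[X]) ≠ 0 := by
    intro h; rw [h] at hdeg; simp at hdeg
  refine ⟨_, ups_mem (X ^ 3) (-X ^ 2 - X + 1) (-X ^ 2 - X + 1) 3 hne
    (by compute_degree!) hdeg.le (IsCoprime.pow_left ⟨1 + X, 1, by ring⟩) (by ring)
    ⟨-1, -(X + 2), ?_⟩ (by simp) ?_, ?_⟩
  · simp only [derivative_add, derivative_sub, derivative_neg, derivative_X_pow, derivative_one,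
      derivative_X]
    simp only [Nat.cast_ofNat, map_ofNat]
    linear_combination (X ^ 2 + 2 * X) * hpX
  · apply not_unit_of_root
    omega
  · intro α h1 h2
    have hN := prim_pow_eq h1 (N := 26) (by rw [hc]; norm_num)
    have e13 := prim_pow_ne h1 13 (by norm_num) (by rw [hc]; norm_num)
    have e2 := prim_pow_ne h1 2 (by norm_num) (by rw [hc]; norm_num)
    have e8 := prim_pow_ne h1 8 (by norm_num) (by rw [hc]; norm_num)
    have r0 := normal_rel_ne h2 ![1, 1, 1] 0 (by simp)
    simp only [Fin.sum_univ_succ, Fin.sum_univ_zero] at r0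
    have key := neg_core_33 α hp' hN e13 e2 (by intro h; apply r0; simp; linear_combination h)
    have hy : -α ^ 2 - α + 1 ≠ 0 := by
      intro h
      have s1 : α ^ 2 = 1 - α := by linear_combination -h
      have s2 : α ^ 4 = -1 := by
        have : α ^ 4 = (1 - α) ^ 2 := by rw [← s1]; ring
        rw [this]; linear_combination s1 + (1 - α) * hp'
      apply e8
      have : α ^ 8 = (α ^ 4) ^ 2 := by ring
      rw [this, s2]; norm_num
    rw [ratEval_div _ _ _ (by simpa using hy)]
    simp only [eval_add, eval_sub, eval_neg, eval_pow, eval_X, eval_one]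
    exact not_prim_div 13 (by norm_num) (by rw [hc]; norm_num) hy key

lemma neg_34 : ¬ memB 3 2 3 4 := by
  have : Fact (Nat.Prime 3) := ⟨Nat.prime_three⟩
  refine neg_of 3 4 (by norm_num) ?_
  intro L _ _ _ hc hp
  have hp' : (3 : L) = 0 := by exact_mod_cast hp
  have hdeg : (X + 1 : L[X]).natDegree = 1 := by compute_degree!
  have hne : (X + 1 : L[X]) ≠ 0 := by
    intro h; rw [h] at hdeg; simp at hdeg
  refine ⟨_, ups_mem (X ^ 2) (X + 1) (X + 1) 2 hne
    (by compute_degree!) (by omega) ⟨1, 1 - X, by ring⟩ (by ring)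
    ⟨0, 1, by simp⟩ (by simp) ?_, ?_⟩
  · apply not_unit_of_root
    omega
  · intro α h1 h2
    have hN := prim_pow_eq h1 (N := 80) (by rw [hc]; norm_num)
    have e40 := prim_pow_ne h1 40 (by norm_num) (by rw [hc]; norm_num)
    have e2 := prim_pow_ne h1 2 (by norm_num) (by rw [hc]; norm_num)
    have e16 := prim_pow_ne h1 16 (by norm_num) (by rw [hc]; norm_num)
    have r0 := normal_rel_ne h2 ![1, 1, 1, 1] 0 (by simp)
    have r1 := normal_rel_ne h2 ![1, -1, 1, -1] 0 (by simp)
    have r2 := normal_rel_ne h2 ![1, 0, -1, 0] 0 (by simp)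
    simp only [Fin.sum_univ_succ, Fin.sum_univ_zero] at r0 r1 r2
    have key := neg_core_34 α hp' hN e40 e16 (by intro h; apply r0; simp; linear_combination h)
      (by intro h; apply r1; simp; linear_combination h)
      (by intro h; apply r2; simp; linear_combination h)
    have hy : α + 1 ≠ 0 := by
      intro h
      apply e2
      linear_combination (α - 1) * h
    rw [ratEval_div _ _ _ (by simpa using hy)]
    simp only [eval_add, eval_pow, eval_X, eval_one]
    rcases key with key | key | key | key
    · exact not_prim_div 5 (by norm_num) (by rw [hc]; norm_num) hy key
    · exact not_prim_div 8 (by norm_num) (by rw [hc]; norm_num) hy key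
    · exact not_prim_div 16 (by norm_num) (by rw [hc]; norm_num) hy key
    · exact not_prim_div 40 (by norm_num) (by rw [hc]; norm_num) hy key

theorem stmt19 :
    (∀ q n : ℕ, IsPrimePow q → 3 ≤ n →
      ¬ ((n = 3 ∧ ((q ≤ 37 ∧ q ≠ 8) ∨
            q ∈ ({43, 49, 61, 67, 71, 79, 81, 121, 151, 211, 331} : Finset ℕ))) ∨
         (n = 4 ∧ (q ≤ 37 ∨ q ∈ ({41, 43, 47, 83} : Finset ℕ))) ∨
         (n = 5 ∧ q ∈ ({3, 4, 5, 7, 9, 11, 16} : Finset ℕ)) ∨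
         (n = 6 ∧ q ∈ ({2, 3, 4, 5, 7, 9, 11, 13, 19} : Finset ℕ)) ∨
         (n = 7 ∧ q ∈ ({3, 4, 8} : Finset ℕ)) ∨
         (n = 8 ∧ q ∈ ({2, 3, 4, 5, 7, 9} : Finset ℕ)) ∨
         (q = 2 ∧ n ∈ ({9, 10, 12, 14, 15, 16, 18, 20, 24} : Finset ℕ)) ∨
         (q = 3 ∧ n ∈ ({9, 10, 12, 16} : Finset ℕ)) ∨
         (q = 4 ∧ n ∈ ({9, 10, 12} : Finset ℕ)) ∨
         ((q, n) ∈ ({(5, 12), (7, 12)} : Finset (ℕ × ℕ)))) →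
      memB 3 2 q n) ∧
    ¬ memB 3 2 2 3 ∧ ¬ memB 3 2 2 4 ∧ ¬ memB 3 2 2 6 ∧ ¬ memB 3 2 3 3 ∧ ¬ memB 3 2 3 4 := by
  refine ⟨fun q n hpp hn hexc => ?_, neg_23, neg_24, neg_26, neg_33, neg_34⟩
  by_cases hs : Special q n
  · exact special_ok q n hs
  · exact generic_ok q n hpp hn hexc hs
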